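/- (Güntürkün–Hochster) Let I ⊆ A = K[x_1,…,x_n] be a homogeneous ideal containing a regular sequence of five quadrics, i.e. a homogeneous regular sequence of degree a = (2,2,2,2,2). Then I satisfies EGH_{(2,2,2,2,2)}. -/

import Mathlib

open MvPolynomial

section Defs

variable {K : Type*} [Field K]

/-- Total degree of an exponent vector. -/
def expDeg {n : ℕ} (m : Fin n →₀ ℕ) : ℕ := ∑ i, m i

/-- `lexLe m m'` means `m ≤ m'` in the lexicographic order with `x_1 > x_2 > … > x_n`. -/
def lexLe {n : ℕ} (m m' : Fin n →₀ ℕ) : Prop :=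
  m = m' ∨ ∃ i : Fin n, (∀ j : Fin n, j < i → m j = m' j) ∧ m i < m' i

/-- A lex-segment in degree `d`: an upward (w.r.t. lex) closed set of degree-`d`
exponent vectors. -/
def IsLexSegment (n d : ℕ) (S : Set (Fin n →₀ ℕ)) : Prop :=
  (∀ m ∈ S, expDeg m = d) ∧
    ∀ m ∈ S, ∀ m' : Fin n →₀ ℕ, expDeg m' = d → lexLe m m' → m' ∈ S

/-- The pure-powers ideal `(x_1^{a_1}, …, x_r^{a_r})`. -/
noncomputable def purePowers (K : Type*) [Field K] {n r : ℕ} (hrn : r ≤ n)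
    (a : Fin r → ℕ) : Ideal (MvPolynomial (Fin n) K) :=
  Ideal.span (Set.range fun i : Fin r => X (Fin.castLE hrn i) ^ a i)

/-- A homogeneous ideal. -/
def IsHomog {n : ℕ} (I : Ideal (MvPolynomial (Fin n) K)) : Prop :=
  ∀ f ∈ I, ∀ d : ℕ, homogeneousComponent d f ∈ I

/-- The degree-`d` component of an ideal, as a `K`-subspace. -/
noncomputable def component {n : ℕ} (I : Ideal (MvPolynomial (Fin n) K)) (d : ℕ) :
    Submodule K (MvPolynomial (Fin n) K) :=
  Submodule.restrictScalars K I ⊓ homogeneousSubmodule (Fin n) K d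

/-- Hilbert function of an ideal: `dim_K I_d`. -/
noncomputable def hilb {n : ℕ} (I : Ideal (MvPolynomial (Fin n) K)) (d : ℕ) : ℕ :=
  Module.finrank K ↥(component I d)

/-- An `a`-lpp (lex-plus-powers) ideal: a homogeneous (monomial) ideal each of whose graded
components is the span of a lex-segment plus the corresponding component of the
pure-powers ideal. -/
def IsLPP {n r : ℕ} (hrn : r ≤ n) (a : Fin r → ℕ)
    (J : Ideal (MvPolynomial (Fin n) K)) : Prop :=
  IsHomog J ∧
    ∀ d : ℕ, ∃ S : Set (Fin n →₀ ℕ), IsLexSegment n d S ∧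
      component J d =
        Submodule.span K ((fun m => (monomial m (1 : K) : MvPolynomial (Fin n) K)) '' S)
          ⊔ component (purePowers K hrn a) d

/-- `I` satisfies `EGH_a(d)`. -/
def EGHd {n r : ℕ} (hrn : r ≤ n) (a : Fin r → ℕ)
    (I : Ideal (MvPolynomial (Fin n) K)) (d : ℕ) : Prop :=
  ∃ J : Ideal (MvPolynomial (Fin n) K), IsLPP hrn a J ∧
    hilb J d = hilb I d ∧ hilb J (d + 1) ≤ hilb I (d + 1)

/-- `I` satisfies `EGH_a`. -/
def EGH {n r : ℕ} (hrn : r ≤ n) (a : Fin r → ℕ)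
    (I : Ideal (MvPolynomial (Fin n) K)) : Prop :=
  ∀ d : ℕ, EGHd hrn a I d

/-- A monomial ideal. -/
def IsMonomialIdeal {n : ℕ} (I : Ideal (MvPolynomial (Fin n) K)) : Prop :=
  ∃ M : Set (Fin n →₀ ℕ),
    I = Ideal.span ((fun m => (monomial m (1 : K) : MvPolynomial (Fin n) K)) '' M)

/-- A strongly stable (monomial) ideal. -/
def IsStronglyStable {n : ℕ} (S : Ideal (MvPolynomial (Fin n) K)) : Prop :=
  IsMonomialIdeal S ∧
    ∀ (m : Fin n →₀ ℕ) (i j : Fin n), j ≤ i →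
      (monomial (m + Finsupp.single i 1) (1 : K) : MvPolynomial (Fin n) K) ∈ S →
      (monomial (m + Finsupp.single j 1) (1 : K) : MvPolynomial (Fin n) K) ∈ S

/-- An `a`-spp (strongly-stable-plus-powers) ideal. -/
def IsSPP {n r : ℕ} (hrn : r ≤ n) (a : Fin r → ℕ)
    (J : Ideal (MvPolynomial (Fin n) K)) : Prop :=
  ∃ S : Ideal (MvPolynomial (Fin n) K), IsStronglyStable S ∧ J = S ⊔ purePowers K hrn a

/-- A regular sequence: each `f i` is a non-zerodivisor modulo `(f j : j < i)`. -/
def IsRegSeq {n r : ℕ} (f : Fin r → MvPolynomial (Fin n) K) : Prop :=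
  ∀ i : Fin r, ∀ g : MvPolynomial (Fin n) K,
    g * f i ∈ Ideal.span { p | ∃ j : Fin r, j < i ∧ p = f j } →
    g ∈ Ideal.span { p | ∃ j : Fin r, j < i ∧ p = f j }

/-- `I` contains a homogeneous regular sequence of degree `a`. -/
def ContainsRegSeq {n r : ℕ} (a : Fin r → ℕ)
    (I : Ideal (MvPolynomial (Fin n) K)) : Prop :=
  ∃ f : Fin r → MvPolynomial (Fin n) K,
    (∀ i, f i ∈ I) ∧ IsRegSeq f ∧ ∀ i, (f i).IsHomogeneous (a i)

/-- `dim_K (N/P)` for ideals `P ≤ N` (the `K`-dimension of `N/(N ∩ P)`). -/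
noncomputable def quotDim (K : Type*) [Field K] {n : ℕ}
    (N P : Ideal (MvPolynomial (Fin n) K)) : ℕ :=
  Module.finrank K
    (↥(Submodule.restrictScalars K N) ⧸
      Submodule.comap (Submodule.restrictScalars K N).subtype (Submodule.restrictScalars K P))

/-- `dim_K (I/F)_d`. -/
noncomputable def relHilb {n : ℕ} (I F : Ideal (MvPolynomial (Fin n) K)) (d : ℕ) : ℕ :=
  Module.finrank K
    (↥(component I d) ⧸ Submodule.comap (component I d).subtype (Submodule.restrictScalars K F))

/-- `dim_K (A/I)_d`. -/
noncomputable def hilbQ {n : ℕ} (I : Ideal (MvPolynomial (Fin n) K)) (d : ℕ) : ℕ :=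
  Module.finrank K
    (↥(homogeneousSubmodule (Fin n) K d) ⧸
      Submodule.comap (homogeneousSubmodule (Fin n) K d).subtype (Submodule.restrictScalars K I))

end Defs

section HilbertFunction

variable {K : Type*} [Field K] {n : ℕ}

instance finite_homogeneousSubmodule (d : ℕ) :
    Module.Finite K (homogeneousSubmodule (Fin n) K d) :=
  Module.Finite.iff_fg.2 (homogeneousSubmodule_fg (Fin n) K d)

lemma component_le (I : Ideal (MvPolynomial (Fin n) K)) (d : ℕ) :
    component I d ≤ homogeneousSubmodule (Fin n) K d := inf_le_right

instance finite_component (I : Ideal (MvPolynomial (Fin n) K)) (d : ℕ) :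
    Module.Finite K (component I d) :=
  Submodule.finiteDimensional_of_le (component_le I d)

lemma mem_component {I : Ideal (MvPolynomial (Fin n) K)} {d : ℕ} {f : MvPolynomial (Fin n) K} :
    f ∈ component I d ↔ f ∈ I ∧ f.IsHomogeneous d := by
  simp [component, mem_homogeneousSubmodule]

/-- The Hilbert function of the quotient by an ideal, as a difference of dimensions. -/
noncomputable def hilbCodim (I : Ideal (MvPolynomial (Fin n) K)) (d : ℕ) : ℕ :=
  Module.finrank K (homogeneousSubmodule (Fin n) K d) - hilb I d

lemma component_mono {I J : Ideal (MvPolynomial (Fin n) K)} (h : I ≤ J) (d : ℕ) :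
    component I d ≤ component J d :=
  inf_le_inf_right _ h

lemma hilb_mono {I J : Ideal (MvPolynomial (Fin n) K)} (h : I ≤ J) (d : ℕ) :
    hilb I d ≤ hilb J d :=
  Submodule.finrank_mono (component_mono h d)

lemma hilb_le (I : Ideal (MvPolynomial (Fin n) K)) (d : ℕ) :
    hilb I d ≤ Module.finrank K (homogeneousSubmodule (Fin n) K d) :=
  Submodule.finrank_mono (component_le I d)

lemma hilbCodim_add_hilb (I : Ideal (MvPolynomial (Fin n) K)) (d : ℕ) :
    hilbCodim I d + hilb I d = Module.finrank K (homogeneousSubmodule (Fin n) K d) :=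
  Nat.sub_add_cancel (hilb_le I d)

lemma hilbCodim_anti {I J : Ideal (MvPolynomial (Fin n) K)} (h : I ≤ J) (d : ℕ) :
    hilbCodim J d ≤ hilbCodim I d :=
  Nat.sub_le_sub_left (hilb_mono h d) _

lemma hilbCodim_eq_zero_iff {I : Ideal (MvPolynomial (Fin n) K)} {d : ℕ} :
    hilbCodim I d = 0 ↔ ∀ f : MvPolynomial (Fin n) K, f.IsHomogeneous d → f ∈ I := by
  have h := hilbCodim_add_hilb I d
  constructor
  · intro h0 f hf
    have : component I d = homogeneousSubmodule (Fin n) K d :=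
      Submodule.eq_of_le_of_finrank_eq (component_le I d) (by rw [h0, zero_add] at h; exact h)
    exact (mem_component.1 (this ▸ (mem_homogeneousSubmodule d f).2 hf)).1
  · intro hf
    have : component I d = homogeneousSubmodule (Fin n) K d :=
      le_antisymm (component_le I d) fun f hfd => mem_component.2 ⟨hf f hfd, hfd⟩
    rw [hilbCodim, hilb, this, Nat.sub_self]

lemma IsHomog.sup {I J : Ideal (MvPolynomial (Fin n) K)} (hI : IsHomog I) (hJ : IsHomog J) :
    IsHomog (I ⊔ J) := by
  intro f hf d
  obtain ⟨a, ha, b, hb, rfl⟩ := Submodule.mem_sup.1 hf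
  rw [map_add]
  exact Submodule.add_mem_sup (hI a ha d) (hJ b hb d)

lemma isHomog_span {S : Set (MvPolynomial (Fin n) K)} (h : ∀ s ∈ S, ∃ e, s.IsHomogeneous e) :
    IsHomog (Ideal.span S) := by
  let := MvPolynomial.gradedAlgebra (R := K) (σ := Fin n)
  have : (Ideal.span S).IsHomogeneous (homogeneousSubmodule (Fin n) K) :=
    Ideal.homogeneous_span _ _ fun s hs => h s hs
  intro f hf d
  exact homogeneousComponent_mem_of_mem this hf d

lemma IsHomog.sup_span {I : Ideal (MvPolynomial (Fin n) K)} (hI : IsHomog I)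
    {g : MvPolynomial (Fin n) K} {e : ℕ} (hg : g.IsHomogeneous e) :
    IsHomog (I ⊔ Ideal.span {g}) :=
  hI.sup (isHomog_span fun s hs => ⟨e, by rwa [Set.mem_singleton_iff.1 hs]⟩)

lemma homogeneousComponent_mul_add {g : MvPolynomial (Fin n) K} {e : ℕ}
    (hg : g.IsHomogeneous e) (f : MvPolynomial (Fin n) K) (d : ℕ) :
    homogeneousComponent (d + e) (g * f) = g * homogeneousComponent d f := by
  conv_lhs => rw [← sum_homogeneousComponent f, Finset.mul_sum, map_sum]
  have key : ∀ i, homogeneousComponent (d + e) (g * homogeneousComponent i f)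
      = if i = d then g * homogeneousComponent d f else 0 := by
    intro i
    have h := hg.mul (homogeneousComponent_isHomogeneous i f)
    rw [homogeneousComponent_of_mem ((mem_homogeneousSubmodule _ _).2 h)]
    split_ifs with h1 h2 h2
    · rw [h2]
    · omega
    · omega
    · rfl
  simp_rw [key]
  rw [Finset.sum_ite_eq']
  split_ifs with h
  · rfl
  · rw [homogeneousComponent_eq_zero, mul_zero]
    simp at h
    omega

/-- The colon ideal `I : g`. -/
noncomputable def colonBy (I : Ideal (MvPolynomial (Fin n) K)) (g : MvPolynomial (Fin n) K) :
    Ideal (MvPolynomial (Fin n) K) :=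
  Submodule.comap (LinearMap.mulLeft (MvPolynomial (Fin n) K) g) I

lemma mem_colonBy {I : Ideal (MvPolynomial (Fin n) K)} {g f : MvPolynomial (Fin n) K} :
    f ∈ colonBy I g ↔ g * f ∈ I := Iff.rfl

lemma le_colonBy (I : Ideal (MvPolynomial (Fin n) K)) (g : MvPolynomial (Fin n) K) :
    I ≤ colonBy I g := fun _ hf => I.mul_mem_left g hf

lemma colonBy_mono {I J : Ideal (MvPolynomial (Fin n) K)} (h : I ≤ J)
    (g : MvPolynomial (Fin n) K) : colonBy I g ≤ colonBy J g := fun _ hf => h hf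

lemma IsHomog.colonBy {I : Ideal (MvPolynomial (Fin n) K)} (hI : IsHomog I)
    {g : MvPolynomial (Fin n) K} {e : ℕ} (hg : g.IsHomogeneous e) : IsHomog (colonBy I g) := by
  intro f hf d
  rw [mem_colonBy, ← homogeneousComponent_mul_add hg]
  exact hI _ hf _

lemma component_sup_span {I : Ideal (MvPolynomial (Fin n) K)} (hI : IsHomog I)
    {g : MvPolynomial (Fin n) K} {e : ℕ} (hg : g.IsHomogeneous e) (d : ℕ) :
    component (I ⊔ Ideal.span {g}) (d + e) = component I (d + e) ⊔
      (homogeneousSubmodule (Fin n) K d).map (LinearMap.mulLeft K g) := by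
  apply le_antisymm
  · intro f hf
    obtain ⟨hf, hfd⟩ := mem_component.1 hf
    obtain ⟨a, ha, b, hb, rfl⟩ := Submodule.mem_sup.1 hf
    obtain ⟨c, rfl⟩ := Ideal.mem_span_singleton.1 hb
    have h : homogeneousComponent (d + e) (a + g * c) = a + g * c := by
      rw [homogeneousComponent_of_mem ((mem_homogeneousSubmodule _ _).2 hfd), if_pos rfl]
    rw [← h, map_add, homogeneousComponent_mul_add hg]
    exact Submodule.add_mem_sup
      (mem_component.2 ⟨hI a ha _, homogeneousComponent_isHomogeneous _ _⟩)
      ⟨_, homogeneousComponent_isHomogeneous d c, rfl⟩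
  · refine sup_le (component_mono le_sup_left _) ?_
    rintro _ ⟨c, hc, rfl⟩
    refine mem_component.2 ⟨Ideal.mem_sup_right (Ideal.mem_span_singleton.2 ⟨c, rfl⟩), ?_⟩
    rw [add_comm]
    exact hg.mul hc

lemma component_sup_span_of_lt {I : Ideal (MvPolynomial (Fin n) K)} (hI : IsHomog I)
    {g : MvPolynomial (Fin n) K} {e : ℕ} (hg : g.IsHomogeneous e) {d : ℕ} (hd : d < e) :
    component (I ⊔ Ideal.span {g}) d = component I d := by
  refine le_antisymm ?_ (component_mono le_sup_left _)
  intro f hf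
  obtain ⟨hf, hfd⟩ := mem_component.1 hf
  obtain ⟨a, ha, b, hb, rfl⟩ := Submodule.mem_sup.1 hf
  obtain ⟨c, rfl⟩ := Ideal.mem_span_singleton.1 hb
  have h : homogeneousComponent d (a + g * c) = a + g * c := by
    rw [homogeneousComponent_of_mem ((mem_homogeneousSubmodule _ _).2 hfd), if_pos rfl]
  have h0 : homogeneousComponent d (g * c) = 0 := by
    rw [← sum_homogeneousComponent c, Finset.mul_sum, map_sum]
    refine Finset.sum_eq_zero fun i _ => ?_
    rw [homogeneousComponent_of_mem
      ((mem_homogeneousSubmodule _ _).2 (hg.mul (homogeneousComponent_isHomogeneous i c))),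
      if_neg (by omega)]
  rw [← h, map_add, h0, add_zero]
  exact mem_component.2 ⟨hI a ha _, homogeneousComponent_isHomogeneous _ _⟩

lemma hilbCodim_sup_span_of_lt {I : Ideal (MvPolynomial (Fin n) K)} (hI : IsHomog I)
    {g : MvPolynomial (Fin n) K} {e : ℕ} (hg : g.IsHomogeneous e) {d : ℕ} (hd : d < e) :
    hilbCodim (I ⊔ Ideal.span {g}) d = hilbCodim I d := by
  rw [hilbCodim, hilbCodim, hilb, hilb, component_sup_span_of_lt hI hg hd]

/-- Additivity of the Hilbert function along `0 → A/(I : g)(-e) → A/I → A/(I, g) → 0`. -/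
lemma hilbCodim_add {I : Ideal (MvPolynomial (Fin n) K)} (hI : IsHomog I)
    {g : MvPolynomial (Fin n) K} {e : ℕ} (hg : g.IsHomogeneous e) (hg0 : g ≠ 0) (d : ℕ) :
    hilbCodim I (d + e) = hilbCodim (I ⊔ Ideal.span {g}) (d + e) + hilbCodim (colonBy I g) d := by
  have hinj : Function.Injective (LinearMap.mulLeft K g) := fun a b h =>
    mul_left_cancel₀ hg0 h
  have hinf : component I (d + e) ⊓ (homogeneousSubmodule (Fin n) K d).map (LinearMap.mulLeft K g)
      = (component (colonBy I g) d).map (LinearMap.mulLeft K g) := by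
    ext f
    constructor
    · rintro ⟨hf, c, hc, rfl⟩
      exact ⟨c, mem_component.2 ⟨(mem_component.1 hf).1, hc⟩, rfl⟩
    · rintro ⟨c, hc, rfl⟩
      obtain ⟨h1, h2⟩ := mem_component.1 hc
      refine ⟨mem_component.2 ⟨h1, ?_⟩, c, h2, rfl⟩
      rw [add_comm]
      exact hg.mul h2
  have h := Submodule.finrank_sup_add_finrank_inf_eq (component I (d + e))
    ((homogeneousSubmodule (Fin n) K d).map (LinearMap.mulLeft K g))
  have hmap : ∀ p : Submodule K (MvPolynomial (Fin n) K),
      Module.finrank K (p.map (LinearMap.mulLeft K g)) = Module.finrank K p := fun p =>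
    (Submodule.equivMapOfInjective _ hinj p).finrank_eq.symm
  rw [hinf, ← component_sup_span hI hg, hmap, hmap] at h
  have h1 := hilbCodim_add_hilb I (d + e)
  have h2 := hilbCodim_add_hilb (I ⊔ Ideal.span {g}) (d + e)
  have h3 := hilbCodim_add_hilb (colonBy I g) d
  simp only [hilb] at h1 h2 h3
  omega

end HilbertFunction

section RegularElements

variable {R : Type*} [CommRing R]

/-- `g` is a nonzerodivisor modulo `J`. -/
def RegMod (J : Ideal R) (g : R) : Prop := ∀ u, g * u ∈ J → u ∈ J

lemma RegMod.swap {J : Ideal R} {a b : R} (ha : RegMod J a)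
    (hb : RegMod (J ⊔ Ideal.span {a}) b) : RegMod (J ⊔ Ideal.span {b}) a := by
  intro u hu
  obtain ⟨j, hj, c, hc, h⟩ := Submodule.mem_sup.1 hu
  obtain ⟨c, rfl⟩ := Ideal.mem_span_singleton.1 hc
  have h1 : c ∈ J ⊔ Ideal.span {a} := by
    refine hb c (Submodule.mem_sup.2 ⟨-j, J.neg_mem hj, a * u, ?_, ?_⟩)
    · exact Ideal.mem_span_singleton.2 ⟨u, rfl⟩
    · rw [← h]; ring
  obtain ⟨j', hj', e, he, rfl⟩ := Submodule.mem_sup.1 h1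
  obtain ⟨e, rfl⟩ := Ideal.mem_span_singleton.1 he
  have h2 : u - b * e ∈ J := by
    apply ha
    have : a * (u - b * e) = j + b * j' := by rw [mul_sub, ← h]; ring
    rw [this]
    exact J.add_mem hj (J.mul_mem_left _ hj')
  refine Submodule.mem_sup.2 ⟨_, h2, b * e, Ideal.mem_span_singleton.2 ⟨e, rfl⟩, by ring⟩

lemma exists_finite_primes_of_not_regMod [IsNoetherianRing R] (J : Ideal R) :
    ∃ S : Set (Ideal R), S.Finite ∧ (∀ v, (∀ P ∈ S, v ∉ P) → RegMod J v) ∧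
      ∀ P ∈ S, P.IsPrime ∧ ∃ u, u ∉ J ∧ ∀ r, r ∈ P ↔ r * u ∈ J := by
  refine ⟨associatedPrimes R (R ⧸ J), associatedPrimes.finite R (R ⧸ J), ?_, ?_⟩
  · intro v hv u hu
    by_contra hu'
    have h : v ∈ { r : R | ∃ x : R ⧸ J, x ≠ 0 ∧ r • x = 0 } := by
      refine ⟨Ideal.Quotient.mk J u, fun h => hu' (Ideal.Quotient.eq_zero_iff_mem.1 h), ?_⟩
      exact Ideal.Quotient.eq_zero_iff_mem.2 hu
    rw [← biUnion_associatedPrimes_eq_zero_divisors] at h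
    obtain ⟨P, hP, hvP⟩ := Set.mem_iUnion₂.1 h
    exact hv P hP hvP
  · intro P hP
    rw [AssociatedPrimes.mem_iff, isAssociatedPrime_iff] at hP
    obtain ⟨hP, x, rfl⟩ := hP
    refine ⟨hP, ?_⟩
    obtain ⟨u, rfl⟩ := Ideal.Quotient.mk_surjective x
    have key : ∀ r, r ∈ Submodule.colon (⊥ : Submodule R (R ⧸ J)) {Ideal.Quotient.mk J u} ↔
        r * u ∈ J := by
      intro r
      rw [Submodule.mem_colon_singleton, Submodule.mem_bot]
      exact Ideal.Quotient.eq_zero_iff_mem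
    refine ⟨u, fun hu => hP.ne_top ((Ideal.eq_top_iff_one _).2 ((key 1).2 ?_)), key⟩
    rwa [one_mul]

end RegularElements

lemma exists_mem_forall_notMem {K V : Type*} [Field K] [Infinite K] [AddCommGroup V] [Module K V]
    (W : Submodule K V) {S : Set (Submodule K V)} (hS : S.Finite) (h : ∀ B ∈ S, ¬ W ≤ B) :
    ∃ v ∈ W, ∀ B ∈ S, v ∉ B := by
  have hfin : (Submodule.comap W.subtype '' S).Finite := hS.image _
  have := Subspace.biUnion_ne_univ_of_top_notMem (k := K) (s := hfin.toFinset) (by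
    intro hmem
    obtain ⟨B, hB, hB'⟩ := hfin.mem_toFinset.1 hmem
    exact h B hB (Submodule.comap_subtype_eq_top.1 hB'))
  obtain ⟨v, hv⟩ := (Set.ne_univ_iff_exists_notMem _).1 this
  refine ⟨v, v.2, fun B hB hvB => hv ?_⟩
  exact Set.mem_iUnion₂.2 ⟨B.comap W.subtype, hfin.mem_toFinset.2 ⟨B, hB, rfl⟩, hvB⟩

section LinearForms

variable {K : Type*} [Field K] {n : ℕ}

lemma linear_eq_sum {f : MvPolynomial (Fin n) K} (hf : f.IsHomogeneous 1) :
    ∃ c : Fin n → K, f = ∑ i, C (c i) * X i := by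
  have h : f ∈ Submodule.span K (Set.range (X : Fin n → MvPolynomial (Fin n) K)) := by
    rw [← homogeneousSubmodule_one_eq_span_X]
    exact (mem_homogeneousSubmodule 1 f).2 hf
  obtain ⟨c, rfl⟩ := (Submodule.mem_span_range_iff_exists_fun K).1 h
  exact ⟨c, by simp [smul_eq_C_mul]⟩

lemma finrank_homogeneousSubmodule_one :
    Module.finrank K (homogeneousSubmodule (Fin n) K 1) = n := by
  rw [homogeneousSubmodule_one_eq_span_X, finrank_span_eq_card, Fintype.card_fin]
  exact MvPolynomial.linearIndependent_X (Fin n) K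

/-- An ideal generated by linear forms is prime, and has no further linear forms. -/
lemma linear_span_aux {Λ : Submodule K (MvPolynomial (Fin n) K)}
    (hΛ : Λ ≤ homogeneousSubmodule (Fin n) K 1) :
    (Ideal.span (Λ : Set (MvPolynomial (Fin n) K))).IsPrime ∧
      ∀ l : MvPolynomial (Fin n) K, l.IsHomogeneous 1 →
        l ∈ Ideal.span (Λ : Set (MvPolynomial (Fin n) K)) → l ∈ Λ := by
  obtain ⟨Λ', hc⟩ := Submodule.exists_isCompl Λ
  let π := Submodule.projection Λ' Λ hc.symm
  let φ : MvPolynomial (Fin n) K →ₐ[K] MvPolynomial (Fin n) K := aeval fun i => π (X i)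
  have hlin : ∀ l : MvPolynomial (Fin n) K, l.IsHomogeneous 1 → φ l = π l := by
    intro l hl
    obtain ⟨c, rfl⟩ := linear_eq_sum hl
    simp only [map_sum, ← smul_eq_C_mul, map_smul, φ, aeval_X]
  have hmod : ∀ f, f - φ f ∈ Ideal.span (Λ : Set (MvPolynomial (Fin n) K)) := by
    intro f
    rw [← Ideal.Quotient.eq]
    have : (Ideal.Quotient.mkₐ K (Ideal.span (Λ : Set (MvPolynomial (Fin n) K)))) =
        (Ideal.Quotient.mkₐ K _).comp φ := by
      apply MvPolynomial.algHom_ext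
      intro i
      simp only [Ideal.Quotient.mkₐ_eq_mk, AlgHom.comp_apply, φ, aeval_X]
      rw [Ideal.Quotient.eq]
      apply Ideal.subset_span
      have h := Submodule.projection_add_projection_eq_self hc (X i)
      have h2 : (X i : MvPolynomial (Fin n) K) - π (X i) = Submodule.projection Λ Λ' hc (X i) := by
        rw [sub_eq_iff_eq_add]; exact h.symm
      rw [h2]
      exact Submodule.projection_apply_mem hc _
    exact DFunLike.congr_fun this f
  have hker : RingHom.ker φ = Ideal.span (Λ : Set (MvPolynomial (Fin n) K)) := by
    apply le_antisymm
    · intro f hf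
      have := hmod f
      rwa [(RingHom.mem_ker).1 hf, sub_zero] at this
    · rw [Ideal.span_le]
      intro l hl
      change φ l = 0
      rw [hlin l (hΛ hl)]
      exact (Submodule.projection_apply_eq_zero_iff hc.symm).2 hl
  constructor
  · rw [← hker]
    exact RingHom.ker_isPrime _
  · intro l hl h
    rw [← hker] at h
    have h : φ l = 0 := h
    rw [hlin l hl] at h
    exact (Submodule.projection_apply_eq_zero_iff hc.symm).1 h

end LinearForms

section CompleteIntersections

variable {K : Type*} [Field K] {n : ℕ}

/-- `IsCI a b J` says that `J` is generated by `b` independent linear forms followed by `a`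
quadrics, each regular modulo the previous generators. -/
inductive IsCI : ℕ → ℕ → Ideal (MvPolynomial (Fin n) K) → Prop
  | base (Λ : Submodule K (MvPolynomial (Fin n) K))
      (hΛ : Λ ≤ homogeneousSubmodule (Fin n) K 1) (b : ℕ) (hb : Module.finrank K Λ = b) :
      IsCI 0 b (Ideal.span (Λ : Set (MvPolynomial (Fin n) K)))
  | quad {a b : ℕ} {J : Ideal (MvPolynomial (Fin n) K)} (hJ : IsCI a b J)
      {g : MvPolynomial (Fin n) K} (hg : g.IsHomogeneous 2) (hreg : RegMod J g) :
      IsCI (a + 1) b (J ⊔ Ideal.span {g})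

lemma IsCI.isHomog {a b : ℕ} {J : Ideal (MvPolynomial (Fin n) K)} (h : IsCI a b J) :
    IsHomog J := by
  induction h with
  | base Λ hΛ b hb => exact isHomog_span fun s hs => ⟨1, hΛ hs⟩
  | quad hJ hg hreg ih => exact ih.sup_span hg

/-- `v` generates the socle modulo `J`, as a vector space. -/
def SocGen (J : Ideal (MvPolynomial (Fin n) K)) (v : MvPolynomial (Fin n) K) : Prop :=
  ∀ u, (∀ i, X i * u ∈ J) → ∃ c : K, u - C c * v ∈ J

lemma soc_exchange_aux {J : Ideal (MvPolynomial (Fin n) K)} {a b u w : MvPolynomial (Fin n) K}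
    (ha : RegMod J a) (h : ∀ i, X i * u ∈ J ⊔ Ideal.span {a}) (huw : b * u - a * w ∈ J)
    (i : Fin n) :
    X i * w ∈ J ⊔ Ideal.span {b} := by
  obtain ⟨j, hj, t, ht, hjt⟩ := Submodule.mem_sup.1 (h i)
  obtain ⟨t, rfl⟩ := Ideal.mem_span_singleton.1 ht
  have h1 : X i * w - b * t ∈ J := by
    apply ha
    have : a * (X i * w - b * t) = b * j - X i * (b * u - a * w) := by
      have : a * t = X i * u - j := by rw [← hjt]; ring
      linear_combination (-b) * this
    rw [this]
    exact J.sub_mem (J.mul_mem_left _ hj) (J.mul_mem_left _ huw)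
  exact Submodule.mem_sup.2 ⟨_, h1, b * t, Ideal.mem_span_singleton.2 ⟨t, rfl⟩, by ring⟩

lemma mul_mem_of_forall_X_mul_mem {J : Ideal (MvPolynomial (Fin n) K)}
    {u : MvPolynomial (Fin n) K} (h : ∀ i, X i * u ∈ J) {f : MvPolynomial (Fin n) K}
    (hf : f ∈ Ideal.span (Set.range (X : Fin n → MvPolynomial (Fin n) K))) : f * u ∈ J := by
  have : Ideal.span (Set.range (X : Fin n → MvPolynomial (Fin n) K)) ≤ colonBy J u := by
    rw [Ideal.span_le]
    rintro _ ⟨i, rfl⟩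
    change u * X i ∈ J
    rw [mul_comm]
    exact h i
  rw [mul_comm]
  exact this hf

lemma mem_irrelevant {f : MvPolynomial (Fin n) K} {d : ℕ} (hf : f.IsHomogeneous d) (hd : d ≠ 0) :
    f ∈ Ideal.span (Set.range (X : Fin n → MvPolynomial (Fin n) K)) := by
  rw [← Set.image_univ, mem_ideal_span_X_image]
  intro m hm
  have h := hf (mem_support_iff.1 hm)
  by_contra! h0
  apply hd
  rw [← h]
  have : m = 0 := by
    ext i
    simpa using h0 i
  simp [this]

/-- Elements `a`, `b` regular modulo `J` give linked socles: every socle element modulo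
`(J, a)` corresponds to one modulo `(J, b)`. -/
lemma exists_linked {J : Ideal (MvPolynomial (Fin n) K)} {a b u : MvPolynomial (Fin n) K}
    {e : ℕ} (hb : b.IsHomogeneous e) (he : e ≠ 0) (ha : RegMod J a)
    (h : ∀ i, X i * u ∈ J ⊔ Ideal.span {a}) :
    ∃ w, b * u - a * w ∈ J ∧ ∀ i, X i * w ∈ J ⊔ Ideal.span {b} := by
  obtain ⟨j, hj, t, ht, hjt⟩ :=
    Submodule.mem_sup.1 (mul_mem_of_forall_X_mul_mem h (mem_irrelevant hb he))
  obtain ⟨t, rfl⟩ := Ideal.mem_span_singleton.1 ht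
  have h1 : b * u - a * t ∈ J := by rw [← hjt, add_sub_cancel_right]; exact hj
  exact ⟨t, h1, soc_exchange_aux ha h h1⟩

lemma SocGen.exchange {J : Ideal (MvPolynomial (Fin n) K)} {a b v : MvPolynomial (Fin n) K}
    {d e : ℕ} (ha : a.IsHomogeneous d) (hb : b.IsHomogeneous e) (hd : d ≠ 0) (he : e ≠ 0)
    (hra : RegMod J a) (hrb : RegMod J b) (hv : ∀ i, X i * v ∈ J ⊔ Ideal.span {b})
    (h : SocGen (J ⊔ Ideal.span {b}) v) :
    ∃ u, (∀ i, X i * u ∈ J ⊔ Ideal.span {a}) ∧ SocGen (J ⊔ Ideal.span {a}) u := by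
  obtain ⟨u₀, hu₀, hs⟩ := exists_linked ha hd hrb hv
  refine ⟨u₀, hs, fun u hu => ?_⟩
  obtain ⟨w, hw, hsw⟩ := exists_linked hb he hra hu
  obtain ⟨c, hc⟩ := h w hsw
  obtain ⟨j, hj, t, ht, hjt⟩ := Submodule.mem_sup.1 hc
  obtain ⟨t, rfl⟩ := Ideal.mem_span_singleton.1 ht
  refine ⟨c, ?_⟩
  have h1 : u - C c * u₀ - a * t ∈ J := by
    apply hrb
    have : b * (u - C c * u₀ - a * t) =
        (b * u - a * w) + C c * (a * v - b * u₀) + a * j := by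
      linear_combination (-a) * hjt
    rw [this]
    exact J.add_mem (J.add_mem hw (J.mul_mem_left _ hu₀)) (J.mul_mem_left _ hj)
  exact Submodule.mem_sup.2 ⟨_, h1, a * t, Ideal.mem_span_singleton.2 ⟨t, rfl⟩, by ring⟩

lemma soc_eq_zero_exchange {J : Ideal (MvPolynomial (Fin n) K)} {a b : MvPolynomial (Fin n) K}
    {e : ℕ} (hb : b.IsHomogeneous e) (he : e ≠ 0)
    (hra : RegMod J a) (hrb : RegMod J b)
    (h : ∀ v, (∀ i, X i * v ∈ J ⊔ Ideal.span {b}) → v ∈ J ⊔ Ideal.span {b})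
    (u : MvPolynomial (Fin n) K) (hu : ∀ i, X i * u ∈ J ⊔ Ideal.span {a}) :
    u ∈ J ⊔ Ideal.span {a} := by
  obtain ⟨w, hw, hsw⟩ := exists_linked hb he hra hu
  obtain ⟨j, hj, t, ht, hjt⟩ := Submodule.mem_sup.1 (h w hsw)
  obtain ⟨t, rfl⟩ := Ideal.mem_span_singleton.1 ht
  have h1 : u - a * t ∈ J := by
    apply hrb
    have : b * (u - a * t) = (b * u - a * w) + a * j := by
      linear_combination (-a) * hjt
    rw [this]
    exact J.add_mem hw (J.mul_mem_left _ hj)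
  exact Submodule.mem_sup.2 ⟨_, h1, a * t, Ideal.mem_span_singleton.2 ⟨t, rfl⟩, by ring⟩

/-- Avoiding finitely many subspaces guarantees regularity, when the socle vanishes. -/
lemma exists_bad_subspaces {J : Ideal (MvPolynomial (Fin n) K)}
    (h : ∀ u, (∀ i, X i * u ∈ J) → u ∈ J) :
    ∃ S : Set (Submodule K (MvPolynomial (Fin n) K)), S.Finite ∧
      (∀ v, (∀ B ∈ S, v ∉ B) → RegMod J v) ∧
      ∀ B ∈ S, ∃ P : Ideal (MvPolynomial (Fin n) K), P.IsPrime ∧ J ≤ P ∧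
        B = P.restrictScalars K ∧ ∃ i, X i ∉ P := by
  obtain ⟨S, hS, h1, h2⟩ := exists_finite_primes_of_not_regMod J
  refine ⟨Submodule.restrictScalars K '' S, hS.image _, ?_, ?_⟩
  · intro v hv
    exact h1 v fun P hP hvP => hv _ ⟨P, hP, rfl⟩ hvP
  · rintro _ ⟨P, hP, rfl⟩
    obtain ⟨hPp, u, hu, hPu⟩ := h2 P hP
    refine ⟨P, hPp, fun j hj => (hPu j).2 (J.mul_mem_right _ hj), rfl, ?_⟩
    by_contra! hX
    exact hu (h u fun i => (hPu _).1 (hX i))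

lemma span_sup_span_singleton (Λ : Submodule K (MvPolynomial (Fin n) K))
    (l : MvPolynomial (Fin n) K) :
    Ideal.span (Λ : Set (MvPolynomial (Fin n) K)) ⊔ Ideal.span {l} =
      Ideal.span ((Λ ⊔ Submodule.span K {l} : Submodule K (MvPolynomial (Fin n) K)) :
        Set (MvPolynomial (Fin n) K)) := by
  apply le_antisymm
  · refine sup_le (Ideal.span_mono (by exact_mod_cast le_sup_left (a := Λ))) ?_
    rw [Ideal.span_singleton_le_iff_mem]
    exact Ideal.subset_span (Submodule.mem_sup_right (Submodule.mem_span_singleton_self l))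
  · rw [Ideal.span_le]
    intro f hf
    obtain ⟨a, ha, b, hb, rfl⟩ := Submodule.mem_sup.1 hf
    obtain ⟨c, rfl⟩ := Submodule.mem_span_singleton.1 hb
    refine Submodule.add_mem_sup (Ideal.subset_span ha) ?_
    rw [smul_eq_C_mul]
    exact Ideal.mul_mem_left _ _ (Ideal.mem_span_singleton_self l)

lemma not_homogeneousSubmodule_one_le {P : Ideal (MvPolynomial (Fin n) K)} {i : Fin n}
    (hi : X i ∉ P) : ¬ homogeneousSubmodule (Fin n) K 1 ≤ P.restrictScalars K :=
  fun h => hi (h ((mem_homogeneousSubmodule _ _).2 (isHomogeneous_X K i)))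

lemma finrank_sup_span_singleton {V : Type*} [AddCommGroup V] [Module K V] {W : Submodule K V}
    [Module.Finite K W] {v : V} (hv : v ∉ W) :
    Module.finrank K (W ⊔ Submodule.span K {v} : Submodule K V) = Module.finrank K W + 1 := by
  have h := Submodule.finrank_sup_add_finrank_inf_eq W (Submodule.span K {v})
  have hv0 : v ≠ 0 := fun h => hv (h ▸ W.zero_mem)
  have h0 : W ⊓ Submodule.span K {v} = ⊥ := by
    rw [← disjoint_iff, Submodule.disjoint_span_singleton' hv0]
    exact hv
  rw [h0, finrank_bot, finrank_span_singleton hv0] at h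
  exact h

section

variable [Infinite K]

theorem IsCI.main (a : ℕ) : ∀ (b : ℕ) (J : Ideal (MvPolynomial (Fin n) K)), IsCI a b J →
    (a + b < n → (∀ u, (∀ i, X i * u ∈ J) → u ∈ J) ∧
      ∃ S : Set (Submodule K (MvPolynomial (Fin n) K)), S.Finite ∧
        (∀ B ∈ S, ¬ homogeneousSubmodule (Fin n) K 1 ≤ B) ∧
        ∀ l : MvPolynomial (Fin n) K, l.IsHomogeneous 1 → (∀ B ∈ S, l ∉ B) →
          RegMod J l ∧ IsCI a (b + 1) (J ⊔ Ideal.span {l})) ∧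
    (a + b = n → ∃ v, (∀ i, X i * v ∈ J) ∧ SocGen J v) := by
  induction a with
  | zero =>
    rintro b J (⟨Λ, hΛ, _, hb⟩)
    have : Module.Finite K Λ := Submodule.finiteDimensional_of_le hΛ
    obtain ⟨hprime, hlin⟩ := linear_span_aux hΛ
    have hreg : ∀ l : MvPolynomial (Fin n) K, l.IsHomogeneous 1 → l ∉ Λ →
        RegMod (Ideal.span (Λ : Set (MvPolynomial (Fin n) K))) l := by
      intro l hl hlΛ u hu
      exact (hprime.mem_or_mem hu).resolve_left fun h => hlΛ (hlin l hl h)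
    constructor
    · intro hbn
      have hne : ¬ homogeneousSubmodule (Fin n) K 1 ≤ Λ := by
        intro h
        have h1 := le_antisymm h hΛ
        have h2 := finrank_homogeneousSubmodule_one (K := K) (n := n)
        rw [h1, hb] at h2
        omega
      refine ⟨?_, {Λ}, Set.finite_singleton Λ, ?_, ?_⟩
      · intro u hu
        obtain ⟨l, hl, hlΛ⟩ := SetLike.not_le_iff_exists.1 hne
        exact hreg l hl hlΛ u
          (mul_mem_of_forall_X_mul_mem hu (mem_irrelevant (d := 1) hl one_ne_zero))
      · rintro _ rfl
        exact hne
      · intro l hl hlB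
        have hlΛ := hlB Λ rfl
        refine ⟨hreg l hl hlΛ, ?_⟩
        rw [span_sup_span_singleton]
        refine IsCI.base _ (sup_le hΛ ?_) _ ?_
        · rwa [Submodule.span_singleton_le_iff_mem]
        · rw [finrank_sup_span_singleton hlΛ, hb]
    · intro hbn
      have h1 : Λ = homogeneousSubmodule (Fin n) K 1 := by
        apply Submodule.eq_of_le_of_finrank_eq hΛ
        rw [finrank_homogeneousSubmodule_one]
        omega
      have hX : ∀ i : Fin n, X i ∈ Ideal.span (Λ : Set (MvPolynomial (Fin n) K)) := fun i => by
        apply Ideal.subset_span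
        rw [h1]
        exact isHomogeneous_X K i
      refine ⟨1, fun i => by rw [mul_one]; exact hX i, fun u _ => ⟨coeff 0 u, ?_⟩⟩
      rw [mul_one]
      have h2 : Ideal.span (Set.range (X : Fin n → MvPolynomial (Fin n) K)) ≤
          Ideal.span (Λ : Set (MvPolynomial (Fin n) K)) := by
        rw [Ideal.span_le]
        rintro _ ⟨i, rfl⟩
        exact hX i
      apply h2
      rw [← Set.image_univ, mem_ideal_span_X_image]
      intro m hm
      by_contra! h0
      have hm0 : m = 0 := by
        ext i
        simpa using h0 i
      simp [hm0] at hm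
  | succ a ih =>
    intro b J hJ
    obtain _ | ⟨hJ, hg, hreg⟩ := hJ
    rename_i J g
    have ih0 := ih b J hJ
    have hpick : a + b < n → ∃ l : MvPolynomial (Fin n) K, l.IsHomogeneous 1 ∧ RegMod J l ∧
        IsCI a (b + 1) (J ⊔ Ideal.span {l}) := by
      intro hab
      obtain ⟨-, S, hS, hS1, hS2⟩ := ih0.1 hab
      obtain ⟨l, hl, hlS⟩ := exists_mem_forall_notMem _ hS hS1
      exact ⟨l, hl, hS2 l hl hlS⟩
    constructor
    · intro hab
      have hsoc : ∀ u, (∀ i, X i * u ∈ J ⊔ Ideal.span {g}) → u ∈ J ⊔ Ideal.span {g} := by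
        obtain ⟨l, hl, hlr, hlCI⟩ := hpick (by omega)
        exact soc_eq_zero_exchange hl one_ne_zero hreg hlr
          ((ih (b + 1) _ hlCI).1 (by omega)).1
      refine ⟨hsoc, ?_⟩
      obtain ⟨-, S, hS, hS1, hS2⟩ := ih0.1 (by omega)
      obtain ⟨S', hS', hS'1, hS'2⟩ := exists_bad_subspaces hsoc
      refine ⟨S ∪ S', hS.union hS', ?_, ?_⟩
      · rintro B (hB | hB)
        · exact hS1 B hB
        · obtain ⟨P, -, -, rfl, i, hi⟩ := hS'2 B hB
          exact not_homogeneousSubmodule_one_le hi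
      · intro l hl hlB
        obtain ⟨hr, hci⟩ := hS2 l hl fun B hB => hlB B (Or.inl hB)
        have hr' := hS'1 l fun B hB => hlB B (Or.inr hB)
        refine ⟨hr', ?_⟩
        rw [sup_right_comm]
        exact hci.quad hg (hreg.swap hr')
    · intro hab
      obtain ⟨l, hl, hlr, hlCI⟩ := hpick (by omega)
      obtain ⟨v, hv, hvs⟩ := (ih (b + 1) _ hlCI).2 (by omega)
      exact hvs.exchange hg hl two_ne_zero one_ne_zero hreg hlr hv

end

end CompleteIntersections

section CompleteIntersections

variable {K : Type*} [Field K] {n : ℕ}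

lemma RegMod.colonBy_eq {J : Ideal (MvPolynomial (Fin n) K)} {g : MvPolynomial (Fin n) K}
    (h : RegMod J g) : colonBy J g = J :=
  le_antisymm (fun u hu => h u hu) (le_colonBy J g)

lemma finrank_homogeneousSubmodule_zero :
    Module.finrank K (homogeneousSubmodule (Fin n) K 0) = 1 := by
  rw [homogeneousSubmodule_zero, Submodule.one_eq_span, finrank_span_singleton one_ne_zero]

lemma hilbCodim_zero_of_ne_top {J : Ideal (MvPolynomial (Fin n) K)} (hJ : J ≠ ⊤) :
    hilbCodim J 0 = 1 := by
  have h := hilbCodim_add_hilb J 0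
  rw [finrank_homogeneousSubmodule_zero] at h
  have h2 : hilbCodim J 0 ≠ 0 := fun h0 => hJ <| (Ideal.eq_top_iff_one J).2 <|
    hilbCodim_eq_zero_iff.1 h0 1 (isHomogeneous_one (Fin n) K)
  omega

lemma IsCI.ne_top {a b : ℕ} {J : Ideal (MvPolynomial (Fin n) K)} (h : IsCI a b J) : J ≠ ⊤ := by
  have : J ≤ Ideal.span (Set.range (X : Fin n → MvPolynomial (Fin n) K)) := by
    induction h with
    | base Λ hΛ b hb =>
      rw [Ideal.span_le]
      exact fun l hl => mem_irrelevant (d := 1) (hΛ hl) one_ne_zero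
    | quad hJ hg hreg ih =>
      refine sup_le ih ?_
      rw [Ideal.span_singleton_le_iff_mem]
      exact mem_irrelevant hg two_ne_zero
  rintro rfl
  have h1 := this (Submodule.mem_top (x := 1))
  rw [← Set.image_univ, mem_ideal_span_X_image] at h1
  obtain ⟨i, -, hi⟩ := h1 0 (by simp)
  simp at hi

lemma RegMod.ne_zero {J : Ideal (MvPolynomial (Fin n) K)} (hJ : J ≠ ⊤)
    {g : MvPolynomial (Fin n) K} (h : RegMod J g) : g ≠ 0 := by
  rintro rfl
  exact hJ ((Ideal.eq_top_iff_one J).2 (h 1 (by simp)))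

variable [Infinite K]

lemma IsCI.exists_linear {a b : ℕ} {J : Ideal (MvPolynomial (Fin n) K)} (h : IsCI a b J)
    (hab : a + b < n) : ∃ l : MvPolynomial (Fin n) K, l.IsHomogeneous 1 ∧ RegMod J l ∧
      IsCI a (b + 1) (J ⊔ Ideal.span {l}) := by
  obtain ⟨-, S, hS, hS1, hS2⟩ := (IsCI.main a b J h).1 hab
  obtain ⟨l, hl, hlS⟩ := exists_mem_forall_notMem _ hS hS1
  exact ⟨l, hl, hS2 l hl hlS⟩

/-- The Hilbert function of an Artinian complete intersection of quadrics. -/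
theorem IsCI.hilbCodim_eq {a : ℕ} : ∀ {b : ℕ} {J : Ideal (MvPolynomial (Fin n) K)},
    IsCI a b J → a + b = n → ∀ d, hilbCodim J d = a.choose d := by
  induction a with
  | zero =>
    rintro b J hJ hab d
    cases d with
    | zero => exact hilbCodim_zero_of_ne_top hJ.ne_top
    | succ d =>
      obtain ⟨Λ, hΛ, _, hb⟩ := hJ
      rw [Nat.choose_zero_succ, hilbCodim_eq_zero_iff]
      have h1 : Λ = homogeneousSubmodule (Fin n) K 1 := by
        apply Submodule.eq_of_le_of_finrank_eq hΛ
        rw [finrank_homogeneousSubmodule_one]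
        omega
      intro f hf
      have h2 : Ideal.span (Set.range (X : Fin n → MvPolynomial (Fin n) K)) ≤
          Ideal.span (Λ : Set (MvPolynomial (Fin n) K)) := by
        rw [Ideal.span_le]
        rintro _ ⟨i, rfl⟩
        apply Ideal.subset_span
        rw [h1]
        exact isHomogeneous_X K i
      exact h2 (mem_irrelevant hf d.succ_ne_zero)
  | succ a ih =>
    intro b J hJ hab d
    obtain _ | ⟨hJ, hg, hreg⟩ := hJ
    rename_i J g
    obtain ⟨l, hl, hlr, hlCI⟩ := hJ.exists_linear (by omega)
    have h1 : ∀ d, hilbCodim J (d + 1) = a.choose (d + 1) + hilbCodim J d := by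
      intro d
      rw [hilbCodim_add hJ.isHomog hl (hlr.ne_zero hJ.ne_top) d, hlr.colonBy_eq,
        ih hlCI (by omega)]
    have h2 : ∀ d, hilbCodim J (d + 2) = hilbCodim (J ⊔ Ideal.span {g})
        (d + 2) + hilbCodim J d := by
      intro d
      rw [hilbCodim_add hJ.isHomog hg (hreg.ne_zero hJ.ne_top) d, hreg.colonBy_eq]
    have h0 := hilbCodim_zero_of_ne_top hJ.ne_top
    match d with
    | 0 => rw [hilbCodim_sup_span_of_lt hJ.isHomog hg (by omega), h0]; simp
    | 1 =>
      rw [hilbCodim_sup_span_of_lt hJ.isHomog hg (by omega), h1, h0]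
      simp
    | d + 2 =>
      have h3 : hilbCodim J (d + 2) = a.choose (d + 2) + hilbCodim J (d + 1) := h1 (d + 1)
      have h4 := h1 d
      have h5 := h2 d
      have h6 : (a + 1).choose (d + 2) = a.choose (d + 1) + a.choose (d + 2) :=
        Nat.choose_succ_succ' a (d + 1)
      omega

/-- Nondegeneracy: an Artinian complete intersection of quadrics has socle only in top degree. -/
theorem IsCI.mem_of_X_mul_mem {a b : ℕ} {J : Ideal (MvPolynomial (Fin n) K)} (hJ : IsCI a b J)
    (hab : a + b = n) {d : ℕ} (hd : d < a) {u : MvPolynomial (Fin n) K} (hu : u.IsHomogeneous d)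
    (h : ∀ i, X i * u ∈ J) : u ∈ J := by
  obtain ⟨v, hv, hvs⟩ := (IsCI.main a b J hJ).2 hab
  have hHF := hJ.hilbCodim_eq hab
  have h1 : ¬ ∀ f : MvPolynomial (Fin n) K, f.IsHomogeneous a → f ∈ J := by
    rw [← hilbCodim_eq_zero_iff, hHF, Nat.choose_self]
    exact one_ne_zero
  push Not at h1
  obtain ⟨t, ht, htJ⟩ := h1
  have h2 := hilbCodim_eq_zero_iff.1 ((hHF (1 + a)).trans (Nat.choose_eq_zero_of_lt (by omega)))
  obtain ⟨c, hc⟩ := hvs t fun i => h2 _ ((isHomogeneous_X K i).mul ht)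
  obtain ⟨c', hc'⟩ := hvs u h
  have hc0 : c ≠ 0 := by
    rintro rfl
    simp at hc
    exact htJ hc
  have h3 : u - C (c' / c) * t ∈ J := by
    have h4 := J.sub_mem hc' (J.mul_mem_left (C (c' / c)) hc)
    have h5 : u - C c' * v - C (c' / c) * (t - C c * v) = u - C (c' / c) * t := by
      have : (C c' : MvPolynomial (Fin n) K) = C (c' / c) * C c := by
        rw [← C_mul, div_mul_cancel₀ _ hc0]
      rw [this]; ring
    rwa [h5] at h4
  have h4 := hJ.isHomog _ h3 d
  rwa [map_sub, homogeneousComponent_of_mem ((mem_homogeneousSubmodule _ _).2 hu), if_pos rfl,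
    homogeneousComponent_of_mem (n := a), if_neg (by omega), sub_zero] at h4
  rw [mem_homogeneousSubmodule]
  simpa using (isHomogeneous_C (Fin n) (c' / c)).mul ht

/-- A space of forms that is cofinite modulo a complete intersection contains a form regular
modulo it. -/
theorem IsCI.exists_regMod {a b : ℕ} {J : Ideal (MvPolynomial (Fin n) K)} (hJ : IsCI a b J)
    (hab : a + b < n) (V : Submodule K (MvPolynomial (Fin n) K)) {N : ℕ}
    (hV : ∀ i, X i ^ N ∈ J ⊔ Ideal.span (V : Set (MvPolynomial (Fin n) K))) :
    ∃ v ∈ V, RegMod J v := by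
  obtain ⟨S, hS, h1, h2⟩ := exists_bad_subspaces ((IsCI.main a b J hJ).1 hab).1
  obtain ⟨v, hv, hvS⟩ := exists_mem_forall_notMem V hS <| by
    intro B hB hVB
    obtain ⟨P, hP, hJP, rfl, i, hi⟩ := h2 B hB
    apply hi
    apply hP.mem_of_pow_mem N
    have : J ⊔ Ideal.span (V : Set (MvPolynomial (Fin n) K)) ≤ P :=
      sup_le hJP (Ideal.span_le.2 fun x hx => hVB hx)
    exact this (hV i)
  exact ⟨v, hv, h1 v hvS⟩

end CompleteIntersections

section QuadricSystems

variable {K : Type*} [Field K] {n : ℕ}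

/-- A space `F` of quadrics and a space `Λ` of linear forms generating together an Artinian
complete intersection of type `(2, 2, 2, 2, 2)` in the remaining five variables. -/
structure IsQuadricSystem (F Λ : Submodule K (MvPolynomial (Fin n) K)) : Prop where
  quad : F ≤ homogeneousSubmodule (Fin n) K 2
  finrank_quad : Module.finrank K F ≤ 5
  lin : Λ ≤ homogeneousSubmodule (Fin n) K 1
  finrank_lin : Module.finrank K Λ + 5 = n
  isCI : IsCI 5 (Module.finrank K Λ) (Ideal.span (Λ : Set (MvPolynomial (Fin n) K)) ⊔
    Ideal.span (F : Set (MvPolynomial (Fin n) K)))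

lemma span_submodule_mono {V W : Submodule K (MvPolynomial (Fin n) K)} (h : V ≤ W) :
    Ideal.span (V : Set (MvPolynomial (Fin n) K)) ≤ Ideal.span (W : Set _) :=
  Ideal.span_mono h

lemma IsCI.X_pow_mem [Infinite K] {a b : ℕ} {J : Ideal (MvPolynomial (Fin n) K)}
    (hJ : IsCI a b J) (hab : a + b = n) (i : Fin n) : X i ^ (a + 1) ∈ J :=
  hilbCodim_eq_zero_iff.1 ((hJ.hilbCodim_eq hab (a + 1)).trans (Nat.choose_succ_self a)) _
    (isHomogeneous_X_pow i (a + 1))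

lemma RegMod.notMem {R : Type*} [CommRing R] {J : Ideal R} {g : R} (h : RegMod J g)
    (hJ : J ≠ ⊤) : g ∉ J :=
  fun hg => hJ ((Ideal.eq_top_iff_one J).2 (h 1 (by rwa [mul_one])))

/-- Regular quadrics chosen inside `F`, on top of linear forms `Λ'`. An element `p` regular
modulo `M` with `(M, p) = (Λ')` stays regular after adding these quadrics to `M`. -/
lemma IsQuadricSystem.exists_quadrics [Infinite K] {F Λ : Submodule K (MvPolynomial (Fin n) K)}
    (h : IsQuadricSystem F Λ) {Λ' : Submodule K (MvPolynomial (Fin n) K)} (hΛ : Λ ≤ Λ')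
    (hΛ' : Λ' ≤ homogeneousSubmodule (Fin n) K 1) (a : ℕ)
    (ha : a + Module.finrank K Λ' ≤ n) :
    ∃ G ≤ F, Module.finrank K G = a ∧
      IsCI a (Module.finrank K Λ') (Ideal.span (Λ' : Set (MvPolynomial (Fin n) K)) ⊔
        Ideal.span (G : Set (MvPolynomial (Fin n) K))) ∧
      ∀ (M : Ideal (MvPolynomial (Fin n) K)) (p : MvPolynomial (Fin n) K), RegMod M p →
        M ⊔ Ideal.span {p} = Ideal.span (Λ' : Set (MvPolynomial (Fin n) K)) →
        RegMod (M ⊔ Ideal.span (G : Set (MvPolynomial (Fin n) K))) p := by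
  induction a with
  | zero =>
    refine ⟨⊥, bot_le, finrank_bot _ _, ?_, fun M p hp _ => ?_⟩
    · rw [Submodule.bot_coe, Ideal.span_singleton_zero, sup_bot_eq]
      exact IsCI.base Λ' hΛ' _ rfl
    · rwa [Submodule.bot_coe, Ideal.span_singleton_zero, sup_bot_eq]
  | succ a ih =>
    obtain ⟨G, hGF, hGa, hci, hreg⟩ := ih (by omega)
    obtain ⟨v, hvF, hv⟩ := hci.exists_regMod (N := 6) (by omega) F <| by
      intro i
      have := h.isCI.X_pow_mem (by rw [add_comm]; exact h.finrank_lin) i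
      exact (sup_le_sup_right (span_submodule_mono hΛ) _ : _ ≤ Ideal.span
        (Λ' : Set (MvPolynomial (Fin n) K)) ⊔ _).trans (sup_le_sup_right le_sup_left _) this
    have hvG : v ∉ G := fun hvG =>
      hv.notMem hci.ne_top (Ideal.mem_sup_right (Ideal.subset_span hvG))
    have : Module.Finite K G := Submodule.finiteDimensional_of_le (hGF.trans h.quad)
    refine ⟨G ⊔ Submodule.span K {v}, sup_le hGF ?_, ?_, ?_, fun M p hp hM => ?_⟩
    · rwa [Submodule.span_singleton_le_iff_mem]
    · rw [finrank_sup_span_singleton hvG, hGa]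
    · rw [← span_sup_span_singleton, ← sup_assoc]
      exact hci.quad (h.quad hvF) hv
    · rw [← span_sup_span_singleton, ← sup_assoc]
      apply (hreg M p hp hM).swap
      rwa [sup_right_comm, hM]

lemma IsQuadricSystem.hilbCodim_sup_le [Infinite K] {F Λ : Submodule K (MvPolynomial (Fin n) K)}
    (h : IsQuadricSystem F Λ) {Λ' : Submodule K (MvPolynomial (Fin n) K)} (hΛ : Λ ≤ Λ')
    (hΛ' : Λ' ≤ homogeneousSubmodule (Fin n) K 1) {k : ℕ} (hk : Module.finrank K Λ' + k = n)
    (d : ℕ) :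
    hilbCodim (Ideal.span (Λ' : Set (MvPolynomial (Fin n) K)) ⊔
      Ideal.span (F : Set (MvPolynomial (Fin n) K))) d ≤ k.choose d := by
  obtain ⟨G, hGF, -, hci, -⟩ := h.exists_quadrics hΛ hΛ' k (by omega)
  rw [← hci.hilbCodim_eq (by omega) d]
  exact hilbCodim_anti (sup_le_sup le_rfl (span_submodule_mono hGF)) d

/-- A quadric outside an Artinian complete intersection of four quadrics is annihilated by
at most three independent linear forms. -/
lemma IsCI.two_le_hilbCodim_colonBy [Infinite K] {b : ℕ}
    {Λ G : Submodule K (MvPolynomial (Fin n) K)}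
    (hΛ : Λ ≤ homogeneousSubmodule (Fin n) K 1)
    (hci : IsCI 4 b (Ideal.span (Λ : Set (MvPolynomial (Fin n) K)) ⊔
      Ideal.span (G : Set (MvPolynomial (Fin n) K)))) (hG : G ≤ homogeneousSubmodule (Fin n) K 2)
    (hb : 4 + b = n) {f : MvPolynomial (Fin n) K} (hf : f.IsHomogeneous 2)
    (hfJ : f ∉ Ideal.span (Λ : Set (MvPolynomial (Fin n) K)) ⊔
      Ideal.span (G : Set (MvPolynomial (Fin n) K))) :
    2 ≤ hilbCodim (colonBy (Ideal.span (Λ : Set (MvPolynomial (Fin n) K)) ⊔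
      Ideal.span (G : Set (MvPolynomial (Fin n) K))) f) 1 := by
  set J := Ideal.span (Λ : Set (MvPolynomial (Fin n) K)) ⊔
      Ideal.span (G : Set (MvPolynomial (Fin n) K)) with hJ
  by_contra! hlt
  suffices hsq : ∀ i j : Fin n, X i * (X j * f) ∈ J by
    exact hfJ (hci.mem_of_X_mul_mem hb (by norm_num) hf fun j =>
      hci.mem_of_X_mul_mem hb (d := 1 + 2) (by norm_num) ((isHomogeneous_X K j).mul hf)
        fun i => hsq i j)
  have hadd := hilbCodim_add_hilb (colonBy J f) 1
  rw [finrank_homogeneousSubmodule_one] at hadd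
  have hΛc : Λ ≤ component (colonBy J f) 1 := fun l hl =>
    mem_component.2 ⟨le_colonBy J f (Ideal.mem_sup_left (Ideal.subset_span hl)), hΛ hl⟩
  have hmem : ∀ u : MvPolynomial (Fin n) K, u.IsHomogeneous 2 → u ∈ colonBy J f := by
    obtain hn | hn := Nat.lt_or_ge (hilb (colonBy J f) 1) n
    · have hn1 : Module.finrank K (component (colonBy J f) 1) = n - 1 := by
        change hilb _ _ = _
        omega
      have hci' := IsCI.base _ (component_le (colonBy J f) 1) _ hn1
      obtain ⟨v, hv, hvr⟩ := hci'.exists_regMod (N := 5) (by omega) G <| fun i =>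
        sup_le_sup (span_submodule_mono hΛc) le_rfl (hci.X_pow_mem hb i)
      intro u hu
      have h1 := hilbCodim_eq_zero_iff.1
        (((hci'.quad (hG hv) hvr).hilbCodim_eq (by omega) 2).trans (by simp)) u hu
      refine (sup_le ?_ ?_ :
        Ideal.span (component (colonBy J f) 1 : Set (MvPolynomial (Fin n) K)) ⊔
          Ideal.span {v} ≤ colonBy J f) h1
      · exact Ideal.span_le.2 fun l hl => (mem_component.1 hl).1
      · rw [Ideal.span_singleton_le_iff_mem]
        exact le_colonBy J f (Ideal.mem_sup_right (Ideal.subset_span hv))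
    · have h0 : hilbCodim (colonBy J f) 1 = 0 := by omega
      have h1 : Ideal.span (Set.range (X : Fin n → MvPolynomial (Fin n) K)) ≤ colonBy J f := by
        rw [Ideal.span_le]
        rintro _ ⟨i, rfl⟩
        exact hilbCodim_eq_zero_iff.1 h0 _ (isHomogeneous_X K i)
      exact fun u hu => h1 (mem_irrelevant hu two_ne_zero)
  intro i j
  have := mem_colonBy.1 (hmem (X i * X j) ((isHomogeneous_X K i).mul (isHomogeneous_X K j)))
  rwa [mul_comm, mul_assoc] at this

/-- The dichotomy for annihilators of a linear form `p` in an Artinian complete intersection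
of five quadrics. -/
theorem IsQuadricSystem.dichotomy [Infinite K] {F Λ : Submodule K (MvPolynomial (Fin n) K)}
    (h : IsQuadricSystem F Λ) {p : MvPolynomial (Fin n) K} (hp : p.IsHomogeneous 1)
    {Q : Ideal (MvPolynomial (Fin n) K)}
    (hQ : Q = Ideal.span (Λ : Set (MvPolynomial (Fin n) K)) ⊔
      Ideal.span (F : Set (MvPolynomial (Fin n) K)))
    (hpQ : p ∉ Q) :
    hilbCodim Q 2 ≤ hilbCodim (colonBy Q p) 2 + 2 ∨
      ∃ q : MvPolynomial (Fin n) K, q.IsHomogeneous 1 ∧ p * q ∈ Q ∧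
        ∀ (d : ℕ) (u : MvPolynomial (Fin n) K), u.IsHomogeneous (d + 1) → p * u ∈ Q →
          ∃ c : MvPolynomial (Fin n) K, c.IsHomogeneous d ∧ u - q * c ∈ Q := by
  have hpΛ : p ∉ Λ := fun hpΛ => hpQ (hQ ▸ Ideal.mem_sup_left (Ideal.subset_span hpΛ))
  have hΛf : Module.Finite K Λ := Submodule.finiteDimensional_of_le h.lin
  have hΛ' : Λ ⊔ Submodule.span K {p} ≤ homogeneousSubmodule (Fin n) K 1 :=
    sup_le h.lin (by rwa [Submodule.span_singleton_le_iff_mem])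
  have hrank := finrank_sup_span_singleton hpΛ
  have hn := h.finrank_lin
  obtain ⟨G, hGF, hG4, hci, hreg⟩ := h.exists_quadrics le_sup_left hΛ' 4 (by omega)
  have hFf : Module.Finite K F := Submodule.finiteDimensional_of_le h.quad
  have hGf : Module.Finite K G := Submodule.finiteDimensional_of_le (hGF.trans h.quad)
  have hpreg := hreg (Ideal.span (Λ : Set (MvPolynomial (Fin n) K))) p (by
      obtain ⟨hprime, hlin⟩ := linear_span_aux h.lin
      intro u hu
      exact (hprime.mem_or_mem hu).resolve_left fun h => hpΛ (hlin p hp h))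
    (span_sup_span_singleton Λ p)
  obtain ⟨f, hfF, hf⟩ : ∃ f ∈ F, F = G ⊔ Submodule.span K {f} := by
    by_cases hFG : F ≤ G
    · exact ⟨0, F.zero_mem, by simpa using le_antisymm hFG hGF⟩
    · obtain ⟨f, hfF, hfG⟩ := SetLike.not_le_iff_exists.1 hFG
      refine ⟨f, hfF, (Submodule.eq_of_le_of_finrank_le (sup_le hGF ?_) ?_).symm⟩
      · rwa [Submodule.span_singleton_le_iff_mem]
      · rw [finrank_sup_span_singleton hfG, hG4]
        exact h.finrank_quad
  set G₀ := Ideal.span (Λ : Set (MvPolynomial (Fin n) K)) ⊔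
    Ideal.span (G : Set (MvPolynomial (Fin n) K)) with hG₀
  have hG₀h : IsHomog G₀ := (isHomog_span fun s hs => ⟨1, h.lin hs⟩).sup
    (isHomog_span fun s hs => ⟨2, h.quad (hGF hs)⟩)
  have hQ' : Q = G₀ ⊔ Ideal.span {f} := by
    rw [hQ, hf, ← span_sup_span_singleton, ← sup_assoc]
  have hf2 : f.IsHomogeneous 2 := h.quad hfF
  have hG' : Ideal.span ((Λ ⊔ Submodule.span K {p} : Submodule K (MvPolynomial (Fin n) K)) :
      Set (MvPolynomial (Fin n) K)) ⊔ Ideal.span (G : Set (MvPolynomial (Fin n) K)) =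
      G₀ ⊔ Ideal.span {p} := by
    rw [← span_sup_span_singleton, sup_right_comm]
  by_cases hfG : f ∈ G₀ ⊔ Ideal.span {p}
  · right
    obtain ⟨g, hg, t, ht, hgt⟩ := Submodule.mem_sup.1 hfG
    obtain ⟨t, rfl⟩ := Ideal.mem_span_singleton.1 ht
    set q := homogeneousComponent 1 t with hq
    have hfq : f - p * q ∈ G₀ := by
      have h1 : homogeneousComponent (1 + 1) (g + p * t) = f := by
        rw [hgt, homogeneousComponent_of_mem ((mem_homogeneousSubmodule _ _).2 hf2), if_pos rfl]
      rw [map_add, homogeneousComponent_mul_add hp] at h1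
      rw [← h1, add_sub_cancel_right]
      exact hG₀h _ hg _
    have hG₀Q : G₀ ≤ Q := hQ' ▸ le_sup_left
    have hfQ : f ∈ Q := hQ' ▸ Ideal.mem_sup_right (Ideal.mem_span_singleton_self f)
    have hqh : q.IsHomogeneous 1 := homogeneousComponent_isHomogeneous _ _
    refine ⟨q, hqh, ?_, fun d u hu hpu => ?_⟩
    · have := Q.sub_mem hfQ (hG₀Q hfq)
      rwa [sub_sub_cancel] at this
    · rw [hQ'] at hpu
      obtain ⟨g', hg', s, hs, hgs⟩ := Submodule.mem_sup.1 hpu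
      obtain ⟨s, rfl⟩ := Ideal.mem_span_singleton.1 hs
      have h2 : u - q * s ∈ G₀ := by
        apply hpreg
        have : p * (u - q * s) = g' + s * (f - p * q) := by linear_combination -hgs
        rw [this]
        exact G₀.add_mem hg' (G₀.mul_mem_left _ hfq)
      refine ⟨homogeneousComponent d s, homogeneousComponent_isHomogeneous _ _, ?_⟩
      have h3 := hG₀h _ h2 (d + 1)
      rw [map_sub, homogeneousComponent_mul_add hqh,
        homogeneousComponent_of_mem ((mem_homogeneousSubmodule _ _).2 hu), if_pos rfl] at h3
      exact hG₀Q h3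
  · left
    have hQh : IsHomog Q := hQ' ▸ hG₀h.sup_span hf2
    have hp0 : p ≠ 0 := fun h0 => hpΛ (h0 ▸ Λ.zero_mem)
    have hf0 : f ≠ 0 := fun h0 => hfG (h0 ▸ Ideal.zero_mem _)
    have h1 := hilbCodim_add hQh hp hp0 2
    have h2 := hilbCodim_add (hG₀h.sup_span hp) hf2 hf0 1
    have h3 := hci.two_le_hilbCodim_colonBy hΛ' (hGF.trans h.quad) (by omega) hf2
      (by rwa [hG'])
    have h4 := hci.hilbCodim_eq (by omega) 3
    have h5 := h.isCI.hilbCodim_eq (by omega)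
    rw [← hQ] at h5
    rw [hG'] at h3 h4
    have h6 : Q ⊔ Ideal.span {p} = G₀ ⊔ Ideal.span {p} ⊔ Ideal.span {f} := by
      rw [hQ', sup_right_comm]
    rw [h6] at h1
    rw [h5] at h1 ⊢
    have e1 : Nat.choose 5 3 = 10 := rfl
    have e2 : Nat.choose 5 2 = 10 := rfl
    have e3 : Nat.choose 4 3 = 4 := rfl
    simp only [Nat.reduceAdd] at h1 h2
    omega

end QuadricSystems

section QuadricSystems

variable {K : Type*} [Field K] {n : ℕ}

lemma ideal_span_submodule_span (S : Set (MvPolynomial (Fin n) K)) :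
    Ideal.span (Submodule.span K S : Set (MvPolynomial (Fin n) K)) = Ideal.span S := by
  refine le_antisymm (Ideal.span_le.2 ?_) (Ideal.span_mono Submodule.subset_span)
  have : Submodule.span K S ≤ (Ideal.span S).restrictScalars K :=
    Submodule.span_le.2 Ideal.subset_span
  exact this

lemma IsRegSeq.isCI {r : ℕ} {f : Fin r → MvPolynomial (Fin n) K} (hf : IsRegSeq f)
    (hf2 : ∀ i, (f i).IsHomogeneous 2) : IsCI r 0 (Ideal.span (Set.range f)) := by
  have key : ∀ k ≤ r, IsCI k 0 (Ideal.span { p | ∃ j : Fin r, (j : ℕ) < k ∧ p = f j }) := by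
    intro k
    induction k with
    | zero =>
      intro _
      have := IsCI.base (K := K) (n := n) ⊥ bot_le 0 (finrank_bot _ _)
      rw [Submodule.bot_coe, Ideal.span_singleton_zero] at this
      convert this
      rw [Ideal.span_eq_bot]
      rintro _ ⟨j, hj, rfl⟩
      omega
    | succ k ih =>
      intro hk
      have h := (ih (by omega)).quad (hf2 ⟨k, by omega⟩) (fun u hu => hf ⟨k, by omega⟩ u (by
        rw [mul_comm]; exact hu))
      convert h using 1
      rw [← Ideal.span_union]
      congr 1
      ext p
      constructor
      · rintro ⟨j, hj, rfl⟩
        obtain hj | hj := Nat.lt_succ_iff_lt_or_eq.1 hj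
        · exact Or.inl ⟨j, hj, rfl⟩
        · right
          rw [Set.mem_singleton_iff]
          congr 1
          exact Fin.ext hj
      · rintro (⟨j, hj, rfl⟩ | rfl)
        · exact ⟨j, by omega, rfl⟩
        · exact ⟨⟨k, by omega⟩, Nat.lt_succ_self k, rfl⟩
  convert key r le_rfl using 2
  ext p
  exact ⟨fun ⟨j, hj⟩ => ⟨j, j.2, hj.symm⟩, fun ⟨j, _, hj⟩ => ⟨j, hj.symm⟩⟩

/-- A regular sequence of five quadrics can be completed by linear forms. -/
theorem IsRegSeq.exists_isQuadricSystem [Infinite K] {f : Fin 5 → MvPolynomial (Fin n) K}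
    (hf : IsRegSeq f) (hf2 : ∀ i, (f i).IsHomogeneous 2) (hn : 5 ≤ n) :
    ∃ l : ℕ → MvPolynomial (Fin n) K, (∀ i, (l i).IsHomogeneous 1) ∧ (∀ i < n - 5, l i ≠ 0) ∧
      IsQuadricSystem (Submodule.span K (Set.range f))
        (Submodule.span K (l '' Set.Iio (n - 5))) := by
  have hci := hf.isCI hf2
  have key : ∀ j ≤ n - 5, ∃ l : ℕ → MvPolynomial (Fin n) K, (∀ i, (l i).IsHomogeneous 1) ∧
      (∀ i < j, l i ≠ 0) ∧ Module.finrank K (Submodule.span K (l '' Set.Iio j)) = j ∧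
      IsCI 5 j (Ideal.span (Set.range f) ⊔ Ideal.span (Submodule.span K (l '' Set.Iio j) :
        Set (MvPolynomial (Fin n) K))) := by
    intro j
    induction j with
    | zero =>
      intro _
      have h0 : Set.Iio 0 = (∅ : Set ℕ) := by ext; simp
      refine ⟨fun _ => 0, fun i => isHomogeneous_zero _ _ _,
        fun i hi => absurd hi i.not_lt_zero, ?_⟩
      rw [h0, Set.image_empty, Submodule.span_empty]
      simpa using hci
    | succ j ih =>
      intro hj
      obtain ⟨l, hl, hl0, hlr, hlci⟩ := ih (by omega)
      obtain ⟨v, hv, hvr, hvci⟩ := hlci.exists_linear (by omega)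
      have hvm := hvr.notMem hlci.ne_top
      have hspan : Submodule.span K (Function.update l j v '' Set.Iio (j + 1)) =
          Submodule.span K (l '' Set.Iio j) ⊔ Submodule.span K {v} := by
        rw [← Submodule.span_union]
        congr 1
        ext p
        constructor
        · rintro ⟨i, hi, rfl⟩
          obtain rfl | hij := eq_or_ne i j
          · simp
          · left
            rw [Function.update_of_ne hij]
            have hi' : i < j + 1 := hi
            exact ⟨i, (by omega : i < j), rfl⟩
        · rintro (⟨i, hi, rfl⟩ | rfl)
          · have hi' : i < j := hi
            exact ⟨i, hi'.trans (Nat.lt_succ_self j), by rw [Function.update_of_ne hi'.ne]⟩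
          · exact ⟨j, by simp, by simp⟩
      have : Module.Finite K (Submodule.span K (l '' Set.Iio j)) :=
        Module.Finite.span_of_finite K ((Set.finite_Iio j).image l)
      refine ⟨Function.update l j v, ?_, ?_, ?_, ?_⟩
      · intro i
        obtain rfl | hij := eq_or_ne i j
        · simpa using hv
        · rw [Function.update_of_ne hij]
          exact hl i
      · intro i hi
        obtain rfl | hij := eq_or_ne i j
        · simpa using hvr.ne_zero hlci.ne_top
        · rw [Function.update_of_ne hij]
          exact hl0 i (by omega)
      · rw [hspan, finrank_sup_span_singleton, hlr]
        exact fun h => hvm (Ideal.mem_sup_right (Ideal.subset_span h))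
      · rw [hspan, ← span_sup_span_singleton, ← sup_assoc]
        exact hvci
  obtain ⟨l, hl, hl0, hlr, hlci⟩ := key _ le_rfl
  refine ⟨l, hl, hl0, ?_, ?_, ?_, ?_, ?_⟩
  · rw [Submodule.span_le]
    rintro _ ⟨i, rfl⟩
    exact hf2 i
  · exact (finrank_range_le_card f).trans (by simp)
  · rw [Submodule.span_le]
    rintro _ ⟨i, -, rfl⟩
    exact hl i
  · omega
  · rw [hlr, sup_comm, ideal_span_submodule_span (Set.range f)]
    exact hlci

end QuadricSystems

section LinearAlgebra

variable {K : Type*} [Field K] {V W : Type*} [AddCommGroup V] [Module K V] [AddCommGroup W]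
  [Module K W]

lemma exists_le_finrank_eq [Module.Finite K V] (P : Submodule K V) {k : ℕ}
    (hk : k ≤ Module.finrank K P) : ∃ P' ≤ P, Module.finrank K P' = k := by
  induction k with
  | zero => exact ⟨⊥, bot_le, finrank_bot _ _⟩
  | succ k ih =>
    obtain ⟨P', hP', h⟩ := ih (by omega)
    have hnot : ¬ P ≤ P' := fun hle => by
      have := Submodule.finrank_mono hle
      omega
    obtain ⟨v, hv, hv'⟩ := SetLike.not_le_iff_exists.1 hnot
    exact ⟨P' ⊔ Submodule.span K {v}, sup_le hP' (by rwa [Submodule.span_singleton_le_iff_mem]),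
      by rw [finrank_sup_span_singleton hv', h]⟩

lemma finrank_inf_ker_add_finrank_map (f : V →ₗ[K] W) (P : Submodule K V) [Module.Finite K P] :
    Module.finrank K (P ⊓ LinearMap.ker f : Submodule K V) + Module.finrank K (P.map f) =
      Module.finrank K P := by
  have h := LinearMap.finrank_range_add_finrank_ker (f.domRestrict P)
  rw [LinearMap.range_domRestrict] at h
  have h1 : LinearMap.ker (f.domRestrict P) = Submodule.comap P.subtype (LinearMap.ker f) := rfl
  rw [h1] at h
  have h2 : P ⊓ LinearMap.ker f = (Submodule.comap P.subtype (LinearMap.ker f)).map P.subtype :=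
    (Submodule.map_comap_subtype _ _).symm
  rw [h2, (Submodule.equivMapOfInjective _ P.injective_subtype _).finrank_eq.symm]
  omega

/-- A dimension count for the preimage of a subspace. -/
lemma finrank_add_le_finrank_inf_comap [Module.Finite K V] [Module.Finite K W] (f : V →ₗ[K] W)
    (P : Submodule K V) {W₁ W₂ : Submodule K W} (h₁ : W₁ ≤ W₂) (h₂ : P.map f ≤ W₂) :
    Module.finrank K P + Module.finrank K W₁ ≤
      Module.finrank K (P ⊓ W₁.comap f : Submodule K V) + Module.finrank K W₂ := by
  have e1 := finrank_inf_ker_add_finrank_map f P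
  have e2 := finrank_inf_ker_add_finrank_map f (P ⊓ W₁.comap f)
  have e3 := Submodule.finrank_sup_add_finrank_inf_eq (P.map f) W₁
  have e4 := Submodule.finrank_mono (sup_le h₂ h₁)
  have e5 : (P ⊓ W₁.comap f).map f = P.map f ⊓ W₁ := Submodule.map_inf_eq_map_inf_comap.symm
  have e6 : P ⊓ W₁.comap f ⊓ LinearMap.ker f = P ⊓ LinearMap.ker f := by
    rw [inf_assoc]
    congr 1
    exact inf_eq_right.2 (LinearMap.ker_le_comap f)
  rw [e5, e6] at e2
  omega

/-- A pencil of linear maps over an algebraically closed field has a singular member. -/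
lemma exists_pencil_kernel [IsAlgClosed K] [Module.Finite K V] [Module.Finite K W] [Nontrivial V]
    (h : Module.finrank K W ≤ Module.finrank K V) (f g : V →ₗ[K] W) :
    ∃ (a b : K) (x : V), (a ≠ 0 ∨ b ≠ 0) ∧ x ≠ 0 ∧ a • f x + b • g x = 0 := by
  by_cases hf : Function.Injective f
  · have hr := LinearMap.finrank_le_finrank_of_injective hf
    let e := LinearEquiv.ofInjectiveOfFinrankEq f hf (le_antisymm hr h)
    obtain ⟨μ, hμ⟩ := Module.End.exists_eigenvalue (e.symm.toLinearMap ∘ₗ g)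
    obtain ⟨x, hx⟩ := hμ.exists_hasEigenvector
    refine ⟨μ, -1, x, Or.inr (by simp), hx.2, ?_⟩
    have h1 : e.symm (g x) = μ • x := hx.apply_eq_smul
    have h2 : g x = μ • f x := by
      have h3 := congrArg e h1
      rw [LinearEquiv.apply_symm_apply, map_smul] at h3
      exact h3
    rw [h2]
    simp
  · rw [injective_iff_map_eq_zero] at hf
    push Not at hf
    obtain ⟨x, hx, hx0⟩ := hf
    exact ⟨1, 0, x, Or.inl one_ne_zero, hx0, by simp [hx]⟩

lemma finrank_ker_add_finrank_of_injective_flip [Module.Finite K V] [Module.Finite K W]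
    (B : V →ₗ[K] W →ₗ[K] K) (hB : Function.Injective B.flip) :
    Module.finrank K (LinearMap.ker B) + Module.finrank K W = Module.finrank K V := by
  have hs := LinearMap.flip_injective_iff₁.1 hB
  have h := LinearMap.finrank_range_add_finrank_ker B
  rw [LinearMap.range_eq_top.2 hs, finrank_top] at h
  have h2 : Module.finrank K (W →ₗ[K] K) = Module.finrank K W := Subspace.dual_finrank_eq
  omega

end LinearAlgebra

section GrowthCore

variable {K R : Type*} [Field K] [CommRing R] [Algebra K R]

/-- The properties of the graded pieces `𝓡 d` of an Artinian complete intersection of five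
quadrics that bound the growth of its homogeneous ideals. -/
structure IsFiveQuadricAlgebra (𝓡 : ℕ → Submodule K R) : Prop where
  zero : 𝓡 0 = 1
  one_mul : ∀ d, 𝓡 1 * 𝓡 d = 𝓡 (d + 1)
  finrank_eq : ∀ d, Module.finrank K (𝓡 d) = Nat.choose 5 d
  nondeg : ∀ d < 5, ∀ v ∈ 𝓡 d, (∀ l ∈ 𝓡 1, l * v = 0) → v = 0
  linear_growth : ∀ L ≤ 𝓡 1, ∀ d, Nat.choose 5 (d + 1) ≤
    Module.finrank K (L * 𝓡 d : Submodule K R) + Nat.choose (5 - Module.finrank K L) (d + 1)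
  dichotomy : ∀ p ∈ 𝓡 1, p ≠ 0 →
    (∀ V ≤ 𝓡 2, (∀ v ∈ V, p * v = 0) → Module.finrank K V ≤ 2) ∨
    ∃ q ∈ 𝓡 1, p * q = 0 ∧ ∀ d, ∀ u ∈ 𝓡 (d + 1), p * u = 0 → ∃ c ∈ 𝓡 d, u = q * c

/-- The elements of a subspace `P` annihilated by a set `U`. -/
def annIn (P : Submodule K R) (U : Set R) : Submodule K R where
  carrier := { w | w ∈ P ∧ ∀ u ∈ U, u * w = 0 }
  zero_mem' := ⟨P.zero_mem, fun u _ => mul_zero u⟩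
  add_mem' := fun ha hb => ⟨P.add_mem ha.1 hb.1, fun u hu => by
    rw [mul_add, ha.2 u hu, hb.2 u hu, add_zero]⟩
  smul_mem' := fun c _ hw => ⟨P.smul_mem c hw.1, fun u hu => by
    rw [mul_smul_comm, hw.2 u hu, smul_zero]⟩

lemma mem_annIn {P : Submodule K R} {U : Set R} {w : R} :
    w ∈ annIn P U ↔ w ∈ P ∧ ∀ u ∈ U, u * w = 0 := Iff.rfl

lemma annIn_singleton (P : Submodule K R) (u : R) :
    annIn P {u} = P ⊓ LinearMap.ker (LinearMap.mulLeft K u) := by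
  ext w
  simp [mem_annIn]

namespace IsFiveQuadricAlgebra

variable {𝓡 : ℕ → Submodule K R}

lemma mul_eq (h : IsFiveQuadricAlgebra 𝓡) (i j : ℕ) : 𝓡 i * 𝓡 j = 𝓡 (i + j) := by
  induction i with
  | zero => rw [h.zero, _root_.one_mul, zero_add]
  | succ i ih => rw [← h.one_mul, mul_assoc, ih, h.one_mul]; congr 1; omega

lemma mul_mem (h : IsFiveQuadricAlgebra 𝓡) {i j k : ℕ} (hk : i + j = k) {a b : R} (ha : a ∈ 𝓡 i)
    (hb : b ∈ 𝓡 j) :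
    a * b ∈ 𝓡 k := by
  rw [← hk, ← h.mul_eq]
  exact Submodule.mul_mem_mul ha hb

lemma eq_zero_of_mul (h : IsFiveQuadricAlgebra 𝓡) {i t : ℕ} (hit : i + t ≤ 5) {v : R} (hv : v ∈ 𝓡 i)
    (hz : ∀ r ∈ 𝓡 t, r * v = 0) : v = 0 := by
  induction t generalizing i v with
  | zero =>
    have := hz 1 (by rw [h.zero]; exact Submodule.one_le.1 le_rfl)
    rwa [_root_.one_mul] at this
  | succ t ih =>
    apply h.nondeg i (by omega) v hv
    intro l hl
    apply ih (i := i + 1) (by omega) (h.mul_mem (by omega) hl hv)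
    intro r hr
    rw [← mul_assoc]
    exact hz _ (h.mul_mem rfl hr hl)

variable [Module.Finite K R]

lemma exists_functional
    (h : IsFiveQuadricAlgebra 𝓡) : ∃ φ : R →ₗ[K] K, ∀ v ∈ 𝓡 5, φ v = 0 → v = 0 := by
  have h5 : Module.finrank K (𝓡 5) = 1 := h.finrank_eq 5
  let e : 𝓡 5 ≃ₗ[K] K := LinearEquiv.ofFinrankEq _ _ (by rw [h5, Module.finrank_self])
  obtain ⟨φ, hφ⟩ := e.toLinearMap.exists_extend
  refine ⟨φ, fun v hv h0 => ?_⟩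
  have h1 : φ v = e ⟨v, hv⟩ := DFunLike.congr_fun hφ ⟨v, hv⟩
  rw [h1] at h0
  exact congrArg Subtype.val (e.map_eq_zero_iff.1 h0)

/-- Duality: annihilators are orthogonal complements for the socle pairing. -/
lemma finrank_annIn (h : IsFiveQuadricAlgebra 𝓡) {i t j : ℕ} (hitj : i + t + j = 5)
    {U : Submodule K R} (hU : U ≤ 𝓡 i) :
    Module.finrank K (annIn (𝓡 j) U) + Module.finrank K (U * 𝓡 t : Submodule K R) =
      Nat.choose 5 j := by
  obtain ⟨φ, hφ⟩ := h.exists_functional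
  have hUt : U * 𝓡 t ≤ 𝓡 (i + t) := by
    rw [← h.mul_eq]
    exact mul_le_mul_left hU _
  let B : 𝓡 j →ₗ[K] ↥(U * 𝓡 t) →ₗ[K] K :=
    ((LinearMap.mul K R).compr₂ φ).domRestrict₁₂ (𝓡 j) (U * 𝓡 t)
  have hB : ∀ (w : 𝓡 j) (u : ↥(U * 𝓡 t)), B w u = φ (w * u) := fun _ _ => rfl
  have hinj : Function.Injective B.flip := by
    rw [injective_iff_map_eq_zero]
    rintro ⟨u, hu⟩ h0
    apply Subtype.ext
    apply h.eq_zero_of_mul (t := j) (by omega) (hUt hu)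
    intro r hr
    apply hφ _ (h.mul_mem (by omega) hr (hUt hu))
    exact DFunLike.congr_fun h0 ⟨r, hr⟩
  have key := finrank_ker_add_finrank_of_injective_flip B hinj
  have hker : (LinearMap.ker B).map (𝓡 j).subtype = annIn (𝓡 j) U := by
    ext w
    constructor
    · rintro ⟨w, hw, rfl⟩
      refine ⟨w.2, fun u hu => ?_⟩
      apply h.eq_zero_of_mul (i := i + j) (t := t) (by omega) (h.mul_mem rfl (hU hu) w.2)
      intro r hr
      apply hφ _ (h.mul_mem (by omega) hr (h.mul_mem rfl (hU hu) w.2))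
      have h1 := DFunLike.congr_fun (LinearMap.mem_ker.1 hw)
        ⟨u * r, Submodule.mul_mem_mul hu hr⟩
      rw [hB] at h1
      have h2 : r * (u * (w : R)) = (w : R) * (u * r) := by ring
      change φ (r * (u * (w : R))) = 0
      rw [h2]
      exact h1
    · rintro ⟨hw, hwU⟩
      refine ⟨⟨w, hw⟩, LinearMap.mem_ker.2 ?_, rfl⟩
      ext ⟨u, hu⟩
      rw [hB]
      change φ (w * u) = 0
      have : w * u = 0 := by
        induction hu using Submodule.mul_induction_on' with
        | mem_mul_mem a ha b hb => rw [← mul_assoc, mul_comm w, hwU a ha, zero_mul]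
        | add a _ b _ ha hb => rw [mul_add, ha, hb, add_zero]
      rw [this, map_zero]
  rw [← hker, ← (Submodule.equivMapOfInjective _ (𝓡 j).injective_subtype _).finrank_eq, key,
    h.finrank_eq]

lemma finrank_annIn_singleton (h : IsFiveQuadricAlgebra 𝓡) {j : ℕ} (v : R) :
    Module.finrank K (annIn (𝓡 j) {v}) +
      Module.finrank K (Submodule.span K {v} * 𝓡 j : Submodule K R) = Nat.choose 5 j := by
  have h1 := finrank_inf_ker_add_finrank_map (LinearMap.mulLeft K v) (𝓡 j)
  have h2 : (𝓡 j).map (LinearMap.mulLeft K v) = Submodule.span K {v} * 𝓡 j := by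
    ext x
    rw [Submodule.mem_span_singleton_mul]
    rfl
  rw [annIn_singleton, ← h2, h1, h.finrank_eq]

lemma mul_eq_of_finrank (h : IsFiveQuadricAlgebra 𝓡) {L : Submodule K R} (hL : L ≤ 𝓡 1) {d : ℕ}
    (hd : 5 - Module.finrank K L < d + 1) : L * 𝓡 d = 𝓡 (d + 1) := by
  apply Submodule.eq_of_le_of_finrank_le
  · rw [← h.one_mul]
    exact mul_le_mul_left hL _
  · have := h.linear_growth L hL d
    rw [Nat.choose_eq_zero_of_lt hd] at this
    rw [h.finrank_eq]
    omega

lemma three_le_finrank (h : IsFiveQuadricAlgebra 𝓡) {v : R} (hv : v ∈ 𝓡 2) (hv0 : v ≠ 0) :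
    3 ≤ Module.finrank K (Submodule.span K {v} * 𝓡 1 : Submodule K R) := by
  by_contra! hlt
  apply hv0
  have h1 := h.finrank_annIn_singleton (j := 1) v
  rw [Nat.choose_one_right] at h1
  apply h.eq_zero_of_mul (t := 3) (by omega) hv
  rw [← h.mul_eq_of_finrank (L := annIn (𝓡 1) {v}) (fun w hw => hw.1) (d := 2) (by omega)]
  intro r hr
  induction hr using Submodule.mul_induction_on' with
  | mem_mul_mem a ha b hb => rw [mul_right_comm, mul_comm a, ha.2 v rfl, zero_mul]
  | add a _ b _ ha hb => rw [add_mul, ha, hb, add_zero]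

/-- If many linear forms `l` satisfy `l u ∈ v R₁`, then annihilators of `v` annihilate `u`. -/
lemma mul_eq_zero_of_finrank (h : IsFiveQuadricAlgebra 𝓡) {V : Submodule K R} {u v p : R}
    (hu : u ∈ V) (hv : v ∈ V)
    (hV : V ≤ 𝓡 2) (hp : p ∈ 𝓡 1) (hpv : v * p = 0)
    (hle : Module.finrank K (V * 𝓡 1 : Submodule K R) ≤
      Module.finrank K (Submodule.span K {v} * 𝓡 1 : Submodule K R) + 1) : u * p = 0 := by
  have hmap : (𝓡 1).map (LinearMap.mulLeft K u) ≤ V * 𝓡 1 := by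
    rintro _ ⟨r, hr, rfl⟩
    exact Submodule.mul_mem_mul hu hr
  have hspan : Submodule.span K {v} * 𝓡 1 ≤ V * 𝓡 1 :=
    mul_le_mul_left ((Submodule.span_singleton_le_iff_mem v V).2 hv) _
  have h1 := finrank_add_le_finrank_inf_comap (LinearMap.mulLeft K u) (𝓡 1) hspan hmap
  have h2 : Module.finrank K (𝓡 1) = 5 := h.finrank_eq 1
  apply h.eq_zero_of_mul (i := 3) (t := 2) (by omega) (h.mul_mem (by omega) (hV hu) hp)
  rw [← h.mul_eq_of_finrank (d := 1) inf_le_left (by omega :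
    5 - Module.finrank K (𝓡 1 ⊓ (Submodule.span K {v} * 𝓡 1).comap (LinearMap.mulLeft K u) :
      Submodule K R) < 1 + 1)]
  intro r hr
  induction hr using Submodule.mul_induction_on' with
  | mem_mul_mem a ha b hb =>
    obtain ⟨s, hs, hvs⟩ := Submodule.mem_span_singleton_mul.1 ha.2
    rw [LinearMap.mulLeft_apply] at hvs
    calc a * b * (u * p) = (u * a) * (b * p) := by ring
      _ = (v * p) * (s * b) := by rw [← hvs]; ring
      _ = 0 := by rw [hpv, zero_mul]
  | add a _ b _ ha hb => rw [add_mul, ha, hb, add_zero]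

end IsFiveQuadricAlgebra

end GrowthCore

section GrowthBounds

variable {K R : Type*} [Field K] [CommRing R] [Algebra K R]

lemma Submodule.exists_relative_compl [Module.Finite K R] {N P : Submodule K R} (hN : N ≤ P) :
    ∃ C ≤ P, (∀ x ∈ C, x ∈ N → x = 0) ∧
      Module.finrank K N + Module.finrank K C = Module.finrank K P := by
  obtain ⟨C, hC⟩ := Submodule.exists_isCompl N
  have hsup : N ⊔ C ⊓ P = P := by rw [← sup_inf_assoc_of_le C hN, hC.sup_eq_top, top_inf_eq]
  have hinf : N ⊓ (C ⊓ P) = ⊥ := by rw [← inf_assoc, hC.inf_eq_bot, bot_inf_eq]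
  refine ⟨C ⊓ P, inf_le_right, fun x hx hxN => ?_, ?_⟩
  · have : x ∈ N ⊓ (C ⊓ P) := ⟨hxN, hx⟩
    rwa [hinf, Submodule.mem_bot] at this
  · have := Submodule.finrank_sup_add_finrank_inf_eq N (C ⊓ P)
    rw [hsup, hinf, finrank_bot] at this
    omega

lemma exists_pair_of_two_le_finrank [Module.Finite K R] {V : Submodule K R}
    (hV : 2 ≤ Module.finrank K V) :
    ∃ u ∈ V, ∃ v ∈ V, ∀ a b : K, a • u + b • v = 0 → a = 0 ∧ b = 0 := by
  obtain ⟨V', hV', h2⟩ := exists_le_finrank_eq V hV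
  let b := Module.finBasisOfFinrankEq K V' h2
  refine ⟨b 0, hV' (b 0).2, b 1, hV' (b 1).2, ?_⟩
  rw [← LinearIndependent.pair_iff]
  convert b.linearIndependent.map' V'.subtype (Submodule.ker_subtype _) using 1
  ext i
  fin_cases i <;> rfl

/-- In a pencil of multiplication maps into a space that is not too big, some member has a
kernel. -/
lemma exists_pencil_mul_eq_zero [IsAlgClosed K] [Module.Finite K R] {P W : Submodule K R}
    {u v : R} (hu : ∀ p ∈ P, u * p ∈ W) (hv : ∀ p ∈ P, v * p ∈ W)
    (hle : Module.finrank K W ≤ Module.finrank K P) (hP : 0 < Module.finrank K P) :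
    ∃ (a b : K) (x : R), (a ≠ 0 ∨ b ≠ 0) ∧ x ∈ P ∧ x ≠ 0 ∧ (a • u + b • v) * x = 0 := by
  have : Nontrivial P := Module.finrank_pos_iff.1 hP
  obtain ⟨a, b, x, hab, hx, h⟩ := exists_pencil_kernel hle
    ((LinearMap.mulLeft K u).restrict hu) ((LinearMap.mulLeft K v).restrict hv)
  refine ⟨a, b, x, hab, x.2, fun h0 => hx (Subtype.ext h0), ?_⟩
  have h1 : a • (u * (x : R)) + b • (v * (x : R)) = 0 := congrArg Subtype.val h
  rw [add_mul, smul_mul_assoc, smul_mul_assoc, h1]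

lemma annIn_le (P : Submodule K R) (U : Set R) : annIn P U ≤ P := fun _ hw => hw.1

lemma annIn_span (P : Submodule K R) (U : Set R) :
    annIn P (Submodule.span K U : Set R) = annIn P U := by
  apply le_antisymm
  · exact fun w hw => ⟨hw.1, fun u hu => hw.2 u (Submodule.subset_span hu)⟩
  · refine fun w hw => ⟨hw.1, fun u hu => ?_⟩
    have : Submodule.span K U ≤ LinearMap.ker (LinearMap.mulRight K w) :=
      Submodule.span_le.2 fun u hu => hw.2 u hu
    exact this hu

lemma exists_ne_zero_of_finrank_pos [Module.Finite K R] {V : Submodule K R}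
    (h : 0 < Module.finrank K V) : ∃ v ∈ V, v ≠ 0 := by
  have : Nontrivial V := Module.finrank_pos_iff.1 h
  obtain ⟨v, hv⟩ := exists_ne (0 : V)
  exact ⟨v, v.2, fun h0 => hv (Subtype.ext h0)⟩

namespace IsFiveQuadricAlgebra

variable {𝓡 : ℕ → Submodule K R} [Module.Finite K R]

lemma finrank_annIn_singleton' (h : IsFiveQuadricAlgebra 𝓡) {i t j : ℕ} (hitj : i + t + j = 5)
    {v : R} (hv : v ∈ 𝓡 i) :
    Module.finrank K (annIn (𝓡 j) {v}) +
      Module.finrank K (Submodule.span K {v} * 𝓡 t : Submodule K R) = Nat.choose 5 j := by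
  rw [← annIn_span]
  exact h.finrank_annIn hitj ((Submodule.span_singleton_le_iff_mem v _).2 hv)

variable [IsAlgClosed K]

lemma five_le_finrank (h : IsFiveQuadricAlgebra 𝓡) {V : Submodule K R} (hV : V ≤ 𝓡 2)
    (hV2 : 2 ≤ Module.finrank K V) :
    5 ≤ Module.finrank K (V * 𝓡 1 : Submodule K R) := by
  by_contra! hlt
  obtain ⟨u, hu, v, hv, huv⟩ := exists_pair_of_two_le_finrank hV2
  have hshare : ∀ w ∈ V, w ≠ 0 → ∀ p ∈ 𝓡 1, w * p = 0 → ∀ w' ∈ V, w' * p = 0 := by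
    intro w hw hw0 p hp hwp w' hw'
    have := h.three_le_finrank (hV hw) hw0
    exact h.mul_eq_zero_of_finrank hw' hw hV hp hwp (by omega)
  have hu0 : u ≠ 0 := by
    rintro rfl
    simpa using huv 1 0 (by simp)
  have h3 := h.three_le_finrank (hV hu) hu0
  have hN := h.finrank_annIn_singleton (j := 1) u
  have hle : Module.finrank K (Submodule.span K {u} * 𝓡 1 : Submodule K R) ≤
      Module.finrank K (V * 𝓡 1 : Submodule K R) :=
    Submodule.finrank_mono (mul_le_mul_left ((Submodule.span_singleton_le_iff_mem u V).2 hu) _)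
  rw [Nat.choose_one_right] at hN
  have h1 : Module.finrank K (𝓡 1) = 5 := h.finrank_eq 1
  set N := annIn (𝓡 1) {u} with hNdef
  by_cases hN2 : Module.finrank K N = 2
  · have hann : V ≤ annIn (𝓡 2) N := fun w hw =>
      ⟨hV hw, fun p hp => by rw [mul_comm]; exact hshare u hu hu0 p hp.1 (hp.2 u rfl) w hw⟩
    have e1 := h.finrank_annIn (i := 1) (t := 2) (j := 2) rfl (annIn_le (𝓡 1) {u})
    have e2 := h.linear_growth N (annIn_le (𝓡 1) {u}) 2
    have e3 := Submodule.finrank_mono hann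
    rw [hN2] at e2
    rw [← hNdef] at e1
    norm_num [Nat.choose] at e1 e2
    omega
  · obtain ⟨C, hC, hCN, hCf⟩ := Submodule.exists_relative_compl (annIn_le (𝓡 1) {u})
    rw [← hNdef] at hCf
    obtain ⟨a, b, x, hab, hxC, hx0, hx⟩ := exists_pencil_mul_eq_zero (P := C) (W := V * 𝓡 1)
      (fun p hp => Submodule.mul_mem_mul hu (hC hp))
      (fun p hp => Submodule.mul_mem_mul hv (hC hp)) (by omega) (by omega)
    apply hx0
    apply hCN x hxC
    refine ⟨hC hxC, fun y hy => ?_⟩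
    rw [Set.mem_singleton_iff.1 hy]
    refine hshare (a • u + b • v) (V.add_mem (V.smul_mem _ hu) (V.smul_mem _ hv)) ?_ x (hC hxC) hx
      _ hu
    intro h0
    obtain ⟨ha, hb⟩ := huv a b h0
    tauto

lemma exists_mul_eq_zero_of_finrank_le_five (h : IsFiveQuadricAlgebra 𝓡) {V C : Submodule K R}
    (hC : C ≤ V) (hC2 : 2 ≤ Module.finrank K C)
    (hle : Module.finrank K (V * 𝓡 1 : Submodule K R) ≤ 5) :
    ∃ w ∈ C, w ≠ 0 ∧ ∃ p ∈ 𝓡 1, p ≠ 0 ∧ w * p = 0 := by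
  obtain ⟨u, hu, v, hv, huv⟩ := exists_pair_of_two_le_finrank hC2
  have h1 : Module.finrank K (𝓡 1) = 5 := h.finrank_eq 1
  obtain ⟨a, b, x, hab, hxP, hx0, hx⟩ := exists_pencil_mul_eq_zero (P := 𝓡 1) (W := V * 𝓡 1)
      (fun p hp => Submodule.mul_mem_mul (hC hu) hp)
      (fun p hp => Submodule.mul_mem_mul (hC hv) hp) (by omega) (by omega)
  refine ⟨a • u + b • v, C.add_mem (C.smul_mem _ hu) (C.smul_mem _ hv), fun h0 => ?_, x, hxP,
    hx0, hx⟩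
  obtain ⟨ha, hb⟩ := huv a b h0
  tauto

/-- A three-dimensional space of quadrics with small growth has a common annihilator. -/
lemma exists_common_annihilator (h : IsFiveQuadricAlgebra 𝓡) {V : Submodule K R} (hV : V ≤ 𝓡 2)
    (hV3 : Module.finrank K V = 3) (hle : Module.finrank K (V * 𝓡 1 : Submodule K R) ≤ 5) :
    ∃ p ∈ 𝓡 1, p ≠ 0 ∧ ∀ v ∈ V, p * v = 0 := by
  by_cases hbig : ∃ w ∈ V, w ≠ 0 ∧ (∃ p ∈ 𝓡 1, p ≠ 0 ∧ w * p = 0) ∧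
      4 ≤ Module.finrank K (Submodule.span K {w} * 𝓡 1 : Submodule K R)
  · obtain ⟨w, hw, -, ⟨p, hp, hp0, hwp⟩, h4⟩ := hbig
    refine ⟨p, hp, hp0, fun v hv => ?_⟩
    rw [mul_comm]
    exact h.mul_eq_zero_of_finrank hv hw hV hp hwp (by omega)
  push Not at hbig
  obtain ⟨w₁, hw₁, hw₁0, hp₁⟩ := h.exists_mul_eq_zero_of_finrank_le_five le_rfl (by omega) hle
  have hd₁ := hbig w₁ hw₁ hw₁0 hp₁
  obtain ⟨C, hC, hCw, hCf⟩ := Submodule.exists_relative_compl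
    ((Submodule.span_singleton_le_iff_mem w₁ V).2 hw₁)
  rw [finrank_span_singleton hw₁0] at hCf
  obtain ⟨w₂, hw₂, hw₂0, hp₂⟩ := h.exists_mul_eq_zero_of_finrank_le_five hC (by omega) hle
  have hd₂ := hbig w₂ (hC hw₂) hw₂0 hp₂
  have hd₁' := h.three_le_finrank (hV hw₁) hw₁0
  have hd₂' := h.three_le_finrank (hV (hC hw₂)) hw₂0
  obtain ⟨V', hV'⟩ : ∃ V', V' = Submodule.span K {w₁} ⊔ Submodule.span K {w₂} := ⟨_, rfl⟩
  have hV'V : V' ≤ V := hV' ▸ sup_le ((Submodule.span_singleton_le_iff_mem w₁ V).2 hw₁)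
    ((Submodule.span_singleton_le_iff_mem w₂ V).2 (hC hw₂))
  have hV'2 : 2 ≤ Module.finrank K V' := by
    have e := Submodule.finrank_sup_add_finrank_inf_eq (Submodule.span K {w₁})
      (Submodule.span K {w₂})
    have hinf : Submodule.span K {w₁} ⊓ Submodule.span K {w₂} = ⊥ := by
      rw [eq_bot_iff]
      intro x hx
      exact hCw x ((Submodule.span_singleton_le_iff_mem w₂ C).2 hw₂ hx.2) hx.1
    rw [← hV', hinf, finrank_span_singleton hw₁0, finrank_span_singleton hw₂0, finrank_bot] at e
    omega
  have h5 := h.five_le_finrank (hV'V.trans hV) hV'2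
  have hVV' : V' * 𝓡 1 = V * 𝓡 1 :=
    Submodule.eq_of_le_of_finrank_le (mul_le_mul_left hV'V _) (by omega)
  have hN₁ := h.finrank_annIn_singleton (j := 1) w₁
  have hN₂ := h.finrank_annIn_singleton (j := 1) w₂
  rw [Nat.choose_one_right] at hN₁ hN₂
  have hcommon : ∃ p ∈ annIn (𝓡 1) {w₁} ⊓ annIn (𝓡 1) {w₂}, p ≠ 0 := by
    by_contra! hno
    have hbot : annIn (𝓡 1) {w₁} ⊓ annIn (𝓡 1) {w₂} = ⊥ := (Submodule.eq_bot_iff _).2 hno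
    have e := Submodule.finrank_sup_add_finrank_inf_eq (annIn (𝓡 1) {w₁}) (annIn (𝓡 1) {w₂})
    rw [hbot, finrank_bot] at e
    have hall := h.mul_eq_of_finrank (L := annIn (𝓡 1) {w₁} ⊔ annIn (𝓡 1) {w₂}) (d := 1)
      (sup_le (annIn_le _ _) (annIn_le _ _)) (by omega)
    have hmul : ∀ w : R, annIn (𝓡 1) {w} * 𝓡 1 ≤ annIn (𝓡 2) {w} := by
      intro w
      rw [Submodule.mul_le]
      rintro a ha b hb
      refine ⟨h.mul_mem rfl ha.1 hb, ?_⟩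
      rintro _ rfl
      rw [← mul_assoc, ha.2 _ rfl, zero_mul]
    have hle2 : 𝓡 (1 + 1) ≤ annIn (𝓡 2) {w₁} ⊔ annIn (𝓡 2) {w₂} := by
      refine hall.symm.le.trans ?_
      rw [Submodule.sup_mul]
      exact sup_le_sup (hmul w₁) (hmul w₂)
    have e2 := Submodule.finrank_mono hle2
    have e3 := Submodule.finrank_sup_add_finrank_inf_eq (annIn (𝓡 2) {w₁}) (annIn (𝓡 2) {w₂})
    have e4 := h.finrank_annIn_singleton' (i := 2) (t := 1) (j := 2) rfl (hV hw₁)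
    have e5 := h.finrank_annIn_singleton' (i := 2) (t := 1) (j := 2) rfl (hV (hC hw₂))
    have e6 := h.finrank_annIn (i := 2) (t := 1) (j := 2) rfl (hV'V.trans hV)
    have hinf : annIn (𝓡 2) (V' : Set R) ≤ annIn (𝓡 2) {w₁} ⊓ annIn (𝓡 2) {w₂} := by
      intro x hx
      refine ⟨⟨hx.1, ?_⟩, hx.1, ?_⟩
      · rintro _ rfl
        exact hx.2 _ (hV' ▸ Submodule.mem_sup_left (Submodule.mem_span_singleton_self _))
      · rintro _ rfl
        exact hx.2 _ (hV' ▸ Submodule.mem_sup_right (Submodule.mem_span_singleton_self _))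
    have e7 := Submodule.finrank_mono hinf
    have e8 : Module.finrank K (𝓡 (1 + 1)) = 10 := h.finrank_eq 2
    have e9 : Nat.choose 5 2 = 10 := rfl
    rw [← hVV'] at hle
    omega
  obtain ⟨p, ⟨hp₁, hp₂⟩, hp0⟩ := hcommon
  refine ⟨p, hp₁.1, hp0, fun v hv => ?_⟩
  have hkill : V' * 𝓡 1 ≤ LinearMap.ker (LinearMap.mulLeft K p) := by
    rw [hV', Submodule.sup_mul, sup_le_iff]
    constructor
    all_goals
      rw [Submodule.mul_le]
      intro a ha b _
      obtain ⟨c, rfl⟩ := Submodule.mem_span_singleton.1 ha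
      rw [LinearMap.mem_ker, LinearMap.mulLeft_apply]
    · rw [← mul_assoc, mul_smul_comm, mul_comm p, hp₁.2 _ rfl, smul_zero, zero_mul]
    · rw [← mul_assoc, mul_smul_comm, mul_comm p, hp₂.2 _ rfl, smul_zero, zero_mul]
  apply h.eq_zero_of_mul (i := 3) (t := 1) (by omega) (h.mul_mem rfl hp₁.1 (hV hv))
  intro r hr
  rw [hVV'] at hkill
  have := hkill (Submodule.mul_mem_mul hv hr)
  rw [LinearMap.mem_ker, LinearMap.mulLeft_apply] at this
  rw [mul_comm, mul_assoc, this]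

lemma six_le_finrank (h : IsFiveQuadricAlgebra 𝓡) {V : Submodule K R} (hV : V ≤ 𝓡 2)
    (hV3 : Module.finrank K V = 3) :
    6 ≤ Module.finrank K (V * 𝓡 1 : Submodule K R) := by
  by_contra! hlt
  obtain ⟨p, hp, hp0, hpV⟩ := h.exists_common_annihilator hV hV3 (by omega)
  obtain hd | ⟨q, hq, hpq, hann⟩ := h.dichotomy p hp hp0
  · have := hd V hV hpV
    omega
  have hq0 : q ≠ 0 := by
    rintro rfl
    obtain ⟨v, hv, hv0⟩ := exists_ne_zero_of_finrank_pos (V := V) (by omega)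
    obtain ⟨c, -, rfl⟩ := hann 1 v (hV hv) (hpV v hv)
    exact hv0 (zero_mul c)
  set V₀ := 𝓡 1 ⊓ V.comap (LinearMap.mulLeft K q) with hV₀
  have hV₀4 : 4 ≤ Module.finrank K V₀ := by
    have e := finrank_inf_ker_add_finrank_map (LinearMap.mulLeft K q) V₀
    have hpmem : p ∈ V₀ ⊓ LinearMap.ker (LinearMap.mulLeft K q) := by
      have hqp : LinearMap.mulLeft K q p = 0 := by rw [LinearMap.mulLeft_apply, mul_comm, hpq]
      refine ⟨⟨hp, ?_⟩, hqp⟩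
      rw [SetLike.mem_coe, Submodule.mem_comap, hqp]
      exact V.zero_mem
    have hpos : 0 < Module.finrank K
        (V₀ ⊓ LinearMap.ker (LinearMap.mulLeft K q) : Submodule K R) :=
      Module.finrank_pos_iff_exists_ne_zero.2 ⟨⟨p, hpmem⟩, fun h0 => hp0 (congrArg Subtype.val h0)⟩
    have hmap : V ≤ V₀.map (LinearMap.mulLeft K q) := by
      intro v hv
      obtain ⟨c, hc, rfl⟩ := hann 1 v (hV hv) (hpV v hv)
      exact ⟨c, ⟨hc, hv⟩, rfl⟩
    have := Submodule.finrank_mono hmap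
    omega
  have hmul := h.mul_eq_of_finrank (L := V₀) inf_le_left (d := 1) (by omega)
  have hqR : ∀ r ∈ 𝓡 2, q * r ∈ V * 𝓡 1 := by
    have : V₀ * 𝓡 1 ≤ (V * 𝓡 1).comap (LinearMap.mulLeft K q) := by
      rw [Submodule.mul_le]
      intro a ha b hb
      rw [Submodule.mem_comap, LinearMap.mulLeft_apply, ← mul_assoc]
      exact Submodule.mul_mem_mul ha.2 hb
    rw [hmul] at this
    exact fun r hr => this hr
  have hle : annIn (𝓡 3) {p} ≤ V * 𝓡 1 := by
    intro u hu
    obtain ⟨c, hc, rfl⟩ := hann 2 u hu.1 (hu.2 p rfl)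
    exact hqR c hc
  have e1 := h.finrank_annIn_singleton' (i := 1) (t := 1) (j := 3) rfl hp
  have e2 := h.finrank_annIn_singleton (j := 1) p
  have hpos : 0 < Module.finrank K (annIn (𝓡 1) {p}) :=
    Module.finrank_pos_iff_exists_ne_zero.2
      ⟨⟨q, hq, fun _ hu => by rw [hu, hpq]⟩, fun h0 => hq0 (congrArg Subtype.val h0)⟩
  have e3 := Submodule.finrank_mono hle
  have e4 : Nat.choose 5 3 = 10 := rfl
  rw [Nat.choose_one_right] at e2
  omega

end IsFiveQuadricAlgebra

end GrowthBounds

section GrowthTable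

/-- `fiveGrowth d k` is the number of squarefree monomials of degree `d + 1` in five variables
divisible by one of the first `k` squarefree monomials of degree `d`. -/
def fiveGrowth (d k : ℕ) : ℕ :=
  (([[0, 5], [0, 4, 7, 9, 10, 10], [0, 3, 5, 6, 6, 8, 9, 9, 10, 10, 10],
    [0, 2, 3, 3, 4, 4, 4, 5, 5, 5, 5], [0, 1, 1, 1, 1, 1]] : List (List ℕ)).getD d []).getD k 0

lemma fiveGrowth_of_le {d : ℕ} (hd : 5 ≤ d) (k : ℕ) : fiveGrowth d k = 0 := by
  obtain ⟨d, rfl⟩ := Nat.exists_eq_add_of_le' hd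
  rfl

variable {K R : Type*} [Field K] [CommRing R] [Algebra K R]

lemma le_annIn_annIn {V P Q : Submodule K R} (hV : V ≤ P) :
    V ≤ annIn P (annIn Q (V : Set R) : Set R) := fun v hv =>
  ⟨hV hv, fun w hw => by rw [mul_comm]; exact hw.2 v hv⟩

namespace IsFiveQuadricAlgebra

variable {𝓡 : ℕ → Submodule K R} [Module.Finite K R]

lemma finrank_le_choose (h : IsFiveQuadricAlgebra 𝓡) {V : Submodule K R} {d : ℕ} (hV : V ≤ 𝓡 d) :
    Module.finrank K V ≤ Nat.choose 5 d := by
  rw [← h.finrank_eq d]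
  exact Submodule.finrank_mono hV

lemma fiveGrowth_zero_le (h : IsFiveQuadricAlgebra 𝓡) {V : Submodule K R} (hV : V ≤ 𝓡 0) :
    fiveGrowth 0 (Module.finrank K V) ≤ Module.finrank K (V * 𝓡 1 : Submodule K R) := by
  have h1 := h.finrank_le_choose hV
  rw [Nat.choose_zero_right] at h1
  obtain h0 | h0 : Module.finrank K V = 0 ∨ Module.finrank K V = 1 := by omega
  · rw [h0]; exact Nat.zero_le _
  · have hVe : V = 𝓡 0 := Submodule.eq_of_le_of_finrank_le hV (by rw [h.finrank_eq, h0]; rfl)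
    rw [h0, hVe, h.mul_eq, h.finrank_eq]
    decide

lemma fiveGrowth_one_le (h : IsFiveQuadricAlgebra 𝓡) {V : Submodule K R} (hV : V ≤ 𝓡 1) :
    fiveGrowth 1 (Module.finrank K V) ≤ Module.finrank K (V * 𝓡 1 : Submodule K R) := by
  have h1 := h.finrank_le_choose hV
  have h2 := h.linear_growth V hV 1
  rw [Nat.choose_one_right] at h1
  generalize Module.finrank K V = k at *
  generalize Module.finrank K (V * 𝓡 1 : Submodule K R) = g at *
  interval_cases k <;> norm_num [Nat.choose] at h2 <;> simp [fiveGrowth] <;> omega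

lemma fiveGrowth_two_le (h : IsFiveQuadricAlgebra 𝓡) [IsAlgClosed K] {V : Submodule K R}
    (hV : V ≤ 𝓡 2) :
    fiveGrowth 2 (Module.finrank K V) ≤ Module.finrank K (V * 𝓡 1 : Submodule K R) := by
  have key : ∀ V ≤ 𝓡 2,
      (1 ≤ Module.finrank K V → 3 ≤ Module.finrank K (V * 𝓡 1 : Submodule K R)) ∧
      (2 ≤ Module.finrank K V → 5 ≤ Module.finrank K (V * 𝓡 1 : Submodule K R)) ∧
      (3 ≤ Module.finrank K V → 6 ≤ Module.finrank K (V * 𝓡 1 : Submodule K R)) := by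
    intro V hV
    refine ⟨fun h1 => ?_, h.five_le_finrank hV, fun h3 => ?_⟩
    · obtain ⟨v, hv, hv0⟩ := exists_ne_zero_of_finrank_pos h1
      exact (h.three_le_finrank (hV hv) hv0).trans (Submodule.finrank_mono
        (mul_le_mul_left ((Submodule.span_singleton_le_iff_mem v V).2 hv) _))
    · obtain ⟨V', hV', hf⟩ := exists_le_finrank_eq V h3
      exact (h.six_le_finrank (hV'.trans hV) hf).trans (Submodule.finrank_mono
        (mul_le_mul_left hV' _))
  have e1 := h.finrank_annIn (i := 2) (t := 1) (j := 2) rfl hV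
  have e2 := h.finrank_annIn (i := 2) (t := 1) (j := 2) rfl (annIn_le (𝓡 2) (V : Set R))
  have e3 := Submodule.finrank_mono (le_annIn_annIn (Q := 𝓡 2) hV)
  have e4 := h.finrank_le_choose hV
  obtain ⟨a1, a2, a3⟩ := key V hV
  obtain ⟨b1, b2, b3⟩ := key _ (annIn_le (𝓡 2) (V : Set R))
  rw [show Nat.choose 5 2 = 10 from rfl] at e1 e2 e4
  generalize Module.finrank K V = k at *
  generalize Module.finrank K (V * 𝓡 1 : Submodule K R) = g at *
  interval_cases k <;> simp [fiveGrowth] <;> omega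

lemma fiveGrowth_three_le (h : IsFiveQuadricAlgebra 𝓡) {V : Submodule K R} (hV : V ≤ 𝓡 3) :
    fiveGrowth 3 (Module.finrank K V) ≤ Module.finrank K (V * 𝓡 1 : Submodule K R) := by
  have e1 := h.finrank_annIn (i := 3) (t := 1) (j := 1) rfl hV
  have e2 := h.finrank_annIn (i := 1) (t := 1) (j := 3) rfl (annIn_le (𝓡 1) (V : Set R))
  have e3 := Submodule.finrank_mono (le_annIn_annIn (Q := 𝓡 1) hV)
  have e4 := h.linear_growth _ (annIn_le (𝓡 1) (V : Set R)) 1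
  have e5 := h.finrank_le_choose hV
  rw [show Nat.choose 5 1 = 5 from rfl] at e1
  rw [show Nat.choose 5 3 = 10 from rfl] at e2 e5
  rw [show Nat.choose 5 (1 + 1) = 10 from rfl, ← e1, Nat.add_sub_cancel_left] at e4
  generalize Module.finrank K V = k at *
  have hg : Module.finrank K (V * 𝓡 1 : Submodule K R) ≤ 5 := by omega
  generalize Module.finrank K (V * 𝓡 1 : Submodule K R) = g at *
  have hk : k ≤ Nat.choose g 2 := by change _ ≤ _ + Nat.choose g 2 at e4; omega
  have table : ∀ g ≤ 5, ∀ k ≤ 10, k ≤ Nat.choose g 2 → fiveGrowth 3 k ≤ g := by decide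
  exact table g hg k e5 hk

lemma fiveGrowth_four_le (h : IsFiveQuadricAlgebra 𝓡) {V : Submodule K R} (hV : V ≤ 𝓡 4) :
    fiveGrowth 4 (Module.finrank K V) ≤ Module.finrank K (V * 𝓡 1 : Submodule K R) := by
  have e5 := h.finrank_le_choose hV
  rw [show Nat.choose 5 4 = 5 from rfl] at e5
  have key : 1 ≤ Module.finrank K V → 1 ≤ Module.finrank K (V * 𝓡 1 : Submodule K R) := by
    intro h1
    obtain ⟨v, hv, hv0⟩ := exists_ne_zero_of_finrank_pos h1
    by_contra hlt
    have hbot : V * 𝓡 1 = ⊥ := by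
      rw [← Submodule.finrank_eq_zero (R := K)]
      omega
    apply hv0
    apply h.nondeg 4 (by omega) v (hV hv)
    intro l hl
    have := Submodule.mul_mem_mul hv hl
    rwa [hbot, Submodule.mem_bot, mul_comm] at this
  generalize Module.finrank K V = k at *
  generalize Module.finrank K (V * 𝓡 1 : Submodule K R) = g at *
  interval_cases k <;> simp [fiveGrowth] <;> omega

/-- The Macaulay-type growth bound for subspaces of a graded piece. -/
theorem fiveGrowth_le (h : IsFiveQuadricAlgebra 𝓡) [IsAlgClosed K] {V : Submodule K R} {d : ℕ}
    (hV : V ≤ 𝓡 d) :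
    fiveGrowth d (Module.finrank K V) ≤ Module.finrank K (V * 𝓡 1 : Submodule K R) := by
  obtain h5 | h5 := le_or_gt 5 d
  · rw [fiveGrowth_of_le h5]; exact Nat.zero_le _
  interval_cases d
  exacts [h.fiveGrowth_zero_le hV, h.fiveGrowth_one_le hV, h.fiveGrowth_two_le hV,
    h.fiveGrowth_three_le hV, h.fiveGrowth_four_le hV]

end IsFiveQuadricAlgebra

end GrowthTable

section QuotientAlgebra

variable {K : Type*} [Field K] {n : ℕ}

/-- The degree `d` piece of `A ⧸ Q`. -/
noncomputable def quotPiece (Q : Ideal (MvPolynomial (Fin n) K)) (d : ℕ) :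
    Submodule K (MvPolynomial (Fin n) K ⧸ Q) :=
  (homogeneousSubmodule (Fin n) K d).map (Ideal.Quotient.mkₐ K Q).toLinearMap

lemma quotPiece_eq_pow (Q : Ideal (MvPolynomial (Fin n) K)) (d : ℕ) :
    quotPiece Q d = quotPiece Q 1 ^ d := by
  rw [quotPiece, quotPiece, ← homogeneousSubmodule_one_pow, Submodule.map_pow]

lemma finrank_map_component {Q I : Ideal (MvPolynomial (Fin n) K)} (hQI : Q ≤ I) (d : ℕ) :
    Module.finrank K ((component I d).map (Ideal.Quotient.mkₐ K Q).toLinearMap) + hilbCodim I d =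
      hilbCodim Q d := by
  have e := finrank_inf_ker_add_finrank_map (Ideal.Quotient.mkₐ K Q).toLinearMap (component I d)
  have hk : component I d ⊓ LinearMap.ker (Ideal.Quotient.mkₐ K Q).toLinearMap =
      component Q d := by
    ext f
    have : f ∈ LinearMap.ker (Ideal.Quotient.mkₐ K Q).toLinearMap ↔ f ∈ Q :=
      Ideal.Quotient.eq_zero_iff_mem
    rw [Submodule.mem_inf, this, mem_component, mem_component]
    exact ⟨fun h => ⟨h.2, h.1.2⟩, fun h => ⟨⟨hQI h.1, h.2⟩, h.1⟩⟩
  rw [hk] at e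
  have e1 := hilbCodim_add_hilb I d
  have e2 := hilbCodim_add_hilb Q d
  unfold hilb at e1 e2
  omega

lemma finrank_quotPiece (Q : Ideal (MvPolynomial (Fin n) K)) (d : ℕ) :
    Module.finrank K (quotPiece Q d) = hilbCodim Q d := by
  have e := finrank_map_component (Q := Q) (I := ⊤) le_top d
  have h0 : hilbCodim (⊤ : Ideal (MvPolynomial (Fin n) K)) d = 0 :=
    hilbCodim_eq_zero_iff.2 fun _ _ => Submodule.mem_top
  have h1 : component (⊤ : Ideal (MvPolynomial (Fin n) K)) d = homogeneousSubmodule (Fin n) K d :=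
    top_inf_eq _
  rw [h0, h1] at e
  exact e

lemma module_finite_quotient {Q : Ideal (MvPolynomial (Fin n) K)} {N : ℕ}
    (hN : ∀ d, N ≤ d → hilbCodim Q d = 0) :
    Module.Finite K (MvPolynomial (Fin n) K ⧸ Q) := by
  have hfin : ∀ d, Module.Finite K (quotPiece Q d) := fun d => by
    unfold quotPiece; infer_instance
  have hsup : (Finset.range N).sup (quotPiece Q) = ⊤ := by
    rw [eq_top_iff]
    rintro x -
    obtain ⟨f, rfl⟩ := Ideal.Quotient.mk_surjective x
    rw [← sum_homogeneousComponent f, map_sum]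
    refine Submodule.sum_mem _ fun d _ => ?_
    obtain hd | hd := lt_or_ge d N
    · exact Finset.le_sup (f := quotPiece Q) (Finset.mem_range.2 hd)
        ⟨_, homogeneousComponent_mem d f, rfl⟩
    · rw [Ideal.Quotient.eq_zero_iff_mem.2
        (hilbCodim_eq_zero_iff.1 (hN d hd) _ (homogeneousComponent_isHomogeneous d f))]
      exact Submodule.zero_mem _
  have : Module.Finite K ((Finset.range N).sup (quotPiece Q) : Submodule K _) :=
    Submodule.finite_finset_sup _ _
  rw [hsup] at this
  exact Module.finite_def.2 (Submodule.fg_top _ |>.1 (Module.finite_def.1 this))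

lemma homogeneousComponent_mem_mul {Λ : Submodule K (MvPolynomial (Fin n) K)}
    (hΛ : Λ ≤ homogeneousSubmodule (Fin n) K 1) {g : MvPolynomial (Fin n) K}
    (hg : g ∈ Ideal.span (Λ : Set (MvPolynomial (Fin n) K))) (d : ℕ) :
    homogeneousComponent (d + 1) g ∈ Λ * homogeneousSubmodule (Fin n) K d := by
  have key : ∀ f ∈ Λ * (⊤ : Submodule K (MvPolynomial (Fin n) K)),
      homogeneousComponent (d + 1) f ∈ Λ * homogeneousSubmodule (Fin n) K d := by
    intro f hf
    induction hf using Submodule.mul_induction_on' with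
    | mem_mul_mem a ha b _ =>
      rw [homogeneousComponent_mul_add (hΛ ha)]
      exact Submodule.mul_mem_mul ha (homogeneousComponent_mem d b)
    | add a _ b _ ha hb => rw [map_add]; exact Submodule.add_mem _ ha hb
  apply key
  induction hg using Submodule.span_induction with
  | mem x hx => rw [← mul_one x]; exact Submodule.mul_mem_mul hx Submodule.mem_top
  | zero => exact Submodule.zero_mem _
  | add a b _ _ ha hb => exact Submodule.add_mem _ ha hb
  | smul a x hx' hx =>
    clear hx'
    rw [smul_eq_mul, mul_comm a x]
    induction hx using Submodule.mul_induction_on' with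
    | mem_mul_mem c hc b _ => rw [mul_assoc]; exact Submodule.mul_mem_mul hc Submodule.mem_top
    | add c _ b _ hc hb => rw [add_mul]; exact Submodule.add_mem _ hc hb

namespace IsQuadricSystem

variable {F Λ : Submodule K (MvPolynomial (Fin n) K)} {Q : Ideal (MvPolynomial (Fin n) K)}

lemma hilbCodim_eq (h : IsQuadricSystem F Λ)
    (hQ : Q = Ideal.span (Λ : Set (MvPolynomial (Fin n) K)) ⊔
    Ideal.span (F : Set (MvPolynomial (Fin n) K))) [Infinite K] (d : ℕ) :
    hilbCodim Q d = Nat.choose 5 d := by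
  rw [hQ]
  exact h.isCI.hilbCodim_eq (by rw [add_comm]; exact h.finrank_lin) d

lemma isHomog (h : IsQuadricSystem F Λ)
    (hQ : Q = Ideal.span (Λ : Set (MvPolynomial (Fin n) K)) ⊔
    Ideal.span (F : Set (MvPolynomial (Fin n) K))) : IsHomog Q := by
  rw [hQ]
  exact h.isCI.isHomog

lemma moduleFinite (h : IsQuadricSystem F Λ)
    (hQ : Q = Ideal.span (Λ : Set (MvPolynomial (Fin n) K)) ⊔
    Ideal.span (F : Set (MvPolynomial (Fin n) K))) [Infinite K] :
    Module.Finite K (MvPolynomial (Fin n) K ⧸ Q) :=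
  module_finite_quotient (N := 6) fun d hd => by
    rw [h.hilbCodim_eq hQ, Nat.choose_eq_zero_of_lt hd]

lemma linear_growth (h : IsQuadricSystem F Λ)
    (hQ : Q = Ideal.span (Λ : Set (MvPolynomial (Fin n) K)) ⊔
    Ideal.span (F : Set (MvPolynomial (Fin n) K))) [Infinite K]
    {L : Submodule K (MvPolynomial (Fin n) K ⧸ Q)}
    (hL : L ≤ quotPiece Q 1) (d : ℕ) : Nat.choose 5 (d + 1) ≤
    Module.finrank K (L * quotPiece Q d : Submodule K (MvPolynomial (Fin n) K ⧸ Q)) +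
      Nat.choose (5 - Module.finrank K L) (d + 1) := by
  have := h.moduleFinite hQ
  set π := (Ideal.Quotient.mkₐ K Q).toLinearMap with hπ
  have hπ0 : ∀ f, π f = 0 ↔ f ∈ Q := fun f => Ideal.Quotient.eq_zero_iff_mem
  set Λ' := homogeneousSubmodule (Fin n) K 1 ⊓ L.comap π with hΛ'
  have hle : Λ' ≤ homogeneousSubmodule (Fin n) K 1 := inf_le_left
  have : Module.Finite K Λ' := Submodule.finiteDimensional_of_le hle
  have hQΛ' : component Q 1 ≤ Λ' := by
    intro f hf
    refine ⟨hf.2, ?_⟩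
    rw [SetLike.mem_coe, Submodule.mem_comap, (hπ0 f).2 hf.1]
    exact L.zero_mem
  have hΛ : Λ ≤ Λ' := by
    intro f hf
    refine hQΛ' ⟨?_, h.lin hf⟩
    rw [hQ]
    exact Submodule.mem_sup_left (Ideal.subset_span hf)
  have hmapL : Λ'.map π = L := by
    apply le_antisymm
    · rintro _ ⟨f, hf, rfl⟩
      exact hf.2
    · intro x hx
      obtain ⟨f, hf, rfl⟩ := hL hx
      exact ⟨f, ⟨hf, hx⟩, rfl⟩
  have hker : Λ' ⊓ LinearMap.ker π = component Q 1 := by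
    apply le_antisymm
    · exact fun f hf => ⟨(hπ0 f).1 hf.2, hle hf.1⟩
    · exact fun f hf => ⟨hQΛ' hf, (hπ0 f).2 hf.1⟩
  have e1 := finrank_inf_ker_add_finrank_map π Λ'
  rw [hmapL, hker] at e1
  have e2 := hilbCodim_add_hilb Q 1
  rw [h.hilbCodim_eq hQ, finrank_homogeneousSubmodule_one, Nat.choose_one_right, hilb] at e2
  have e3 : Module.finrank K L ≤ 5 := by
    have := Submodule.finrank_mono hL
    rwa [finrank_quotPiece, h.hilbCodim_eq hQ, Nat.choose_one_right] at this
  have e4 := h.hilbCodim_sup_le hΛ hle (k := 5 - Module.finrank K L) (by omega) (d + 1)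
  set I := Ideal.span (Λ' : Set (MvPolynomial (Fin n) K)) ⊔
    Ideal.span (F : Set (MvPolynomial (Fin n) K)) with hI
  have hQI : Q ≤ I := by
    rw [hQ]
    exact sup_le_sup_right (Ideal.span_mono hΛ) _
  have e5 := finrank_map_component hQI (d + 1)
  rw [h.hilbCodim_eq hQ] at e5
  have hmap : (component I (d + 1)).map π ≤ L * quotPiece Q d := by
    rintro _ ⟨f, hf, rfl⟩
    obtain ⟨g, hg, k, hk, rfl⟩ := Submodule.mem_sup.1 hf.1
    have hkQ : k ∈ Q := by
      rw [hQ]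
      exact Submodule.mem_sup_right hk
    have hsplit := homogeneousComponent_of_mem (R := K) (m := d + 1) hf.2
    rw [if_pos rfl] at hsplit
    rw [← hsplit, map_add, map_add, (hπ0 _).2 (h.isHomog hQ k hkQ _), add_zero]
    have hmem := Submodule.mem_map_of_mem (f := π) (homogeneousComponent_mem_mul hle hg d)
    have hmul : (Λ' * homogeneousSubmodule (Fin n) K d).map π = L * quotPiece Q d := by
      rw [hπ, Submodule.map_mul, ← hπ, hmapL]
      rfl
    rwa [hmul] at hmem
  have e6 := Submodule.finrank_mono hmap
  rw [← hπ] at e5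
  omega

theorem isFiveQuadricAlgebra (h : IsQuadricSystem F Λ)
    (hQ : Q = Ideal.span (Λ : Set (MvPolynomial (Fin n) K)) ⊔
    Ideal.span (F : Set (MvPolynomial (Fin n) K))) [Infinite K] :
    IsFiveQuadricAlgebra (quotPiece Q) where
  zero := by rw [quotPiece_eq_pow]; exact pow_zero _
  one_mul d := by rw [quotPiece_eq_pow Q d, quotPiece_eq_pow Q (d + 1)]; exact (pow_succ' _ d).symm
  finrank_eq d := by rw [finrank_quotPiece, h.hilbCodim_eq hQ]
  nondeg d hd := by
    rintro _ ⟨u, hu, rfl⟩ hl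
    apply Ideal.Quotient.eq_zero_iff_mem.2
    rw [hQ]
    refine h.isCI.mem_of_X_mul_mem (by rw [add_comm]; exact h.finrank_lin) hd hu fun i => ?_
    rw [← hQ]
    apply Ideal.Quotient.eq_zero_iff_mem.1
    rw [map_mul]
    exact hl _ ⟨X i, isHomogeneous_X K i, rfl⟩
  linear_growth L hL d := h.linear_growth hQ hL d
  dichotomy := by
    rintro _ ⟨p, hp, rfl⟩ hp0
    have hpQ : p ∉ Q := fun hpQ => hp0 (Ideal.Quotient.eq_zero_iff_mem.2 hpQ)
    obtain hd | ⟨q, hq, hpq, hann⟩ := h.dichotomy hp hQ hpQ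
    · left
      intro V hV hpV
      have e := finrank_map_component (le_colonBy Q p) 2
      have hVle : V ≤ (component (colonBy Q p) 2).map (Ideal.Quotient.mkₐ K Q).toLinearMap := by
        intro v hv
        obtain ⟨u, hu, rfl⟩ := hV hv
        refine ⟨u, ⟨?_, hu⟩, rfl⟩
        refine mem_colonBy.2 (Ideal.Quotient.eq_zero_iff_mem.1 ?_)
        rw [map_mul]
        exact hpV _ hv
      have := h.moduleFinite hQ
      have := Submodule.finrank_mono hVle
      omega
    · right
      refine ⟨_, ⟨q, hq, rfl⟩, ?_, ?_⟩
      · change Ideal.Quotient.mk Q p * Ideal.Quotient.mk Q q = 0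
        rw [← map_mul, Ideal.Quotient.eq_zero_iff_mem]
        exact hpq
      · rintro d _ ⟨u, hu, rfl⟩ h0
        obtain ⟨c, hc, huc⟩ := hann d u hu (Ideal.Quotient.eq_zero_iff_mem.1
          (by rw [map_mul]; exact h0))
        refine ⟨_, ⟨c, hc, rfl⟩, ?_⟩
        change Ideal.Quotient.mk Q u = Ideal.Quotient.mk Q q * Ideal.Quotient.mk Q c
        rw [← map_mul]
        exact Ideal.Quotient.eq.2 huc

/-- Growth of a homogeneous ideal containing the complete intersection `Q`. -/
theorem fiveGrowth_le (h : IsQuadricSystem F Λ)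
    (hQ : Q = Ideal.span (Λ : Set (MvPolynomial (Fin n) K)) ⊔
    Ideal.span (F : Set (MvPolynomial (Fin n) K))) [IsAlgClosed K]
    {I : Ideal (MvPolynomial (Fin n) K)} (hQI : Q ≤ I) (d : ℕ) :
    fiveGrowth d (Nat.choose 5 d - hilbCodim I d) ≤
      Nat.choose 5 (d + 1) - hilbCodim I (d + 1) := by
  have : Infinite K := IsAlgClosed.instInfinite
  have := h.moduleFinite hQ
  have e1 := finrank_map_component hQI d
  have e2 := finrank_map_component hQI (d + 1)
  rw [h.hilbCodim_eq hQ] at e1 e2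
  have e3 := (h.isFiveQuadricAlgebra hQ).fiveGrowth_le (d := d)
    (V := (component I d).map (Ideal.Quotient.mkₐ K Q).toLinearMap)
    (Submodule.map_mono (component_le I d))
  have hle : (component I d).map (Ideal.Quotient.mkₐ K Q).toLinearMap * quotPiece Q 1 ≤
      (component I (d + 1)).map (Ideal.Quotient.mkₐ K Q).toLinearMap := by
    rw [quotPiece, ← Submodule.map_mul]
    apply Submodule.map_mono
    rw [Submodule.mul_le]
    exact fun a ha b hb => ⟨I.mul_mem_right b ha.1, IsHomogeneous.mul ha.2 hb⟩
  have e4 := Submodule.finrank_mono hle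
  rw [show Nat.choose 5 d - hilbCodim I d = Module.finrank K
    ((component I d).map (Ideal.Quotient.mkₐ K Q).toLinearMap) by omega]
  omega

end IsQuadricSystem

end QuotientAlgebra

section BaseChange

variable {K L : Type*} [Field K] [Field L] [Algebra K L] {ι : Type*}
  (b : Module.Basis ι K L) {n : ℕ}

lemma coeff_sum_monomial_coord (j : ι) (p : MvPolynomial (Fin n) L) (m : Fin n →₀ ℕ) :
    coeff m (∑ m ∈ p.support, monomial m (b.coord j (coeff m p))) = b.coord j (coeff m p) := by
  classical
  simp only [coeff_sum, coeff_monomial]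
  simp +contextual

/-- The coordinates of a polynomial over `L` with respect to a `K`-basis of `L`. -/
noncomputable def coordPoly (j : ι) : MvPolynomial (Fin n) L →ₗ[K] MvPolynomial (Fin n) K where
  toFun p := ∑ m ∈ p.support, monomial m (b.coord j (coeff m p))
  map_add' p q := by
    ext m
    rw [coeff_add, coeff_sum_monomial_coord, coeff_sum_monomial_coord, coeff_sum_monomial_coord,
      coeff_add, map_add]
  map_smul' c p := by
    ext m
    rw [RingHom.id_apply, coeff_smul, coeff_sum_monomial_coord, coeff_sum_monomial_coord,
      coeff_smul, map_smul]

lemma coeff_coordPoly (j : ι) (p : MvPolynomial (Fin n) L) (m : Fin n →₀ ℕ) :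
    coeff m (coordPoly b j p) = b.coord j (coeff m p) :=
  coeff_sum_monomial_coord b j p m

lemma coordPoly_mul_map (j : ι) (p : MvPolynomial (Fin n) L) (a : MvPolynomial (Fin n) K) :
    coordPoly b j (p * map (algebraMap K L) a) = coordPoly b j p * a := by
  ext m
  rw [coeff_coordPoly, coeff_mul, coeff_mul, map_sum]
  refine Finset.sum_congr rfl fun x _ => ?_
  rw [coeff_coordPoly, coeff_map, mul_comm, ← Algebra.smul_def, map_smul, smul_eq_mul, mul_comm]

lemma coordPoly_homogeneousComponent (j : ι) (p : MvPolynomial (Fin n) L) (d : ℕ) :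
    coordPoly b j (homogeneousComponent d p) = homogeneousComponent d (coordPoly b j p) := by
  ext m
  rw [coeff_coordPoly, coeff_homogeneousComponent, coeff_homogeneousComponent, coeff_coordPoly]
  split_ifs
  · rfl
  · exact map_zero _

lemma isHomogeneous_coordPoly {j : ι} {p : MvPolynomial (Fin n) L} {d : ℕ}
    (hp : p.IsHomogeneous d) : (coordPoly b j p).IsHomogeneous d := by
  intro m hm
  apply hp
  rw [coeff_coordPoly] at hm
  intro h0
  rw [h0, map_zero] at hm
  exact hm rfl

lemma exists_eq_sum_coordPoly (p : MvPolynomial (Fin n) L) :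
    ∃ J : Finset ι, p = ∑ j ∈ J, b j • map (algebraMap K L) (coordPoly b j p) := by
  classical
  refine ⟨p.support.biUnion fun m => (b.repr (coeff m p)).support, ?_⟩
  ext m
  simp only [coeff_sum, coeff_smul, coeff_map, coeff_coordPoly]
  by_cases hm : coeff m p = 0
  · simp [hm]
  · nth_rewrite 1 [← b.linearCombination_repr (coeff m p)]
    rw [Finsupp.linearCombination_apply, Finsupp.sum_of_support_subset _
      (Finset.subset_biUnion_of_mem (fun m => (b.repr (coeff m p)).support)
        (MvPolynomial.mem_support_iff.2 hm)) _ (by simp)]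
    refine Finset.sum_congr rfl fun j _ => ?_
    rw [Algebra.smul_def, smul_eq_mul, mul_comm]
    rfl

lemma mem_map_iff_coordPoly {I : Ideal (MvPolynomial (Fin n) K)} {p : MvPolynomial (Fin n) L} :
    p ∈ I.map (map (algebraMap K L)) ↔ ∀ j, coordPoly b j p ∈ I := by
  constructor
  · intro hp
    have key : ∀ (r : MvPolynomial (Fin n) L) (j : ι), coordPoly b j (r * p) ∈ I := by
      induction hp using Submodule.span_induction with
      | mem x hx =>
        obtain ⟨a, ha, rfl⟩ := hx
        intro r j
        rw [coordPoly_mul_map]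
        exact I.mul_mem_left _ ha
      | zero => intro r j; rw [mul_zero, map_zero]; exact I.zero_mem
      | add x y _ _ hx hy =>
        intro r j
        rw [mul_add, map_add]
        exact I.add_mem (hx r j) (hy r j)
      | smul s x _ hx =>
        intro r j
        rw [smul_eq_mul, ← mul_assoc]
        exact hx (r * s) j
    intro j
    rw [← one_mul p]
    exact key 1 j
  · intro hp
    obtain ⟨J, hJ⟩ := exists_eq_sum_coordPoly b p
    rw [hJ]
    refine Submodule.sum_mem _ fun j _ => ?_
    rw [smul_eq_C_mul]
    exact Ideal.mul_mem_left _ _ (Ideal.mem_map_of_mem _ (hp j))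

variable (L)

lemma IsHomog.map_algebraMap {I : Ideal (MvPolynomial (Fin n) K)} (hI : IsHomog I) :
    IsHomog (I.map (map (algebraMap K L))) := by
  intro p hp d
  let b := Module.Basis.ofVectorSpace K L
  rw [mem_map_iff_coordPoly b] at hp ⊢
  intro j
  rw [coordPoly_homogeneousComponent]
  exact hI _ (hp j) d

lemma IsRegSeq.map_algebraMap {r : ℕ} {f : Fin r → MvPolynomial (Fin n) K} (hf : IsRegSeq f) :
    IsRegSeq fun i => map (algebraMap K L) (f i) := by
  intro i g hg
  let b := Module.Basis.ofVectorSpace K L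
  have hspan : Ideal.span {p | ∃ j : Fin r, j < i ∧ p = map (algebraMap K L) (f j)} =
      (Ideal.span {p | ∃ j : Fin r, j < i ∧ p = f j}).map (map (algebraMap K L)) := by
    rw [Ideal.map_span]
    congr 1
    ext p
    constructor
    · rintro ⟨j, hj, rfl⟩
      exact ⟨f j, ⟨j, hj, rfl⟩, rfl⟩
    · rintro ⟨_, ⟨j, hj, rfl⟩, rfl⟩
      exact ⟨j, hj, rfl⟩
  rw [hspan, mem_map_iff_coordPoly b] at hg ⊢
  intro j
  apply hf i
  rw [← coordPoly_mul_map]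
  exact hg j

lemma hilb_map_algebraMap (I : Ideal (MvPolynomial (Fin n) K)) (d : ℕ) :
    hilb (I.map (map (algebraMap K L))) d = hilb I d := by
  let b := Module.Basis.ofVectorSpace K L
  let B := Module.finBasis K (component I d)
  let v : Fin (Module.finrank K (component I d)) → MvPolynomial (Fin n) L :=
    fun i => map (algebraMap K L) (B i)
  have hv : LinearIndependent L v := by
    rw [Fintype.linearIndependent_iff]
    intro g hg i
    apply b.repr.injective
    ext j
    have h1 : ∑ i, (b.coord j (g i)) • (B i : MvPolynomial (Fin n) K) = 0 := by
      rw [← map_zero (coordPoly b j), ← hg, map_sum]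
      refine Finset.sum_congr rfl fun i _ => ?_
      rw [smul_eq_C_mul (v i), coordPoly_mul_map, smul_eq_C_mul]
      congr 1
      ext m
      rw [coeff_coordPoly, coeff_C, coeff_C]
      split_ifs
      · rfl
      · exact (map_zero _).symm
    have h2 : ∑ i, (b.coord j (g i)) • B i = 0 := by
      apply Subtype.ext
      simpa using h1
    have := Fintype.linearIndependent_iff.1 B.linearIndependent _ h2 i
    simpa using this
  have hspan : component (I.map (map (algebraMap K L))) d = Submodule.span L (Set.range v) := by
    apply le_antisymm
    · intro p hp
      obtain ⟨J, hJ⟩ := exists_eq_sum_coordPoly b p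
      rw [hJ]
      refine Submodule.sum_mem _ fun j _ => Submodule.smul_mem _ _ ?_
      have hmem : coordPoly b j p ∈ component I d :=
        ⟨(mem_map_iff_coordPoly b).1 hp.1 j, isHomogeneous_coordPoly b hp.2⟩
      have hsum := congrArg
        (fun x : component I d => map (algebraMap K L) (x : MvPolynomial (Fin n) K))
        (B.sum_repr ⟨_, hmem⟩)
      simp only at hsum
      rw [← hsum, Submodule.coe_sum, map_sum]
      refine Submodule.sum_mem _ fun i _ => ?_
      rw [Submodule.coe_smul, smul_eq_C_mul, map_mul, map_C, ← smul_eq_C_mul]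
      exact Submodule.smul_mem _ _ (Submodule.subset_span ⟨i, rfl⟩)
    · rw [Submodule.span_le]
      rintro _ ⟨i, rfl⟩
      exact ⟨Ideal.mem_map_of_mem _ (B i).2.1, IsHomogeneous.map (B i).2.2 _⟩
  rw [hilb, hspan, finrank_span_eq_card hv, Fintype.card_fin, hilb]

end BaseChange

section Slices

variable {K : Type*} [Field K] {n : ℕ}

lemma colonBy_one (I : Ideal (MvPolynomial (Fin n) K)) : colonBy I 1 = I := by
  ext f
  rw [mem_colonBy, one_mul]

lemma colonBy_colonBy (I : Ideal (MvPolynomial (Fin n) K)) (g h : MvPolynomial (Fin n) K) :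
    colonBy (colonBy I g) h = colonBy I (g * h) := by
  ext f
  rw [mem_colonBy, mem_colonBy, mem_colonBy, mul_assoc]

lemma colonBy_pow_mono (I : Ideal (MvPolynomial (Fin n) K)) (g : MvPolynomial (Fin n) K)
    {a b : ℕ} (hab : a ≤ b) : colonBy I (g ^ a) ≤ colonBy I (g ^ b) := by
  obtain ⟨c, rfl⟩ := Nat.exists_eq_add_of_le hab
  rw [pow_add, ← colonBy_colonBy]
  exact le_colonBy _ _

lemma hilbCodim_eq_sum_colonBy {I : Ideal (MvPolynomial (Fin n) K)} (hI : IsHomog I)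
    {l : MvPolynomial (Fin n) K} (hl : l.IsHomogeneous 1) (hl0 : l ≠ 0) (d : ℕ) :
    hilbCodim I d =
      ∑ j ∈ Finset.range (d + 1), hilbCodim (colonBy I (l ^ j) ⊔ Ideal.span {l}) (d - j) := by
  induction d generalizing I with
  | zero =>
    rw [Finset.sum_range_one, pow_zero, colonBy_one, Nat.sub_zero,
      hilbCodim_sup_span_of_lt hI hl zero_lt_one]
  | succ d ih =>
    rw [hilbCodim_add hI hl hl0, ih (hI.colonBy hl), Finset.sum_range_succ' _ (d + 1), pow_zero,
      colonBy_one, add_comm, Nat.sub_zero]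
    congr 1
    refine Finset.sum_congr rfl fun j _ => ?_
    rw [colonBy_colonBy, ← pow_succ', Nat.add_sub_add_right]

/-- The ideal obtained from `I` by taking, for `i < k`, the colon by `l i ^ m (5 + i)` and then
adding `l i`. -/
noncomputable def sliceIdeal (l : ℕ → MvPolynomial (Fin n) K) (I : Ideal (MvPolynomial (Fin n) K)) :
    ℕ → (ℕ →₀ ℕ) → Ideal (MvPolynomial (Fin n) K)
  | 0, _ => I
  | k + 1, m => colonBy (sliceIdeal l I k m) (l k ^ m (5 + k)) ⊔ Ideal.span {l k}

variable {l : ℕ → MvPolynomial (Fin n) K} {I : Ideal (MvPolynomial (Fin n) K)}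

lemma sliceIdeal_mono {k : ℕ} {m m' : ℕ →₀ ℕ} (h : ∀ i < k, m (5 + i) ≤ m' (5 + i)) :
    sliceIdeal l I k m ≤ sliceIdeal l I k m' := by
  induction k with
  | zero => exact le_rfl
  | succ k ih =>
    apply sup_le_sup_right
    exact (colonBy_mono (ih fun i hi => h i (by omega)) _).trans
      (colonBy_pow_mono _ _ (h k (by omega)))

lemma sliceIdeal_congr {k : ℕ} {m m' : ℕ →₀ ℕ} (h : ∀ i < k, m (5 + i) = m' (5 + i)) :
    sliceIdeal l I k m = sliceIdeal l I k m' :=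
  le_antisymm (sliceIdeal_mono fun i hi => (h i hi).le) (sliceIdeal_mono fun i hi => (h i hi).ge)

lemma le_sliceIdeal (k : ℕ) (m : ℕ →₀ ℕ) : I ≤ sliceIdeal l I k m := by
  induction k with
  | zero => exact le_rfl
  | succ k ih => exact (ih.trans (le_colonBy _ _)).trans le_sup_left

lemma mem_sliceIdeal {k i : ℕ} (hi : i < k) (m : ℕ →₀ ℕ) : l i ∈ sliceIdeal l I k m := by
  induction k with
  | zero => omega
  | succ k ih =>
    obtain rfl | hik := eq_or_ne i k
    · exact Submodule.mem_sup_right (Ideal.mem_span_singleton_self _)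
    · exact Submodule.mem_sup_left (le_colonBy _ _ (ih (by omega)))

lemma IsHomog.sliceIdeal (hI : IsHomog I) (hl : ∀ i, (l i).IsHomogeneous 1) (k : ℕ)
    (m : ℕ →₀ ℕ) : IsHomog (sliceIdeal l I k m) := by
  induction k with
  | zero => exact hI
  | succ k ih => exact (ih.colonBy ((hl k).pow _)).sup_span (hl k)

lemma mem_finsuppAntidiag_Ico_four {k d : ℕ} {m : ℕ →₀ ℕ} :
    m ∈ Finset.finsuppAntidiag (Finset.Ico 4 (5 + k)) d ↔
      m 4 + ∑ i ∈ Finset.Ico 5 (5 + k), m i = d ∧ ∀ i, m i ≠ 0 → 4 ≤ i ∧ i < 5 + k := by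
  rw [Finset.mem_finsuppAntidiag, Finset.sum_eq_sum_Ico_succ_bot (by omega)]
  simp only [Finset.subset_iff, Finsupp.mem_support_iff, Finset.mem_Ico]

lemma hilbCodim_eq_sum_sliceIdeal (hI : IsHomog I) (hl : ∀ i, (l i).IsHomogeneous 1) {k : ℕ}
    (hl0 : ∀ i < k, l i ≠ 0) (d : ℕ) :
    hilbCodim I d = ∑ m ∈ Finset.finsuppAntidiag (Finset.Ico 4 (5 + k)) d,
      hilbCodim (sliceIdeal l I k m) (m 4) := by
  classical
  induction k with
  | zero =>
    have hs : Finset.Ico 4 (5 + 0) = {4} := rfl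
    rw [hs, Finset.sum_eq_single (Finsupp.single 4 d)]
    · rw [Finsupp.single_eq_same]
      rfl
    · intro m hm hne
      rw [Finset.mem_finsuppAntidiag, Finset.sum_singleton] at hm
      exact absurd (Finsupp.support_subset_singleton.1 hm.2) (by rw [hm.1]; exact hne)
    · intro hn
      exact absurd (Finset.mem_finsuppAntidiag.2 ⟨by simp, Finsupp.support_single_subset⟩) hn
  | succ k ih =>
    rw [ih fun i hi => hl0 i (by omega)]
    have hstep : ∀ m : ℕ →₀ ℕ, hilbCodim (sliceIdeal l I k m) (m 4) =
        ∑ j ∈ Finset.range (m 4 + 1),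
          hilbCodim (colonBy (sliceIdeal l I k m) (l k ^ j) ⊔ Ideal.span {l k}) (m 4 - j) :=
      fun m => hilbCodim_eq_sum_colonBy (hI.sliceIdeal hl k m) (hl k) (hl0 k (by omega)) _
    simp only [hstep]
    rw [Finset.sum_sigma']
    have hk4 : 5 + k ≠ 4 := by omega
    refine Finset.sum_bij'
      (fun x _ => (x.1.update 4 (x.1 4 - x.2)).update (5 + k) x.2)
      (fun m _ => ⟨(m.update (5 + k) 0).update 4 (m 4 + m (5 + k)), m (5 + k)⟩) ?_ ?_ ?_ ?_ ?_
    · rintro ⟨m, j⟩ hx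
      simp only [Finset.mem_sigma, mem_finsuppAntidiag_Ico_four, Finset.mem_range] at hx
      obtain ⟨⟨h1, h2⟩, h3⟩ := hx
      rw [mem_finsuppAntidiag_Ico_four, ← add_assoc 5 k 1, Finset.sum_Ico_succ_top (by omega),
        Finset.sum_congr rfl (g := fun i => m i)]
      · refine ⟨?_, fun i hi => ?_⟩
        · simp [hk4.symm]
          omega
        · by_cases hik : i = 5 + k
          · omega
          · by_cases hi4 : i = 4
            · omega
            · have := h2 i (by simpa [Function.update_apply, hk4, hk4.symm, hik, hi4] using hi)
              omega
      · intro i hi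
        rw [Finset.mem_Ico] at hi
        have hi1 : i ≠ 5 + k := by omega
        have hi2 : i ≠ 4 := by omega
        simp [hi1, hi2]
    · intro m hm
      rw [mem_finsuppAntidiag_Ico_four, ← add_assoc 5 k 1,
        Finset.sum_Ico_succ_top (by omega)] at hm
      simp only [Finset.mem_sigma, mem_finsuppAntidiag_Ico_four, Finset.mem_range]
      rw [Finset.sum_congr rfl (g := fun i => m i)]
      · refine ⟨⟨?_, fun i hi => ?_⟩, ?_⟩
        · simp
          omega
        · by_cases hi4 : i = 4
          · omega
          · by_cases hik : i = 5 + k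
            · simp [hk4, hik] at hi
            · have := hm.2 i (by simpa [Function.update_apply, hk4, hk4.symm, hik, hi4] using hi)
              omega
        · simp
      · intro i hi
        rw [Finset.mem_Ico] at hi
        have hi1 : i ≠ 5 + k := by omega
        have hi2 : i ≠ 4 := by omega
        simp [hi1, hi2]
    · rintro ⟨m, j⟩ hx
      simp only [Finset.mem_sigma, mem_finsuppAntidiag_Ico_four, Finset.mem_range] at hx
      obtain ⟨⟨h1, h2⟩, h3⟩ := hx
      have hmk : m (5 + k) = 0 := by
        by_contra h
        have := h2 _ h
        omega
      rw [Sigma.mk.injEq]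
      refine ⟨?_, heq_of_eq (by simp)⟩
      ext i
      by_cases hi4 : i = 4
      · simp [hk4.symm, hi4]
        omega
      · by_cases hik : i = 5 + k
        · simp [hk4, hk4.symm, hik, hmk]
        · simp [hk4.symm, hik, hi4]
    · intro m hm
      ext i
      by_cases hi4 : i = 4
      · simp [hk4.symm, hi4]
      · by_cases hik : i = 5 + k
        · simp [hik]
        · simp [hik, hi4]
    · rintro ⟨m, j⟩ hx
      symm
      rw [sliceIdeal]
      have h4 : ((m.update 4 (m 4 - j)).update (5 + k) j) 4 = m 4 - j := by
        simp [hk4.symm]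
      have hk : ((m.update 4 (m 4 - j)).update (5 + k) j) (5 + k) = j := by simp
      rw [h4, hk, sliceIdeal_congr (m' := m)]
      intro i hi
      have hi1 : 5 + i ≠ 5 + k := by omega
      have hi2 : 5 + i ≠ 4 := by omega
      simp [hi2, hi.ne]

end Slices

section SquarefreeMonomials

/-- Exponent vectors of the monomials of degree `d` in the variables indexed by `s` which are
squarefree in the variables with index less than `b`. -/
def sqMon (b : ℕ) (s : Finset ℕ) (d : ℕ) : Finset (ℕ →₀ ℕ) :=
  (Finset.finsuppAntidiag s d).filter fun m => ∀ i < b, m i ≤ 1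

lemma mem_sqMon_iff_sum {b d : ℕ} {s : Finset ℕ} {m : ℕ →₀ ℕ} : m ∈ sqMon b s d ↔
    ∑ i ∈ s, m i = d ∧ (∀ i ∉ s, m i = 0) ∧ ∀ i < b, m i ≤ 1 := by
  rw [sqMon, Finset.mem_filter, Finset.mem_finsuppAntidiag, and_assoc]
  refine and_congr_right fun _ => and_congr_left fun _ => ?_
  simp only [Finset.subset_iff, Finsupp.mem_support_iff]
  exact forall_congr' fun i => not_imp_comm

/-- The vectors obtained by increasing one coordinate with index in `s` of an element of `T` by one
which are squarefree in the coordinates with index less than `b`. -/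
noncomputable def upShadow (b : ℕ) (s : Finset ℕ) (T : Finset (ℕ →₀ ℕ)) : Finset (ℕ →₀ ℕ) :=
  (T.biUnion fun m => s.image fun i => m + Finsupp.single i 1).filter fun m => ∀ i < b, m i ≤ 1

lemma mem_upShadow {b : ℕ} {s : Finset ℕ} {T : Finset (ℕ →₀ ℕ)} {m : ℕ →₀ ℕ} :
    m ∈ upShadow b s T ↔
      (∃ t ∈ T, ∃ i ∈ s, t + Finsupp.single i 1 = m) ∧ ∀ i < b, m i ≤ 1 := by
  simp [upShadow]

/-- The support of `m` among the first five variables. -/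
def fiveHead (m : ℕ →₀ ℕ) : Finset ℕ := (Finset.range 5).filter fun i => m i ≠ 0

lemma mem_fiveHead {m : ℕ →₀ ℕ} {i : ℕ} : i ∈ fiveHead m ↔ i < 5 ∧ m i ≠ 0 := by
  rw [fiveHead, Finset.mem_filter, Finset.mem_range]

lemma card_fiveHead {m : ℕ →₀ ℕ} (hm : ∀ i < 5, m i ≤ 1) :
    (fiveHead m).card = ∑ i ∈ Finset.range 5, m i := by
  rw [fiveHead, Finset.card_filter]
  refine Finset.sum_congr rfl fun i hi => ?_
  have := hm i (Finset.mem_range.1 hi)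
  split_ifs <;> omega

/-- The supports of the first `k` squarefree monomials of degree `e` in five variables. -/
def fiveSegment (e k : ℕ) : Finset (Finset ℕ) :=
  ((((List.range 5).sublistsLen e).reverse.take k).map List.toFinset).toFinset

lemma fiveSegment_subset (e k : ℕ) :
    fiveSegment e k ⊆ Finset.powersetCard e (Finset.range 5) := by
  intro H hH
  rw [fiveSegment, List.mem_toFinset, List.mem_map] at hH
  obtain ⟨L, hL, rfl⟩ := hH
  have h := List.mem_of_mem_take hL
  rw [List.mem_reverse, List.mem_sublistsLen] at h
  rw [Finset.mem_powersetCard]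
  refine ⟨fun i hi => ?_, ?_⟩
  · exact Finset.mem_range.2 (List.mem_range.1 (h.1.subset (List.mem_toFinset.1 hi)))
  · rw [List.toFinset_card_of_nodup (h.1.nodup List.nodup_range), h.2]

lemma fiveSegment_mono (e : ℕ) {k k' : ℕ} (h : k ≤ k') : fiveSegment e k ⊆ fiveSegment e k' := by
  intro H hH
  simp only [fiveSegment, List.mem_toFinset, List.mem_map] at hH ⊢
  obtain ⟨L, hL, rfl⟩ := hH
  exact ⟨L, (List.take_subset_take_left _ h) hL, rfl⟩

set_option maxRecDepth 100000 in
lemma fiveSegment_table : ∀ e < 6, ∀ k ∈ Finset.range (Nat.choose 5 e + 1),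
    (fiveSegment e k).card = k ∧ ∀ H ∈ fiveSegment e k, ∀ i ∈ Finset.range 5, i ∉ H →
      insert i H ∈ fiveSegment (e + 1) (fiveGrowth e k) := by
  decide +kernel

lemma card_fiveSegment {e k : ℕ} (hk : k ≤ Nat.choose 5 e) : (fiveSegment e k).card = k := by
  by_cases he : e < 6
  · exact (fiveSegment_table e he k (Finset.mem_range.2 (by omega))).1
  · rw [Nat.choose_eq_zero_of_lt (by omega)] at hk
    obtain rfl : k = 0 := by omega
    rfl

lemma insert_mem_fiveSegment {e k i : ℕ} (hk : k ≤ Nat.choose 5 e) {H : Finset ℕ}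
    (hH : H ∈ fiveSegment e k) (hi : i < 5) (hiH : i ∉ H) :
    insert i H ∈ fiveSegment (e + 1) (fiveGrowth e k) := by
  by_cases he : e < 6
  · exact (fiveSegment_table e he k (Finset.mem_range.2 (by omega))).2 H hH i
      (Finset.mem_range.2 hi) hiH
  · rw [Nat.choose_eq_zero_of_lt (by omega)] at hk
    obtain rfl : k = 0 := by omega
    exact absurd hH (by simp [fiveSegment])

/-- The monomials `m` of degree `d` whose head belongs to a segment of size `k m e`, where `e` is
the degree of the head of `m`. -/
def stackSet (k : (ℕ →₀ ℕ) → ℕ → ℕ) (n d : ℕ) : Finset (ℕ →₀ ℕ) :=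
  (sqMon 5 (Finset.range n) d).filter fun m =>
    fiveHead m ∈ fiveSegment (fiveHead m).card (k m (fiveHead m).card)

variable {k : (ℕ →₀ ℕ) → ℕ → ℕ}

lemma card_stackSet (hk : ∀ m e, k m e ≤ Nat.choose 5 e)
    (hk' : ∀ m m' : ℕ →₀ ℕ, (∀ i, 5 ≤ i → m i ≤ m' i) → ∀ e, k m e ≤ k m' e) (r d : ℕ) :
    (stackSet k (5 + r) d).card =
      ∑ p ∈ Finset.finsuppAntidiag (Finset.Ico 4 (5 + r)) d, k p (p 4) := by
  have hcongr : ∀ m m' : ℕ →₀ ℕ, (∀ i, 5 ≤ i → m i = m' i) → ∀ e, k m e = k m' e :=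
    fun m m' h e => le_antisymm (hk' m m' (fun i hi => (h i hi).le) e)
      (hk' m' m (fun i hi => (h i hi).ge) e)
  have hsum : ∀ m : ℕ →₀ ℕ, ∑ i ∈ Finset.range (5 + r), m i =
      ∑ i ∈ Finset.range 5, m i + ∑ i ∈ Finset.Ico 5 (5 + r), m i := fun m =>
    (Finset.sum_range_add_sum_Ico _ (by omega)).symm
  rw [Finset.sum_congr rfl fun p _ => (card_fiveSegment (hk p (p 4))).symm, ← Finset.card_sigma]
  have hhead : ∀ (p : ℕ →₀ ℕ) {H : Finset ℕ}, H ⊆ Finset.range 5 →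
      fiveHead (p.filter (5 ≤ ·) + Finsupp.indicator H fun _ _ => 1) = H := by
    intro p H hH
    ext i
    rw [mem_fiveHead]
    have := @hH i
    rw [Finset.mem_range] at this
    by_cases hi : i ∈ H
    · simp [hi, this hi]
    · simp [hi, Finsupp.filter_apply]
      omega
  refine Finset.card_bij'
    (fun m _ => ⟨m.filter (5 ≤ ·) + Finsupp.single 4 (fiveHead m).card, fiveHead m⟩)
    (fun x _ => x.1.filter (5 ≤ ·) + Finsupp.indicator x.2 fun _ _ => 1) ?_ ?_ ?_ ?_
  · intro m hm
    rw [stackSet, Finset.mem_filter, mem_sqMon_iff_sum, hsum] at hm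
    obtain ⟨⟨h1, h2, h3⟩, h4⟩ := hm
    rw [← card_fiveHead h3] at h1
    rw [Finset.mem_sigma, mem_finsuppAntidiag_Ico_four]
    refine ⟨⟨?_, fun i hi => ?_⟩, ?_⟩
    · rw [← h1]
      congr 1
      · simp
      · refine Finset.sum_congr rfl fun i hi => ?_
        rw [Finset.mem_Ico] at hi
        have : i ≠ 4 := by omega
        simp [hi.1, this]
    · by_cases hi4 : i = 4
      · omega
      · by_cases hi5 : 5 ≤ i
        · refine ⟨by omega, ?_⟩
          by_contra h
          exact hi (by simp [hi5, hi4, h2 i (by simpa using h)])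
        · exact absurd (by simp [hi5, hi4]) hi
    · convert h4 using 2
      · simp
      · rw [hcongr _ m]
        · simp
        · intro i hi
          have : i ≠ 4 := by omega
          simp [hi, this]
  · rintro ⟨p, H⟩ hx
    rw [Finset.mem_sigma, mem_finsuppAntidiag_Ico_four] at hx
    obtain ⟨⟨h1, h2⟩, h3⟩ := hx
    have hH := Finset.mem_powersetCard.1 (fiveSegment_subset _ _ h3)
    have hle : ∀ i < 5, (p.filter (5 ≤ ·) + Finsupp.indicator H fun _ _ => 1 : ℕ →₀ ℕ) i ≤ 1 := by
      intro i hi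
      by_cases hiH : i ∈ H
      · simp [hiH, hi]
      · simp [hiH, hi]
    rw [stackSet, Finset.mem_filter, mem_sqMon_iff_sum, hsum, ← card_fiveHead hle,
      hhead p hH.1, hH.2]
    refine ⟨⟨?_, fun i hi => ?_, hle⟩, ?_⟩
    · rw [← h1]
      congr 1
      refine Finset.sum_congr rfl fun i hi => ?_
      rw [Finset.mem_Ico] at hi
      have hiH : i ∉ H := fun h => by
        have := Finset.mem_range.1 (hH.1 h)
        omega
      simp [hi.1, hiH]
    · replace hi : 5 + r ≤ i := by simpa using hi
      have hiH : i ∉ H := fun h => by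
        have := Finset.mem_range.1 (hH.1 h)
        omega
      have : p i = 0 := by
        by_contra h
        have := h2 i h
        omega
      simp [hiH, show 5 ≤ i by omega, this]
    · convert h3 using 1
      congr 1
      refine hcongr _ _ (fun i hi => ?_) _
      have hiH : i ∉ H := fun h => by
        have := Finset.mem_range.1 (hH.1 h)
        omega
      simp [hiH, hi]
  · intro m hm
    rw [stackSet, Finset.mem_filter, mem_sqMon_iff_sum] at hm
    ext i
    by_cases hi : i < 5
    · have h1 := hm.1.2.2 i hi
      have h2 := @mem_fiveHead m i
      by_cases h0 : i ∈ fiveHead m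
      · have h3 := h2.1 h0
        have hi5 : ¬ 5 ≤ i := by omega
        simp [h0, hi5]
        omega
      · have h3 : m i = 0 := by
          by_contra h3
          exact h0 (h2.2 ⟨hi, h3⟩)
        simp [h0, h3, Finsupp.filter_apply]
    · have h0 : i ∉ fiveHead m := fun h => hi (mem_fiveHead.1 h).1
      have h5 : 5 ≤ i := by omega
      simp [h0, h5]
  · rintro ⟨p, H⟩ hx
    rw [Finset.mem_sigma, mem_finsuppAntidiag_Ico_four] at hx
    obtain ⟨⟨h1, h2⟩, h3⟩ := hx
    have hH := Finset.mem_powersetCard.1 (fiveSegment_subset _ _ h3)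
    dsimp only at hH ⊢
    rw [hhead p hH.1, hH.2, Sigma.mk.injEq]
    refine ⟨?_, HEq.rfl⟩
    ext i
    by_cases hi4 : i = 4
    · simp [hi4]
    · by_cases hi5 : 5 ≤ i
      · have hiH : i ∉ H := fun h => by
          have := Finset.mem_range.1 (hH.1 h)
          omega
        simp [hi5, hiH, hi4]
      · have : p i = 0 := by
          by_contra h
          have := h2 i h
          omega
        simp [hi5, hi4, this]

lemma card_sqMon_five (r d : ℕ) : (sqMon 5 (Finset.range (5 + r)) d).card =
    ∑ p ∈ Finset.finsuppAntidiag (Finset.Ico 4 (5 + r)) d, Nat.choose 5 (p 4) := by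
  rw [← card_stackSet (k := fun _ e => Nat.choose 5 e) (fun _ _ => le_rfl) fun _ _ _ _ => le_rfl]
  congr 1
  refine (Finset.filter_true_of_mem fun m hm => ?_).symm
  dsimp only
  rw [Finset.eq_of_subset_of_card_le (fiveSegment_subset _ _)
    (by rw [card_fiveSegment le_rfl]; simp), Finset.mem_powersetCard]
  exact ⟨Finset.filter_subset _ _, rfl⟩

lemma upShadow_stackSet_subset (hk : ∀ m e, k m e ≤ Nat.choose 5 e)
    (hk' : ∀ m m' : ℕ →₀ ℕ, (∀ i, 5 ≤ i → m i ≤ m' i) → ∀ e, k m e ≤ k m' e)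
    (hg : ∀ m e, fiveGrowth e (k m e) ≤ k m (e + 1)) (n d : ℕ) :
    upShadow 5 (Finset.range n) (stackSet k n d) ⊆ stackSet k n (d + 1) := by
  intro m' hm'
  obtain ⟨⟨m, hm, i, hi, rfl⟩, hb⟩ := mem_upShadow.1 hm'
  rw [stackSet, Finset.mem_filter, mem_sqMon_iff_sum] at hm ⊢
  obtain ⟨⟨h1, h2, h3⟩, h4⟩ := hm
  refine ⟨⟨?_, fun j hj => ?_, hb⟩, ?_⟩
  · simp [Finset.sum_add_distrib, h1, Finsupp.single_apply, Finset.mem_range.1 hi]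
  · have : j ≠ i := fun h => hj (h ▸ hi)
    simp [h2 j hj, this]
  · by_cases hi5 : i < 5
    · have hiH : i ∉ fiveHead m := fun h => by
        have h5 := hb i hi5
        have h6 := (mem_fiveHead.1 h).2
        simp at h5
        omega
      have hins : fiveHead (m + Finsupp.single i 1) = insert i (fiveHead m) := by
        ext j
        rw [Finset.mem_insert, mem_fiveHead, mem_fiveHead]
        by_cases hij : j = i
        · simp [hij, hi5]
        · simp [hij]
      rw [hins, Finset.card_insert_of_notMem hiH]
      refine fiveSegment_mono _ ?_ (insert_mem_fiveSegment (hk _ _) h4 hi5 hiH)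
      exact (hg _ _).trans (hk' _ _ (fun j _ => by simp) _)
    · have hins : fiveHead (m + Finsupp.single i 1) = fiveHead m := by
        ext j
        rw [mem_fiveHead, mem_fiveHead]
        refine and_congr_right fun hj => ?_
        have : j ≠ i := by omega
        simp [this]
      rw [hins]
      exact fiveSegment_mono _ (hk' _ _ (fun j _ => by simp) _) h4

end SquarefreeMonomials

section Stacks

variable {K : Type*} [Field K] {n : ℕ} {I : Ideal (MvPolynomial (Fin n) K)}

lemma exists_sqMon_subset_of_isAlgClosed [IsAlgClosed K] (h5n : 5 ≤ n) (hI : IsHomog I)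
    (hreg : ContainsRegSeq (fun _ : Fin 5 => 2) I) (d : ℕ) :
    ∃ T ⊆ sqMon 5 (Finset.range n) d, T.card + hilbCodim I d = (sqMon 5 (Finset.range n) d).card ∧
      (upShadow 5 (Finset.range n) T).card + hilbCodim I (d + 1) ≤
        (sqMon 5 (Finset.range n) (d + 1)).card := by
  have : Infinite K := IsAlgClosed.instInfinite
  obtain ⟨f, hfI, hf, hf2⟩ := hreg
  obtain ⟨l, hl, hl0, hQ⟩ := hf.exists_isQuadricSystem hf2 h5n
  obtain ⟨r, rfl⟩ := Nat.exists_eq_add_of_le h5n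
  rw [Nat.add_sub_cancel_left] at hl0 hQ
  set Q := Ideal.span (Submodule.span K (l '' Set.Iio r) : Set (MvPolynomial (Fin (5 + r)) K)) ⊔
    Ideal.span (Submodule.span K (Set.range f) : Set (MvPolynomial (Fin (5 + r)) K)) with hQdef
  have hQle : ∀ m, Q ≤ sliceIdeal l I r m := by
    intro m
    rw [hQdef, ideal_span_submodule_span, ideal_span_submodule_span]
    apply sup_le
    · rw [Ideal.span_le]
      rintro _ ⟨i, hi, rfl⟩
      exact mem_sliceIdeal hi m
    · rw [Ideal.span_le]
      rintro _ ⟨i, rfl⟩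
      exact le_sliceIdeal r m (hfI i)
  have hle : ∀ m e, hilbCodim (sliceIdeal l I r m) e ≤ Nat.choose 5 e := fun m e => by
    rw [← hQ.hilbCodim_eq hQdef e]
    exact hilbCodim_anti (hQle m) e
  set k : (ℕ →₀ ℕ) → ℕ → ℕ :=
    fun m e => Nat.choose 5 e - hilbCodim (sliceIdeal l I r m) e with hkdef
  have hk : ∀ m e, k m e ≤ Nat.choose 5 e := fun m e => Nat.sub_le _ _
  have hk' : ∀ m m' : ℕ →₀ ℕ, (∀ i, 5 ≤ i → m i ≤ m' i) → ∀ e, k m e ≤ k m' e :=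
    fun m m' h e => Nat.sub_le_sub_left
      (hilbCodim_anti (sliceIdeal_mono fun i _ => h (5 + i) (by omega)) e) _
  have hcard : ∀ d, (stackSet k (5 + r) d).card + hilbCodim I d =
      (sqMon 5 (Finset.range (5 + r)) d).card := by
    intro d
    rw [card_stackSet hk hk', hilbCodim_eq_sum_sliceIdeal hI hl hl0, card_sqMon_five,
      ← Finset.sum_add_distrib]
    exact Finset.sum_congr rfl fun m _ => Nat.sub_add_cancel (hle m _)
  refine ⟨stackSet k (5 + r) d, Finset.filter_subset _ _, hcard d, ?_⟩
  rw [← hcard (d + 1)]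
  refine Nat.add_le_add_right (Finset.card_le_card (upShadow_stackSet_subset hk hk' ?_ _ _)) _
  exact fun m e => hQ.fiveGrowth_le hQdef (hQle m) e

lemma hilb_top (d : ℕ) : hilb (⊤ : Ideal (MvPolynomial (Fin n) K)) d =
    Module.finrank K (homogeneousSubmodule (Fin n) K d) := by
  rw [hilb, component, Submodule.restrictScalars_top, top_inf_eq]

lemma hilbCodim_map_algebraMap (L : Type*) [Field L] [Algebra K L]
    (I : Ideal (MvPolynomial (Fin n) K)) (d : ℕ) :
    hilbCodim (I.map (map (algebraMap K L))) d = hilbCodim I d := by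
  have h1 := hilbCodim_add_hilb I d
  have h2 := hilbCodim_add_hilb (I.map (map (algebraMap K L))) d
  have h3 := hilb_map_algebraMap L (⊤ : Ideal (MvPolynomial (Fin n) K)) d
  rw [Ideal.map_top, hilb_top, hilb_top] at h3
  rw [hilb_map_algebraMap] at h2
  omega

theorem exists_sqMon_subset (h5n : 5 ≤ n) (hI : IsHomog I)
    (hreg : ContainsRegSeq (fun _ : Fin 5 => 2) I) (d : ℕ) :
    ∃ T ⊆ sqMon 5 (Finset.range n) d, T.card + hilbCodim I d = (sqMon 5 (Finset.range n) d).card ∧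
      (upShadow 5 (Finset.range n) T).card + hilbCodim I (d + 1) ≤
        (sqMon 5 (Finset.range n) (d + 1)).card := by
  have h := exists_sqMon_subset_of_isAlgClosed h5n (hI.map_algebraMap (AlgebraicClosure K)) ?_ d
  · simpa only [hilbCodim_map_algebraMap] using h
  · obtain ⟨f, hfI, hf, hf2⟩ := hreg
    exact ⟨_, fun i => Ideal.mem_map_of_mem _ (hfI i), hf.map_algebraMap (AlgebraicClosure K),
      fun i => (hf2 i).map _⟩

end Stacks

section LexUpper

lemma toLex_lt_iff {m m' : ℕ →₀ ℕ} :
    toLex m < toLex m' ↔ ∃ p, (∀ q < p, m q = m' q) ∧ m p < m' p := Iff.rfl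

variable {b d : ℕ} {s : Finset ℕ} {T : Finset (ℕ →₀ ℕ)} {m : ℕ →₀ ℕ}

lemma mem_sqMon : m ∈ sqMon b s d ↔
    m.degree = d ∧ (∀ i ∉ s, m i = 0) ∧ ∀ i < b, m i ≤ 1 := by
  rw [mem_sqMon_iff_sum]
  refine and_congr_left fun ⟨h, _⟩ => ?_
  rw [Finsupp.degree_apply, Finset.sum_subset (s₁ := m.support) (s₂ := s)]
  · intro i hi
    by_contra his
    exact Finsupp.mem_support_iff.1 hi (h i his)
  · intro i _ hi
    exact Finsupp.notMem_support_iff.1 hi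

lemma upShadow_subset_sqMon (hT : T ⊆ sqMon b s d) : upShadow b s T ⊆ sqMon b s (d + 1) := by
  intro m hm
  obtain ⟨⟨t, ht, i, hi, rfl⟩, hb⟩ := mem_upShadow.1 hm
  obtain ⟨h1, h2, -⟩ := mem_sqMon.1 (hT ht)
  refine mem_sqMon.2 ⟨by rw [map_add, h1, Finsupp.degree_single], fun j hj => ?_, hb⟩
  have : j ≠ i := fun h => hj (h ▸ hi)
  simp [h2 j hj, this]

lemma upShadow_mono {T' : Finset (ℕ →₀ ℕ)} (h : T ⊆ T') : upShadow b s T ⊆ upShadow b s T' := by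
  intro m hm
  obtain ⟨⟨t, ht, hi⟩, hb⟩ := mem_upShadow.1 hm
  exact mem_upShadow.2 ⟨⟨t, h ht, hi⟩, hb⟩

lemma exists_lt_of_toLex_lt {m m' : ℕ →₀ ℕ} (h : m.degree = m'.degree) {p : ℕ}
    (hp : ∀ q < p, m q = m' q) (hlt : m p < m' p) : ∃ q, p < q ∧ m' q < m q := by
  by_contra! hcon
  have hle : m ≤ m' := by
    intro q
    obtain hq | rfl | hq := lt_trichotomy q p
    · exact (hp q hq).le
    · exact hlt.le
    · exact hcon q hq
  obtain ⟨c, rfl⟩ := exists_add_of_le hle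
  rw [map_add, Nat.left_eq_add, Finsupp.degree_eq_zero_iff] at h
  simp [h] at hlt

lemma eq_of_le_of_degree_eq {m m' : ℕ →₀ ℕ} (hle : m ≤ m') (h : m.degree = m'.degree) :
    m = m' := by
  obtain ⟨c, rfl⟩ := exists_add_of_le hle
  rw [map_add, Nat.left_eq_add, Finsupp.degree_eq_zero_iff] at h
  rw [h, add_zero]

/-- An up-closed subset, with respect to the lexicographic order, of `sqMon b s d`. -/
structure IsLexUpper (b : ℕ) (s : Finset ℕ) (d : ℕ) (L : Finset (ℕ →₀ ℕ)) : Prop where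
  subset : L ⊆ sqMon b s d
  mem_of_le : ∀ m ∈ L, ∀ m' ∈ sqMon b s d, toLex m ≤ toLex m' → m' ∈ L

namespace IsLexUpper

variable {L L' : Finset (ℕ →₀ ℕ)}

lemma subset_or_subset (h : IsLexUpper b s d L) (h' : IsLexUpper b s d L') :
    L ⊆ L' ∨ L' ⊆ L := by
  by_contra! hcon
  obtain ⟨⟨x, hx, hx'⟩, y, hy, hy'⟩ :=
    hcon.imp Finset.not_subset.1 Finset.not_subset.1
  obtain hxy | hxy := le_total (toLex x) (toLex y)
  · exact hy' (h.mem_of_le x hx y (h'.subset hy) hxy)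
  · exact hx' (h'.mem_of_le y hy x (h.subset hx) hxy)

lemma card_union_le (h : IsLexUpper b s d L) (h' : IsLexUpper b s d L') {N : ℕ}
    (hL : L.card ≤ N) (hL' : L'.card ≤ N) : (L ∪ L').card ≤ N := by
  obtain hs | hs := h.subset_or_subset h'
  · rwa [Finset.union_eq_right.2 hs]
  · rwa [Finset.union_eq_left.2 hs]

lemma upShadow (h : IsLexUpper b s d L) : IsLexUpper b s (d + 1) (upShadow b s L) := by
  refine ⟨upShadow_subset_sqMon h.subset, fun m hm m' hm' hle => ?_⟩
  obtain ⟨⟨t, ht, i, hi, rfl⟩, hb⟩ := mem_upShadow.1 hm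
  obtain ⟨ht1, ht2, ht3⟩ := mem_sqMon.1 (h.subset ht)
  obtain ⟨h1, h2, h3⟩ := mem_sqMon.1 hm'
  have hne : m'.support.Nonempty := by
    rw [Finset.nonempty_iff_ne_empty, Ne, Finsupp.support_eq_empty]
    rintro rfl
    simp at h1
  obtain ⟨k, hk, hmax⟩ : ∃ k, m' k ≠ 0 ∧ ∀ q, k < q → m' q = 0 := by
    refine ⟨m'.support.max' hne, Finsupp.mem_support_iff.1 (Finset.max'_mem _ _), fun q hq => ?_⟩
    by_contra h0
    exact absurd (Finset.le_max' _ q (Finsupp.mem_support_iff.2 h0)) (by omega)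
  have hks : k ∈ s := by
    by_contra hks
    exact hk (h2 k hks)
  obtain ⟨u, rfl⟩ : ∃ u, m' = u + Finsupp.single k 1 :=
    ⟨m' - Finsupp.single k 1, (tsub_add_cancel_of_le (by
      rw [Finsupp.single_le_iff]; omega)).symm⟩
  have hu : u ∈ sqMon b s d := by
    refine mem_sqMon.2 ⟨?_, fun q hq => ?_, fun q hq => ?_⟩
    · rw [map_add, Finsupp.degree_single] at h1
      omega
    · have := h2 q hq
      rw [Finsupp.add_apply] at this
      omega
    · have := h3 q hq
      rw [Finsupp.add_apply] at this
      omega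
  refine mem_upShadow.2 ⟨⟨u, h.mem_of_le t ht u hu ?_, k, hks, rfl⟩, h3⟩
  by_contra! hlt
  obtain ⟨p, hp, hlt⟩ := toLex_lt_iff.1 hlt
  obtain ⟨q, hpq, hq⟩ := exists_lt_of_toLex_lt
    (by rw [(mem_sqMon.1 hu).1, ht1]) hp hlt
  have hqk : q ≤ k := by
    by_contra hqk
    have := hmax q (by omega)
    rw [Finsupp.add_apply] at this
    omega
  refine absurd hle (not_le.2 (toLex_lt_iff.2 ⟨min i p, fun j hj => ?_, ?_⟩))
  · have h4 : j ≠ k := by omega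
    have h5 : j ≠ i := by omega
    simp [h4, h5, hp j (by omega)]
  · obtain hip | hip := lt_or_ge i p
    · have h4 : i ≠ k := by omega
      simp [min_eq_left hip.le, h4, hp i hip]
    · have h4 : p ≠ k := by omega
      simp only [min_eq_right hip, Finsupp.add_apply, Finsupp.single_eq_of_ne h4]
      omega

end IsLexUpper

end LexUpper

section Compression

variable {b d : ℕ} {s : Finset ℕ} {T : Finset (ℕ →₀ ℕ)}

lemma exists_isLexUpper_card {N : ℕ} (hN : N ≤ (sqMon b s d).card) :
    ∃ L, IsLexUpper b s d L ∧ L.card = N := by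
  suffices h : ∀ j ≤ (sqMon b s d).card, ∃ L, IsLexUpper b s d L ∧
      L.card = (sqMon b s d).card - j by
    obtain ⟨L, hL, h⟩ := h ((sqMon b s d).card - N) (Nat.sub_le _ _)
    exact ⟨L, hL, by omega⟩
  intro j
  induction j with
  | zero => exact fun _ => ⟨_, ⟨subset_rfl, fun _ _ m' hm' _ => hm'⟩, rfl⟩
  | succ j ih =>
    intro hj
    obtain ⟨L, hL, hc⟩ := ih (by omega)
    obtain ⟨x, hx, hmin⟩ := L.exists_min_image toLex (Finset.card_pos.1 (by omega))
    refine ⟨L.erase x, ⟨(Finset.erase_subset _ _).trans hL.subset, fun m hm m' hm' hle => ?_⟩, ?_⟩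
    · rw [Finset.mem_erase] at hm ⊢
      refine ⟨?_, hL.mem_of_le m hm.2 m' hm' hle⟩
      rintro rfl
      exact hm.1 (toLex.injective (le_antisymm hle (hmin m hm.2)))
    · rw [Finset.card_erase_of_mem hx]
      omega

/-- The vectors `m` with `m k = 0` such that replacing the `k`-th coordinate by `c` gives an element
of `T`. -/
noncomputable def slice (k c : ℕ) (T : Finset (ℕ →₀ ℕ)) : Finset (ℕ →₀ ℕ) :=
  (T.filter fun m => m k = c).image (Finsupp.erase k)

lemma erase_add_single_self (k : ℕ) (m : ℕ →₀ ℕ) : m.erase k + Finsupp.single k (m k) = m := by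
  rw [add_comm, Finsupp.single_add_erase]

lemma erase_add_single_of_eq_zero {k : ℕ} {x : ℕ →₀ ℕ} (hx : x k = 0) (c : ℕ) :
    (x + Finsupp.single k c).erase k = x := by
  rw [Finsupp.erase_add, Finsupp.erase_single, add_zero, Finsupp.erase_of_notMem_support]
  simpa using hx

lemma mem_slice {k c : ℕ} {x : ℕ →₀ ℕ} :
    x ∈ slice k c T ↔ x k = 0 ∧ x + Finsupp.single k c ∈ T := by
  rw [slice, Finset.mem_image]
  constructor
  · rintro ⟨m, hm, rfl⟩
    obtain ⟨hmT, rfl⟩ := Finset.mem_filter.1 hm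
    rw [erase_add_single_self]
    exact ⟨Finsupp.erase_same, hmT⟩
  · rintro ⟨hx, h⟩
    exact ⟨_, Finset.mem_filter.2 ⟨h, by simp [hx]⟩, erase_add_single_of_eq_zero hx c⟩

lemma erase_mem_slice {k : ℕ} {m : ℕ →₀ ℕ} (hm : m ∈ T) : m.erase k ∈ slice k (m k) T :=
  mem_slice.2 ⟨Finsupp.erase_same, by rwa [erase_add_single_self]⟩

lemma card_slice (k c : ℕ) (T : Finset (ℕ →₀ ℕ)) :
    (slice k c T).card = (T.filter fun m => m k = c).card := by
  rw [slice, Finset.card_image_of_injOn]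
  intro x hx y hy hxy
  rw [Finset.mem_coe, Finset.mem_filter] at hx hy
  rw [← erase_add_single_self k x, ← erase_add_single_self k y, hx.2, hy.2]
  exact congrArg (· + _) hxy

lemma card_eq_sum_card_slice {k N : ℕ} (hN : ∀ m ∈ T, m k < N) :
    T.card = ∑ c ∈ Finset.range N, (slice k c T).card := by
  rw [Finset.card_eq_sum_card_fiberwise (f := fun m => m k) (t := Finset.range N)
    fun m hm => Finset.mem_coe.2 (Finset.mem_range.2 (hN m hm))]
  exact Finset.sum_congr rfl fun c _ => (card_slice k c T).symm

lemma apply_le_of_mem_sqMon {m : ℕ →₀ ℕ} (hm : m ∈ sqMon b s d) (k : ℕ) : m k ≤ d := by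
  rw [← (mem_sqMon.1 hm).1]
  exact Finsupp.le_degree k m

lemma add_single_mem_sqMon {k c : ℕ} (hk : k ∈ s) {x : ℕ →₀ ℕ} (hx : x k = 0) :
    x + Finsupp.single k c ∈ sqMon b s d ↔
      x ∈ sqMon b (s.erase k) (d - c) ∧ c ≤ d ∧ (k < b → c ≤ 1) := by
  simp only [mem_sqMon, map_add, Finsupp.degree_single, Finset.mem_erase]
  constructor
  · rintro ⟨h1, h2, h3⟩
    refine ⟨⟨by omega, fun i hi => ?_, fun i hi => ?_⟩, by omega, fun hkb => ?_⟩
    · obtain rfl | hik := eq_or_ne i k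
      · exact hx
      · simpa [hik] using h2 i fun h => hi ⟨hik, h⟩
    · exact (Nat.le_add_right _ _).trans (h3 i hi)
    · simpa [hx] using h3 k hkb
  · rintro ⟨⟨h1, h2, h3⟩, h4, h5⟩
    refine ⟨by omega, fun i hi => ?_, fun i hi => ?_⟩
    · have hik : i ≠ k := fun h => hi (h ▸ hk)
      simp [hik, h2 i fun h => hi h.2]
    · obtain rfl | hik := eq_or_ne i k
      · simpa [hx] using h5 hi
      · simpa [hik] using h3 i hi

lemma slice_subset (hT : T ⊆ sqMon b s d) {k : ℕ} (hk : k ∈ s) (c : ℕ) :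
    slice k c T ⊆ sqMon b (s.erase k) (d - c) := by
  intro x hx
  obtain ⟨hx0, hx⟩ := mem_slice.1 hx
  exact ((add_single_mem_sqMon hk hx0).1 (hT hx)).1

lemma le_of_mem_slice (hT : T ⊆ sqMon b s d) {k c : ℕ} (hk : k ∈ s) {x : ℕ →₀ ℕ}
    (hx : x ∈ slice k c T) : c ≤ d ∧ (k < b → c ≤ 1) := by
  obtain ⟨hx0, hx⟩ := mem_slice.1 hx
  exact ((add_single_mem_sqMon hk hx0).1 (hT hx)).2

lemma slice_upShadow_subset {k c : ℕ} : slice k c (upShadow b s T) ⊆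
    upShadow b (s.erase k) (slice k c T) ∪ if c = 0 then ∅ else slice k (c - 1) T := by
  intro x hx
  obtain ⟨hx0, hx⟩ := mem_slice.1 hx
  obtain ⟨⟨t, ht, i, hi, hti⟩, hb⟩ := mem_upShadow.1 hx
  rw [Finset.mem_union]
  obtain rfl | hik := eq_or_ne i k
  · right
    have hc : t i + 1 = c := by
      have := DFunLike.congr_fun hti i
      simpa [hx0] using this
    subst hc
    rw [if_neg (Nat.succ_ne_zero _), Nat.add_sub_cancel, mem_slice]
    rw [Finsupp.single_add, ← add_assoc] at hti
    rw [← add_right_cancel hti]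
    exact ⟨hx0, ht⟩
  · left
    have hc : t k = c := by
      have := DFunLike.congr_fun hti k
      simpa [hx0, hik.symm] using this
    subst hc
    refine mem_upShadow.2 ⟨⟨t.erase k, erase_mem_slice ht, i, Finset.mem_erase.2 ⟨hik, hi⟩, ?_⟩, ?_⟩
    · have := congrArg (Finsupp.erase k) hti
      rwa [erase_add_single_of_eq_zero hx0, Finsupp.erase_add, Finsupp.erase_of_notMem_support
        (f := Finsupp.single i 1) (by simp [hik.symm])] at this
    · exact fun j hj => (Nat.le_add_right _ _).trans (hb j hj)

lemma upShadow_slice_subset (hT : T ⊆ sqMon b s d) {k c : ℕ} (hk : k ∈ s) :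
    upShadow b (s.erase k) (slice k c T) ⊆ slice k c (upShadow b s T) := by
  intro x hx
  obtain ⟨⟨t, ht, i, hi, rfl⟩, hb⟩ := mem_upShadow.1 hx
  obtain ⟨hik, his⟩ := Finset.mem_erase.1 hi
  obtain ⟨-, hc⟩ := le_of_mem_slice hT hk ht
  obtain ⟨ht0, ht⟩ := mem_slice.1 ht
  have hx0 : (t + Finsupp.single i 1 : ℕ →₀ ℕ) k = 0 := by simp [ht0, hik.symm]
  refine mem_slice.2 ⟨hx0, mem_upShadow.2 ⟨⟨_, ht, i, his, add_right_comm _ _ _⟩, fun j hj => ?_⟩⟩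
  obtain rfl | hjk := eq_or_ne j k
  · rw [Finsupp.add_apply, hx0, zero_add, Finsupp.single_eq_same]
    exact hc hj
  · rw [Finsupp.add_apply _ (Finsupp.single k c), Finsupp.single_eq_of_ne hjk]
    exact hb j hj

lemma slice_subset_slice_upShadow (hT : T ⊆ sqMon b s d) {k c : ℕ} (hk : k ∈ s)
    (hc : k < b → c + 1 ≤ 1) : slice k c T ⊆ slice k (c + 1) (upShadow b s T) := by
  intro x hx
  obtain ⟨hx0, hx⟩ := mem_slice.1 hx
  refine mem_slice.2 ⟨hx0, mem_upShadow.2 ⟨⟨_, hx, k, hk, ?_⟩, fun j hj => ?_⟩⟩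
  · rw [Finsupp.single_add, add_assoc]
  · obtain rfl | hjk := eq_or_ne j k
    · simpa [hx0] using hc hj
    · have := (mem_sqMon.1 (hT hx)).2.2 j hj
      simpa [hjk] using this

/-- `T` viewed as an element of the colexicographic order on finite sets of vectors. -/
def toLexColex (T : Finset (ℕ →₀ ℕ)) : Colex (Finset (Lex (ℕ →₀ ℕ))) :=
  toColex (T.map toLex.toEmbedding)

lemma toLexColex_injective : Function.Injective toLexColex := fun _ _ h =>
  Finset.map_injective _ (toColex.injective h)

lemma toLexColex_le_iff {T' : Finset (ℕ →₀ ℕ)} : toLexColex T ≤ toLexColex T' ↔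
    ∀ x ∈ T, x ∉ T' → ∃ y ∈ T', y ∉ T ∧ toLex x ≤ toLex y := by
  rw [toLexColex, toLexColex, Finset.Colex.toColex_le_toColex]
  simp

/-- `b` and `s` satisfy the Clements–Lindström inequality. -/
def LexShadowLe (b : ℕ) (s : Finset ℕ) : Prop :=
  ∀ d, ∀ T ⊆ sqMon b s d, ∃ L, IsLexUpper b s d L ∧ L.card = T.card ∧
    (upShadow b s L).card ≤ (upShadow b s T).card

lemma exists_compress {k : ℕ} (hk : k ∈ s) (ih : LexShadowLe b (s.erase k))
    (hT : T ⊆ sqMon b s d) : ∃ C ⊆ sqMon b s d, C.card = T.card ∧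
      (upShadow b s C).card ≤ (upShadow b s T).card ∧ toLexColex T ≤ toLexColex C ∧
      ∀ c, IsLexUpper b (s.erase k) (d - c) (slice k c C) := by
  choose L hL hcard hsh using fun c => ih (d - c) (slice k c T) (slice_subset hT hk c)
  set C := (sqMon b s d).filter fun m => m.erase k ∈ L (m k) with hC
  have hCs : C ⊆ sqMon b s d := Finset.filter_subset _ _
  have hsl : ∀ c, slice k c C = L c := by
    intro c
    ext x
    rw [mem_slice, hC, Finset.mem_filter]
    constructor
    · rintro ⟨hx0, -, hx⟩
      rw [erase_add_single_of_eq_zero hx0] at hx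
      simpa [hx0] using hx
    · intro hx
      have hx0 : x k = 0 := (mem_sqMon.1 ((hL c).subset hx)).2.1 k (Finset.notMem_erase k s)
      obtain ⟨y, hy⟩ : (slice k c T).Nonempty := by
        rw [← Finset.card_pos, ← hcard c]
        exact Finset.card_pos.2 ⟨x, hx⟩
      refine ⟨hx0, (add_single_mem_sqMon hk hx0).2 ⟨(hL c).subset hx, le_of_mem_slice hT hk hy⟩, ?_⟩
      rw [erase_add_single_of_eq_zero hx0]
      simpa [hx0] using hx
  have hlt : ∀ {d : ℕ} {U : Finset (ℕ →₀ ℕ)}, U ⊆ sqMon b s d → ∀ m ∈ U, m k < d + 1 :=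
    fun hU m hm => Nat.lt_succ_of_le (apply_le_of_mem_sqMon (hU hm) k)
  refine ⟨C, hCs, ?_, ?_, ?_, fun c => ?_⟩
  · rw [card_eq_sum_card_slice (hlt hCs), card_eq_sum_card_slice (hlt hT)]
    exact Finset.sum_congr rfl fun c _ => by rw [hsl, hcard]
  · rw [card_eq_sum_card_slice (hlt (upShadow_subset_sqMon hCs)),
      card_eq_sum_card_slice (hlt (upShadow_subset_sqMon hT))]
    refine Finset.sum_le_sum fun c _ => ?_
    obtain h0 | ⟨x, hx⟩ := (slice k c (upShadow b s C)).eq_empty_or_nonempty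
    · rw [h0]
      exact Nat.zero_le _
    have hcb := (le_of_mem_slice (upShadow_subset_sqMon hCs) hk hx).2
    have h1 := (hsh c).trans (Finset.card_le_card (upShadow_slice_subset hT hk))
    refine (Finset.card_le_card slice_upShadow_subset).trans ?_
    rw [hsl]
    obtain _ | c := c
    · simpa using h1
    · have h2 := (hcard c).trans_le (Finset.card_le_card (slice_subset_slice_upShadow hT hk hcb))
      rw [if_neg (Nat.succ_ne_zero c), Nat.add_sub_cancel, hsl]
      obtain hcd | hcd := le_or_gt (c + 1) d
      · have h3 : d - (c + 1) + 1 = d - c := by omega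
        exact IsLexUpper.card_union_le (h3 ▸ (hL (c + 1)).upShadow) (hL c) h1 h2
      · have h3 : L (c + 1) = ∅ := by
          rw [← Finset.card_eq_zero, hcard, Finset.card_eq_zero, Finset.eq_empty_iff_forall_notMem]
          intro y hy
          have := (le_of_mem_slice hT hk hy).1
          omega
        have h4 : upShadow b (s.erase k) ∅ = ∅ := by simp [upShadow]
        rw [h3, h4, Finset.empty_union]
        exact h2
  · rw [toLexColex_le_iff]
    intro a ha haC
    have ha1 := erase_mem_slice (k := k) ha
    have ha2 : a.erase k ∉ L (a k) := fun h => haC (Finset.mem_filter.2 ⟨hT ha, h⟩)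
    have hns : ¬ L (a k) ⊆ slice k (a k) T := fun h =>
      ha2 ((Finset.eq_of_subset_of_card_le h (hcard (a k)).ge).ge ha1)
    obtain ⟨y, hy, hyT⟩ := Finset.not_subset.1 hns
    have hyC := hy
    rw [← hsl] at hyC
    obtain ⟨hy0, hyC⟩ := mem_slice.1 hyC
    refine ⟨_, hyC, fun h => hyT (mem_slice.2 ⟨hy0, h⟩), ?_⟩
    have hle : toLex (a.erase k) ≤ toLex y := by
      by_contra! hlt
      exact ha2 ((hL _).mem_of_le y hy _ (slice_subset hT hk _ ha1) hlt.le)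
    have := add_le_add_left hle (toLex (Finsupp.single k (a k)))
    rwa [← toLex_add, ← toLex_add, erase_add_single_self] at this
  · rw [hsl]
    exact hL c

lemma exists_compressed (ih : ∀ k ∈ s, LexShadowLe b (s.erase k)) (hT : T ⊆ sqMon b s d) :
    ∃ C ⊆ sqMon b s d, C.card = T.card ∧ (upShadow b s C).card ≤ (upShadow b s T).card ∧
      ∀ k ∈ s, ∀ c, IsLexUpper b (s.erase k) (d - c) (slice k c C) := by
  obtain ⟨C, hC, hmax⟩ := ((sqMon b s d).powerset.filter fun C => C.card = T.card ∧
    (upShadow b s C).card ≤ (upShadow b s T).card).exists_max_image toLexColex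
    ⟨T, Finset.mem_filter.2 ⟨Finset.mem_powerset.2 hT, rfl, le_rfl⟩⟩
  simp only [Finset.mem_filter, Finset.mem_powerset] at hC hmax
  refine ⟨C, hC.1, hC.2.1, hC.2.2, fun k hk => ?_⟩
  obtain ⟨C', h1, h2, h3, h4, h5⟩ := exists_compress hk (ih k hk) hC.1
  rwa [toLexColex_injective (le_antisymm h4
    (hmax C' ⟨h1, h2.trans hC.2.1, h3.trans hC.2.2⟩))]

end Compression

section Stable

variable {b d : ℕ} {s : Finset ℕ} {T : Finset (ℕ →₀ ℕ)}

/-- Stability under replacing a variable `x_j` by a larger variable `x_i`. -/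
def IsStable (b : ℕ) (s : Finset ℕ) (d : ℕ) (T : Finset (ℕ →₀ ℕ)) : Prop :=
  ∀ u i j, i ∈ s → j ∈ s → i < j → u + Finsupp.single j 1 ∈ T →
    u + Finsupp.single i 1 ∈ sqMon b s d → u + Finsupp.single i 1 ∈ T

lemma IsLexUpper.isStable (h : IsLexUpper b s d T) : IsStable b s d T := by
  intro u i j _ _ hij hj hi
  refine h.mem_of_le _ hj _ hi (toLex_lt_iff.2 ⟨i, fun q hq => ?_, ?_⟩).le
  · have h1 : q ≠ j := by omega
    have h2 : q ≠ i := by omega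
    simp [h1, h2]
  · simp [hij.ne]

lemma isStable_of_isLexUpper_slice (hs : 3 ≤ s.card)
    (h : ∀ k ∈ s, ∀ c, IsLexUpper b (s.erase k) (d - c) (slice k c T)) : IsStable b s d T := by
  intro u i j _ _ hij hj hi
  obtain ⟨k, hk, hk'⟩ : ∃ k ∈ s, k ∉ ({i, j} : Finset ℕ) := by
    by_contra! hcon
    have := Finset.card_le_card (show s ⊆ {i, j} from hcon)
    have := Finset.card_le_two (a := i) (b := j)
    omega
  simp only [Finset.mem_insert, Finset.mem_singleton, not_or] at hk'
  have h1 := erase_mem_slice (k := k) hj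
  have h2 := slice_subset subset_rfl hk _ (erase_mem_slice (k := k) hi)
  have hkk : (u + Finsupp.single i 1 : ℕ →₀ ℕ) k = (u + Finsupp.single j 1 : ℕ →₀ ℕ) k := by
    simp [hk'.1, hk'.2]
  rw [hkk] at h2
  have h3 := (h k hk _).mem_of_le _ h1 _ h2 (toLex_lt_iff.2 ⟨i, fun q hq => ?_, ?_⟩).le
  · have h3 := (mem_slice.1 h3).2
    rwa [← hkk, erase_add_single_self] at h3
  · have h1 : q ≠ j := by omega
    have h2 : q ≠ i := by omega
    simp [Finsupp.erase_apply, h1, h2]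
  · simp [hij.ne, Ne.symm hk'.1]

lemma IsStable.card_upShadow (h : IsStable b s d T) (hT : T ⊆ sqMon b s d) {x : ℕ} (hx : x ∈ s)
    (hmax : ∀ i ∈ s, i ≤ x) : (upShadow b s T).card =
      (upShadow b (s.erase x) (slice x 0 T)).card +
        if x < b then (slice x 0 T).card else T.card := by
  have h0 : upShadow b (s.erase x) (slice x 0 T) = slice x 0 (upShadow b s T) := by
    refine (upShadow_slice_subset hT hx).antisymm (slice_upShadow_subset.trans ?_)
    simp
  rw [← Finset.card_filter_add_card_filter_not (s := upShadow b s T) fun m => m x = 0, h0,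
    card_slice]
  congr 1
  have h1 : (if x < b then (slice x 0 T).card else T.card) =
      (T.filter fun m => x < b → m x = 0).card := by
    split_ifs with hxb
    · simp [card_slice, hxb]
    · simp [hxb]
  rw [h1]
  refine Eq.trans (congrArg _ ?_) (Finset.card_map (addRightEmbedding (Finsupp.single x 1)))
  ext m
  simp only [Finset.mem_filter, Finset.mem_map, addRightEmbedding_apply, mem_upShadow]
  constructor
  · rintro ⟨⟨⟨t, ht, i, hi, rfl⟩, hb⟩, hmx⟩
    obtain ⟨u, hu, hut⟩ : ∃ u ∈ T, u + Finsupp.single x 1 = t + Finsupp.single i 1 := by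
      obtain rfl | hix := eq_or_ne i x
      · exact ⟨t, ht, rfl⟩
      · have htx : t x ≠ 0 := by simpa [hix.symm] using hmx
        obtain ⟨u, rfl⟩ : ∃ u, t = u + Finsupp.single x 1 :=
          ⟨t - Finsupp.single x 1, (tsub_add_cancel_of_le (by
            rw [Finsupp.single_le_iff]; omega)).symm⟩
        refine ⟨u + Finsupp.single i 1, h u i x hi hx (lt_of_le_of_ne (hmax i hi) hix) ht ?_,
          add_right_comm _ _ _⟩
        obtain ⟨h1, h2, h3⟩ := mem_sqMon.1 (hT ht)
        refine mem_sqMon.2 ⟨?_, fun j hj => ?_, fun j hj => ?_⟩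
        · rw [← h1]
          simp
        · have hji : j ≠ i := fun h => hj (h ▸ hi)
          have := h2 j hj
          simp only [Finsupp.add_apply] at this
          simp [hji]
          omega
        · have := hb j hj
          simp only [Finsupp.add_apply] at this ⊢
          omega
    refine ⟨u, ⟨hu, fun hxb => ?_⟩, hut⟩
    have := hb x hxb
    rw [← hut] at this
    simpa using this
  · rintro ⟨u, ⟨hu, hux⟩, rfl⟩
    refine ⟨⟨⟨u, hu, x, hx, rfl⟩, fun j hj => ?_⟩, by simp⟩
    obtain rfl | hjx := eq_or_ne j x
    · simp [hux hj]
    · simpa [hjx] using (mem_sqMon.1 (hT hu)).2.2 j hj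

lemma IsStable.toLex_lt (h : IsStable b s d T) (hT : T ⊆ sqMon b s d) {x : ℕ} (hx : x ∈ s)
    (hmax : ∀ i ∈ s, i ≤ x) (h0 : IsLexUpper b (s.erase x) d (slice x 0 T)) {w : ℕ →₀ ℕ}
    (hw : w ∈ sqMon b s d) (hwx : w x = 0) (hwT : w ∉ T) : ∀ t ∈ T, toLex w < toLex t := by
  suffices ∀ N, ∀ t ∈ T, t x = N → toLex w < toLex t from fun t ht => this _ t ht rfl
  obtain ⟨hw1, hw2, hw3⟩ := mem_sqMon.1 hw
  intro N
  induction N with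
  | zero =>
    intro t ht htx
    by_contra! hle
    have h1 := erase_mem_slice (k := x) ht
    have h2 := slice_subset subset_rfl hx _ (erase_mem_slice (k := x) hw)
    have ht' : t.erase x = t := Finsupp.erase_of_notMem_support (by simpa using htx)
    have hw' : w.erase x = w := Finsupp.erase_of_notMem_support (by simpa using hwx)
    rw [htx, ht'] at h1
    rw [hwx, hw'] at h2
    have := (mem_slice.1 (h0.mem_of_le _ h1 _ h2 hle)).2
    rw [Finsupp.single_zero, add_zero] at this
    exact hwT this
  | succ N ih =>
    intro t ht htx
    by_contra! hle
    have hne : toLex t ≠ toLex w := fun h => hwT (toLex.injective h ▸ ht)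
    obtain ⟨p, hp, hlt⟩ := toLex_lt_iff.1 (lt_of_le_of_ne hle hne)
    obtain ⟨u, rfl⟩ : ∃ u, t = u + Finsupp.single x 1 :=
      ⟨t - Finsupp.single x 1, (tsub_add_cancel_of_le (by
        rw [Finsupp.single_le_iff]; omega)).symm⟩
    have hux : u x = N := by simpa using htx
    obtain ⟨ht1, ht2, ht3⟩ := mem_sqMon.1 (hT ht)
    have hps : p ∈ s := by
      by_contra hps
      rw [hw2 p hps] at hlt
      omega
    have hpx : p < x := by
      refine lt_of_le_of_ne (hmax p hps) ?_
      rintro rfl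
      omega
    have hu : ∀ q, q ≠ x → (u + Finsupp.single x 1 : ℕ →₀ ℕ) q = u q := fun q hq => by simp [hq]
    rw [hu p hpx.ne] at hlt
    replace hp : ∀ q < p, u q = w q := fun q hq => by rw [← hp q hq, hu q (by omega)]
    have hvalid : ∀ i ∈ s, (i < b → u i = 0) → u + Finsupp.single i 1 ∈ sqMon b s d := by
      intro i hi hib
      refine mem_sqMon.2 ⟨?_, fun j hj => ?_, fun j hj => ?_⟩
      · rw [← ht1]
        simp
      · have hji : j ≠ i := fun h => hj (h ▸ hi)
        have hjx : j ≠ x := fun h => hj (h ▸ hx)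
        have := ht2 j hj
        rw [hu j hjx] at this
        simp [hji, this]
      · obtain rfl | hji := eq_or_ne j i
        · simp [hib hj]
        · have := ht3 j hj
          simp only [Finsupp.add_apply, Finsupp.single_eq_of_ne hji] at this ⊢
          omega
    have hmove : ∀ i ∈ s, i < x → (i < b → u i = 0) →
        (∀ q < p, u q = (u + Finsupp.single i 1 : ℕ →₀ ℕ) q) →
        ¬ (u + Finsupp.single i 1 : ℕ →₀ ℕ) p < w p := by
      intro i hi hix hib hq hlt'
      refine lt_asymm (ih _ (h u i x hi hx hix ht (hvalid i hi hib)) (by simp [hix.ne', hux])) ?_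
      exact toLex_lt_iff.2 ⟨p, fun q hqp => by rw [← hq q hqp, hp q hqp], hlt'⟩
    have hpb : p < b → u p = 0 := fun hpb => by have := hw3 p hpb; omega
    have h1 := hmove p hps hpx hpb fun q hq => by simp [hq.ne]
    rw [Finsupp.add_apply, Finsupp.single_eq_same] at h1
    have hle : w ≤ u + Finsupp.single p 1 := by
      intro j
      rw [Finsupp.add_apply]
      obtain hj | rfl | hj := lt_trichotomy j p
      · rw [hp j hj]
        exact Nat.le_add_right _ _
      · rw [Finsupp.single_eq_same]
        omega
      by_cases hjs : j ∈ s
      · obtain rfl | hjx := eq_or_ne j x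
        · omega
        · have h2 := hmove j hjs (lt_of_le_of_ne (hmax j hjs) hjx)
          have h3 : ¬ (j < b → u j = 0) := fun h3 => by
            refine h2 h3 (fun q hq => ?_) ?_
            · have : q ≠ j := by omega
              simp [this]
            · have : p ≠ j := by omega
              simpa [this] using hlt
          push Not at h3
          have := hw3 j h3.1
          omega
      · rw [hw2 j hjs]
        exact Nat.zero_le _
    have hq := hvalid p hps hpb
    have heq := eq_of_le_of_degree_eq hle (by rw [hw1, (mem_sqMon.1 hq).1])
    exact hwT (heq ▸ h u p x hps hx hpx ht hq)

lemma IsStable.slice_subset (h : IsStable b s d T) (hT : T ⊆ sqMon b s d) {x : ℕ} (hx : x ∈ s)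
    (hmax : ∀ i ∈ s, i ≤ x) (h0 : IsLexUpper b (s.erase x) d (slice x 0 T))
    {L : Finset (ℕ →₀ ℕ)} (hL : IsLexUpper b s d L) (hc : L.card ≤ T.card) :
    slice x 0 L ⊆ slice x 0 T := by
  intro w hw
  by_contra hwT
  obtain ⟨hwx, hwL⟩ := mem_slice.1 hw
  rw [mem_slice, not_and] at hwT
  replace hwT := hwT hwx
  rw [Finsupp.single_zero, add_zero] at hwT hwL
  refine hwT (Finset.eq_of_subset_of_card_le (fun t ht => ?_) hc ▸ hwL)
  exact hL.mem_of_le w hwL t (hT ht) (h.toLex_lt hT hx hmax h0 (hL.subset hwL) hwx hwT t ht).le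

lemma LexShadowLe.of_erase (hs : 3 ≤ s.card) (ih : ∀ k ∈ s, LexShadowLe b (s.erase k)) :
    LexShadowLe b s := by
  intro d T hT
  obtain ⟨C, hC, hcard, hle, hsl⟩ := exists_compressed ih hT
  have hst := isStable_of_isLexUpper_slice hs hsl
  obtain ⟨L, hL, hLc⟩ := exists_isLexUpper_card (Finset.card_le_card hT)
  have hne : s.Nonempty := Finset.card_pos.1 (by omega)
  have hx := s.max'_mem hne
  have hmax : ∀ i ∈ s, i ≤ s.max' hne := fun i hi => s.le_max' i hi
  have hsub := hst.slice_subset hC hx hmax (hsl _ hx 0) hL (by omega)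
  refine ⟨L, hL, hLc, le_trans ?_ hle⟩
  rw [hst.card_upShadow hC hx hmax, hL.isStable.card_upShadow hL.subset hx hmax]
  refine add_le_add (Finset.card_le_card (upShadow_mono hsub)) ?_
  split_ifs
  · exact Finset.card_le_card hsub
  · omega

end Stable

section ClementsLindstrom

variable {b d : ℕ} {s : Finset ℕ} {T : Finset (ℕ →₀ ℕ)}

lemma eq_of_mem_sqMon_pair {i j : ℕ} (hij : i ≠ j) {m m' : ℕ →₀ ℕ} (hm : m ∈ sqMon b {i, j} d)
    (hm' : m' ∈ sqMon b {i, j} d) (h : m i = m' i) : m = m' := by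
  rw [mem_sqMon_iff_sum, Finset.sum_pair hij] at hm hm'
  ext q
  by_cases hq : q ∈ ({i, j} : Finset ℕ)
  · simp only [Finset.mem_insert, Finset.mem_singleton] at hq
    obtain rfl | rfl := hq
    · exact h
    · omega
  · rw [hm.2.1 q hq, hm'.2.1 q hq]

lemma card_sqMon_singleton_le (i : ℕ) : (sqMon b {i} d).card ≤ 1 := by
  refine Finset.card_le_one.2 fun m hm m' hm' => ?_
  rw [mem_sqMon_iff_sum, Finset.sum_singleton] at hm hm'
  ext q
  by_cases hq : q ∈ ({i} : Finset ℕ)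
  · rw [Finset.mem_singleton.1 hq, hm.1, hm'.1]
  · rw [hm.2.1 q hq, hm'.2.1 q hq]

lemma exists_isLexUpper_of_card_le_one (h : (sqMon b s d).card ≤ 1) (hT : T ⊆ sqMon b s d) :
    ∃ L, IsLexUpper b s d L ∧ L.card = T.card ∧
      (upShadow b s L).card ≤ (upShadow b s T).card := by
  refine ⟨T, ⟨hT, fun m hm m' hm' _ => ?_⟩, rfl, le_rfl⟩
  rwa [Finset.card_le_one.1 h m' hm' m (hT hm)]

lemma card_sqMon_zero_le : (sqMon b s 0).card ≤ 1 := by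
  refine Finset.card_le_one.2 fun m hm m' hm' => ?_
  rw [mem_sqMon, Finsupp.degree_eq_zero_iff] at hm hm'
  rw [hm.1, hm'.1]

lemma card_upShadow_pair_le {i j : ℕ} (hij : i < j) (hd : d ≠ 0) {L : Finset (ℕ →₀ ℕ)}
    (hL : IsLexUpper b {i, j} d L) (hT : T ⊆ sqMon b {i, j} d) (hc : L.card = T.card)
    (hne : T.Nonempty) : (upShadow b {i, j} L).card ≤ (upShadow b {i, j} T).card := by
  have hjm : j ∈ ({i, j} : Finset ℕ) := by simp
  have him : i ∈ ({i, j} : Finset ℕ) := by simp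
  obtain hjb | hjb := lt_or_ge j b
  · have hcard : (upShadow b {i, j} L).card ≤ 1 := by
      refine Finset.card_le_one.2 fun m hm m' hm' => ?_
      replace hm := upShadow_subset_sqMon hL.subset hm
      replace hm' := upShadow_subset_sqMon hL.subset hm'
      refine eq_of_mem_sqMon_pair hij.ne hm hm' ?_
      rw [mem_sqMon_iff_sum, Finset.sum_pair hij.ne] at hm hm'
      have h1 := hm.2.2 i (hij.trans hjb)
      have h2 := hm.2.2 j hjb
      have h3 := hm'.2.2 i (hij.trans hjb)
      have h4 := hm'.2.2 j hjb
      omega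
    obtain h0 | hpos := (upShadow b {i, j} L).eq_empty_or_nonempty
    · simp [h0]
    refine hcard.trans (Finset.card_pos.2 ?_)
    obtain ⟨m, hm⟩ := hpos
    replace hm := upShadow_subset_sqMon hL.subset hm
    obtain ⟨t, ht⟩ := hne
    have ht' := hT ht
    rw [mem_sqMon_iff_sum, Finset.sum_pair hij.ne] at hm ht'
    have h1 := hm.2.2 i (hij.trans hjb)
    have h2 := hm.2.2 j hjb
    obtain ⟨k, hk, hk0⟩ : ∃ k ∈ ({i, j} : Finset ℕ), t k = 0 := by
      by_cases hti : t i = 0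
      · exact ⟨i, him, hti⟩
      · exact ⟨j, hjm, by omega⟩
    refine ⟨_, mem_upShadow.2 ⟨⟨t, ht, k, hk, rfl⟩, fun q hq => ?_⟩⟩
    obtain rfl | hqk := eq_or_ne q k
    · simp [hk0]
    · simpa [hqk] using ht'.2.2 q hq
  · have hmax : ∀ k ∈ ({i, j} : Finset ℕ), k ≤ j := by
      intro k hk
      simp only [Finset.mem_insert, Finset.mem_singleton] at hk
      omega
    have her : ({i, j} : Finset ℕ).erase j = {i} := by
      ext q
      simp only [Finset.mem_erase, Finset.mem_insert, Finset.mem_singleton]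
      omega
    rw [hL.isStable.card_upShadow hL.subset hjm hmax, if_neg hjb.not_gt, hc, her]
    have hsub := upShadow_subset_sqMon (her ▸ slice_subset hL.subset hjm 0)
    have hTs : T.map (addRightEmbedding (Finsupp.single j 1)) ⊆ upShadow b {i, j} T := by
      intro m hm
      rw [Finset.mem_map] at hm
      obtain ⟨t, ht, rfl⟩ := hm
      refine mem_upShadow.2 ⟨⟨t, ht, j, hjm, rfl⟩, fun q hq => ?_⟩
      have hqj : q ≠ j := by omega
      simpa [hqj] using (mem_sqMon.1 (hT ht)).2.2 q hq
    obtain h0 | ⟨y, hy⟩ := (upShadow b {i} (slice j 0 L)).eq_empty_or_nonempty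
    · rw [h0, Finset.card_empty, zero_add,
        ← Finset.card_map (addRightEmbedding (Finsupp.single j 1))]
      exact Finset.card_le_card hTs
    have hib : b ≤ i := by
      by_contra! hib
      have hy' := hsub hy
      rw [mem_sqMon_iff_sum, Finset.sum_singleton] at hy'
      have := hy'.2.2 i hib
      omega
    obtain ⟨t, ht, htmax⟩ := T.exists_max_image (fun t => t i) hne
    have hti : t + Finsupp.single i 1 ∉ T.map (addRightEmbedding (Finsupp.single j 1)) := by
      rw [Finset.mem_map]
      rintro ⟨t', ht', h⟩
      have h1 := DFunLike.congr_fun h i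
      simp only [addRightEmbedding_apply, Finsupp.add_apply, Finsupp.single_eq_same,
        Finsupp.single_eq_of_ne hij.ne] at h1
      have := htmax t' ht'
      omega
    refine (add_le_add_left ((Finset.card_le_card hsub).trans (card_sqMon_singleton_le i)) _).trans
      ?_
    rw [add_comm, ← Finset.card_map (addRightEmbedding (Finsupp.single j 1)),
      ← Finset.card_insert_of_notMem hti]
    refine Finset.card_le_card (Finset.insert_subset (mem_upShadow.2
      ⟨⟨t, ht, i, him, rfl⟩, fun q hq => ?_⟩) hTs)
    have hqi : q ≠ i := by omega
    simpa [hqi] using (mem_sqMon.1 (hT ht)).2.2 q hq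

/-- The Clements–Lindström theorem for the exponent bounds `1, …, 1, ∞, …, ∞`. -/
theorem lexShadowLe (b : ℕ) (s : Finset ℕ) : LexShadowLe b s := by
  induction hN : s.card using Nat.strong_induction_on generalizing s with
  | _ N ih =>
    subst hN
    obtain hs | hs := le_or_gt 3 s.card
    · exact LexShadowLe.of_erase hs fun k hk => ih _ (Finset.card_erase_lt_of_mem hk) _ rfl
    intro d T hT
    obtain rfl | hd := eq_or_ne d 0
    · exact exists_isLexUpper_of_card_le_one card_sqMon_zero_le hT
    obtain hs0 | hs1 | hs2 : s.card = 0 ∨ s.card = 1 ∨ s.card = 2 := by omega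
    · refine exists_isLexUpper_of_card_le_one ?_ hT
      rw [Finset.card_eq_zero.1 hs0]
      refine Finset.card_le_one.2 fun m hm m' hm' => ?_
      rw [mem_sqMon_iff_sum] at hm hm'
      ext q
      rw [hm.2.1 q (Finset.notMem_empty q), hm'.2.1 q (Finset.notMem_empty q)]
    · obtain ⟨i, rfl⟩ := Finset.card_eq_one.1 hs1
      exact exists_isLexUpper_of_card_le_one (card_sqMon_singleton_le i) hT
    · obtain ⟨i, j, hij, rfl⟩ : ∃ i j, i < j ∧ s = {i, j} := by
        obtain ⟨i, j, hij, rfl⟩ := Finset.card_eq_two.1 hs2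
        obtain h | h := lt_or_gt_of_ne hij
        · exact ⟨i, j, h, rfl⟩
        · exact ⟨j, i, h, Finset.pair_comm i j⟩
      obtain ⟨L, hL, hc⟩ := exists_isLexUpper_card (Finset.card_le_card hT)
      refine ⟨L, hL, hc, ?_⟩
      obtain rfl | hne := T.eq_empty_or_nonempty
      · rw [Finset.card_eq_zero.1 hc]
      · exact card_upShadow_pair_le hij hd hL hT hc hne

end ClementsLindstrom

section NatExp

variable {b d n : ℕ}

/-- An exponent vector in `n` variables, extended by zero to a vector indexed by `ℕ`. -/
noncomputable def natExp (m : Fin n →₀ ℕ) : ℕ →₀ ℕ := m.mapDomain Fin.val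

@[simp]
lemma natExp_apply (m : Fin n →₀ ℕ) (i : Fin n) : natExp m i = m i :=
  Finsupp.mapDomain_apply Fin.val_injective m i

lemma natExp_of_le (m : Fin n →₀ ℕ) {q : ℕ} (hq : n ≤ q) : natExp m q = 0 :=
  Finsupp.mapDomain_of_notMem_range m q fun ⟨i, hi⟩ => by omega

lemma natExp_injective : Function.Injective (natExp (n := n)) :=
  Finsupp.mapDomain_injective Fin.val_injective

@[simp]
lemma natExp_add_single (m : Fin n →₀ ℕ) (i : Fin n) :
    natExp (m + Finsupp.single i 1) = natExp m + Finsupp.single (i : ℕ) 1 := by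
  rw [natExp, Finsupp.mapDomain_add, Finsupp.mapDomain_single, natExp]

lemma exists_natExp_eq {v : ℕ →₀ ℕ} (hv : ∀ i ∉ Finset.range n, v i = 0) :
    ∃ m : Fin n →₀ ℕ, natExp m = v := by
  refine ⟨Finsupp.equivFunOnFinite.symm fun i => v i, Finsupp.ext fun q => ?_⟩
  obtain hq | hq := lt_or_ge q n
  · exact natExp_apply _ ⟨q, hq⟩
  · rw [natExp_of_le _ hq, hv q (by simpa using hq)]

lemma natExp_mem_sqMon (hb : b ≤ n) {m : Fin n →₀ ℕ} :
    natExp m ∈ sqMon b (Finset.range n) d ↔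
      expDeg m = d ∧ ∀ i : Fin b, m (Fin.castLE hb i) ≤ 1 := by
  rw [mem_sqMon_iff_sum, Finset.sum_range]
  simp only [natExp_apply]
  refine and_congr_right fun _ => ⟨fun h i => ?_, fun h => ⟨fun q hq => ?_, fun q hq => ?_⟩⟩
  · rw [← natExp_apply]
    exact h.2 _ i.2
  · exact natExp_of_le m (by simpa using hq)
  · have := h ⟨q, hq⟩
    rwa [← natExp_apply] at this

lemma natExp_mem_sqMon_zero {m : Fin n →₀ ℕ} :
    natExp m ∈ sqMon 0 (Finset.range n) d ↔ expDeg m = d := by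
  rw [natExp_mem_sqMon (Nat.zero_le n)]
  exact and_iff_left fun i => i.elim0

lemma toLex_natExp_le_of_lexLe {m m' : Fin n →₀ ℕ} (h : lexLe m m') :
    toLex (natExp m) ≤ toLex (natExp m') := by
  obtain rfl | ⟨i, hi, hlt⟩ := h
  · exact le_rfl
  · refine (toLex_lt_iff.2 ⟨i, fun q hq => ?_, by simpa using hlt⟩).le
    have := hi ⟨q, hq.trans i.2⟩ hq
    rwa [← natExp_apply, ← natExp_apply] at this

lemma IsLexUpper.isLexSegment {U : Finset (ℕ →₀ ℕ)} (hU : IsLexUpper 0 (Finset.range n) d U) :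
    IsLexSegment n d {m | natExp m ∈ U} :=
  ⟨fun _ hm => natExp_mem_sqMon_zero.1 (hU.subset hm), fun _ hm _ hm' hle =>
    hU.mem_of_le _ hm _ (natExp_mem_sqMon_zero.2 hm') (toLex_natExp_le_of_lexLe hle)⟩

lemma expDeg_mono {m m' : Fin n →₀ ℕ} (h : m ≤ m') : expDeg m ≤ expDeg m' :=
  Finset.sum_le_sum fun i _ => h i

lemma expDeg_eq_degree (m : Fin n →₀ ℕ) : expDeg m = m.degree :=
  (Finsupp.degree_eq_sum m).symm

lemma expDeg_add (m m' : Fin n →₀ ℕ) : expDeg (m + m') = expDeg m + expDeg m' := by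
  simp only [expDeg_eq_degree, map_add]

lemma natExp_mem_upShadow {U : Finset (ℕ →₀ ℕ)} {m : Fin n →₀ ℕ} :
    natExp m ∈ upShadow b (Finset.range n) U ↔
      (∃ t i, natExp t ∈ U ∧ t + Finsupp.single i 1 = m) ∧ ∀ i < b, natExp m i ≤ 1 := by
  rw [mem_upShadow]
  refine and_congr_left fun _ => ⟨?_, ?_⟩
  · rintro ⟨t, ht, i, hi, h⟩
    obtain ⟨t, rfl⟩ : ∃ t' : Fin n →₀ ℕ, natExp t' = t := by
      refine exists_natExp_eq fun q hq => ?_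
      have h1 := DFunLike.congr_fun h q
      rw [natExp_of_le m (by simpa using hq), Finsupp.add_apply] at h1
      omega
    exact ⟨t, ⟨i, Finset.mem_range.1 hi⟩, ht, natExp_injective (by simpa using h)⟩
  · rintro ⟨t, i, ht, rfl⟩
    exact ⟨_, ht, i, Finset.mem_range.2 i.2, by simp⟩

lemma exists_le_iff_mem {S : Set (Fin n →₀ ℕ)} (hS : ∀ μ ∈ S, expDeg μ = d)
    {m : Fin n →₀ ℕ} (hm : expDeg m = d) : (∃ μ ∈ S, μ ≤ m) ↔ m ∈ S := by
  refine ⟨fun ⟨μ, hμ, hle⟩ => ?_, fun h => ⟨m, h, le_rfl⟩⟩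
  have := hS μ hμ
  rw [expDeg_eq_degree] at hm this
  obtain ⟨c, rfl⟩ := exists_add_of_le hle
  rw [map_add, this, Nat.add_eq_left, Finsupp.degree_eq_zero_iff] at hm
  rwa [hm, add_zero]

lemma exists_le_iff_exists_add_single {S : Set (Fin n →₀ ℕ)} (hS : ∀ μ ∈ S, expDeg μ = d)
    {k : ℕ} {m : Fin n →₀ ℕ} (hm : expDeg m = d + k + 1) :
    (∃ μ ∈ S, μ ≤ m) ↔ ∃ t i, (∃ μ ∈ S, μ ≤ t) ∧ t + Finsupp.single i 1 = m := by
  constructor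
  · rintro ⟨μ, hμ, hle⟩
    obtain ⟨c, rfl⟩ := exists_add_of_le hle
    rw [expDeg_add, hS μ hμ] at hm
    obtain ⟨i, hi⟩ : ∃ i, c i ≠ 0 := by
      by_contra! hc
      have : expDeg c = 0 := Finset.sum_eq_zero fun i _ => hc i
      omega
    obtain ⟨c, rfl⟩ : ∃ c', c = c' + Finsupp.single i 1 :=
      ⟨c - Finsupp.single i 1, (tsub_add_cancel_of_le (by
        rw [Finsupp.single_le_iff]; omega)).symm⟩
    exact ⟨μ + c, i, ⟨μ, hμ, le_self_add⟩, add_assoc _ _ _⟩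
  · rintro ⟨t, i, ⟨μ, hμ, hle⟩, rfl⟩
    exact ⟨μ, hμ, hle.trans le_self_add⟩

lemma IsLexUpper.exists_isLexUpper_multiples {U : Finset (ℕ →₀ ℕ)}
    (hU : IsLexUpper 0 (Finset.range n) d U) (k : ℕ) :
    ∃ V, IsLexUpper 0 (Finset.range n) (d + k) V ∧ ∀ m : Fin n →₀ ℕ, natExp m ∈ V ↔
      expDeg m = d + k ∧ ∃ μ ∈ {μ : Fin n →₀ ℕ | natExp μ ∈ U}, μ ≤ m := by
  have hS : ∀ μ ∈ {μ : Fin n →₀ ℕ | natExp μ ∈ U}, expDeg μ = d :=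
    fun μ hμ => natExp_mem_sqMon_zero.1 (hU.subset hμ)
  induction k with
  | zero =>
    refine ⟨U, hU, fun m => ⟨fun hm => ⟨hS m hm, m, hm, le_rfl⟩, fun ⟨hm, h⟩ => ?_⟩⟩
    exact (exists_le_iff_mem hS hm).1 h
  | succ k ih =>
    obtain ⟨V, hV, h⟩ := ih
    refine ⟨_, hV.upShadow, fun m => ?_⟩
    constructor
    · intro hm
      have hdeg := natExp_mem_sqMon_zero.1 (hV.upShadow.subset hm)
      refine ⟨hdeg, (exists_le_iff_exists_add_single hS hdeg).2 ?_⟩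
      obtain ⟨⟨t, i, ht, hti⟩, -⟩ := natExp_mem_upShadow.1 hm
      exact ⟨t, i, ((h t).1 ht).2, hti⟩
    · rintro ⟨hdeg, hm⟩
      obtain ⟨t, i, ht, rfl⟩ := (exists_le_iff_exists_add_single hS hdeg).1 hm
      refine natExp_mem_upShadow.2 ⟨⟨t, i, (h t).2 ⟨?_, ht⟩, rfl⟩,
        fun i hi => absurd hi i.not_lt_zero⟩
      simp only [expDeg_eq_degree, map_add, Finsupp.degree_single] at hdeg ⊢
      omega

lemma IsLexUpper.isLexSegment_multiples {U : Finset (ℕ →₀ ℕ)}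
    (hU : IsLexUpper 0 (Finset.range n) d U) (e : ℕ) :
    IsLexSegment n e {m | expDeg m = e ∧ ∃ μ ∈ {μ : Fin n →₀ ℕ | natExp μ ∈ U}, μ ≤ m} := by
  obtain he | he := lt_or_ge e d
  · have h : ∀ m : Fin n →₀ ℕ,
        ¬ (expDeg m = e ∧ ∃ μ ∈ {μ : Fin n →₀ ℕ | natExp μ ∈ U}, μ ≤ m) := by
      rintro m ⟨hm, μ, hμ, hle⟩
      have h1 := expDeg_mono hle
      rw [natExp_mem_sqMon_zero.1 (hU.subset hμ)] at h1
      omega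
    exact ⟨fun m hm => hm.1, fun m hm => absurd hm (h m)⟩
  · obtain ⟨k, rfl⟩ := Nat.exists_eq_add_of_le he
    obtain ⟨V, hV, h⟩ := hU.exists_isLexUpper_multiples k
    have := hV.isLexSegment
    simp only [h] at this
    exact this

end NatExp

section MonomialIdeal

variable {K : Type*} [Field K] {n : ℕ}

lemma isHomog_span_monomial (M : Set (Fin n →₀ ℕ)) :
    IsHomog (Ideal.span ((fun m => monomial m (1 : K)) '' M)) := by
  intro f hf d
  rw [mem_ideal_span_monomial_image] at hf ⊢
  intro m hm
  refine hf m ?_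
  rw [mem_support_iff, coeff_homogeneousComponent] at hm
  rw [mem_support_iff]
  exact fun h => hm (by simp [h])

lemma component_span_monomial (M : Set (Fin n →₀ ℕ)) (e : ℕ) :
    component (Ideal.span ((fun m => monomial m (1 : K)) '' M)) e =
      restrictSupport K {m | expDeg m = e ∧ ∃ μ ∈ M, μ ≤ m} := by
  ext f
  rw [component, Submodule.mem_inf, Submodule.restrictScalars_mem, mem_ideal_span_monomial_image,
    mem_homogeneousSubmodule, mem_restrictSupport_iff]
  constructor
  · rintro ⟨h1, h2⟩ m hm
    refine ⟨?_, h1 m hm⟩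
    rw [expDeg_eq_degree, Finsupp.degree_eq_weight_one]
    exact h2 (mem_support_iff.1 hm)
  · intro h
    refine ⟨fun m hm => (h hm).2, fun m hm => ?_⟩
    have := (h (mem_support_iff.2 hm)).1
    rwa [expDeg_eq_degree, Finsupp.degree_eq_weight_one] at this

lemma restrictSupport_union (s t : Set (Fin n →₀ ℕ)) :
    restrictSupport K (s ∪ t) = restrictSupport K s ⊔ restrictSupport K t := by
  simp only [restrictSupport_eq_span, Set.image_union, Submodule.span_union]

lemma finrank_restrictSupport (s : Set (Fin n →₀ ℕ)) :
    Module.finrank K (restrictSupport K s) = s.ncard :=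
  Module.finrank_eq_nat_card_basis (basisRestrictSupport K s)

lemma finite_setOf_expDeg_eq (n e : ℕ) : {m : Fin n →₀ ℕ | expDeg m = e}.Finite := by
  refine Set.Finite.subset (((sqMon 0 (Finset.range n) e).finite_toSet).preimage
    natExp_injective.injOn) fun m hm => ?_
  exact natExp_mem_sqMon_zero.2 hm

lemma finrank_homogeneousSubmodule (e : ℕ) :
    Module.finrank K (homogeneousSubmodule (Fin n) K e) =
      {m : Fin n →₀ ℕ | expDeg m = e}.ncard := by
  rw [← finrank_restrictSupport (K := K)]
  have h := component_span_monomial (K := K) ({0} : Set (Fin n →₀ ℕ)) e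
  simp only [Set.image_singleton, Set.mem_singleton_iff, exists_eq_left, zero_le, and_true] at h
  rw [← h, component, show monomial (0 : Fin n →₀ ℕ) (1 : K) = 1 from rfl, Ideal.span_singleton_one,
    Submodule.restrictScalars_top, top_inf_eq]

lemma purePowers_two_eq_span {b : ℕ} (hb : b ≤ n) : purePowers K hb (fun _ => 2) =
    Ideal.span ((fun m => monomial m (1 : K)) ''
      Set.range fun i : Fin b => Finsupp.single (Fin.castLE hb i) 2) := by
  rw [purePowers, ← Set.range_comp]
  congr 2
  ext i
  simp [X_pow_eq_monomial]

lemma isLPP_span_monomial_sup {b d : ℕ} (hb : b ≤ n) {U : Finset (ℕ →₀ ℕ)}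
    (hU : IsLexUpper 0 (Finset.range n) d U) :
    IsLPP hb (fun _ => 2) (Ideal.span ((fun m => monomial m (1 : K)) ''
      {μ : Fin n →₀ ℕ | natExp μ ∈ U}) ⊔ purePowers K hb (fun _ => 2)) := by
  rw [purePowers_two_eq_span]
  refine ⟨(isHomog_span_monomial _).sup (isHomog_span_monomial _), fun e =>
    ⟨_, hU.isLexSegment_multiples e, ?_⟩⟩
  rw [← restrictSupport_eq_span, ← Ideal.span_union, ← Set.image_union, component_span_monomial,
    purePowers_two_eq_span, component_span_monomial, ← restrictSupport_union]
  congr 1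
  ext m
  simp only [Set.mem_ofPred_eq, Set.mem_union, or_and_right, exists_or, and_or_left]

lemma hilb_span_monomial_sup {b e : ℕ} (hb : b ≤ n) {S : Set (Fin n →₀ ℕ)}
    {N : Finset (ℕ →₀ ℕ)} (hN : N ⊆ sqMon b (Finset.range n) e)
    (h : ∀ m, natExp m ∈ sqMon b (Finset.range n) e → ((∃ μ ∈ S, μ ≤ m) ↔ natExp m ∈ N)) :
    hilb (Ideal.span ((fun m => monomial m (1 : K)) '' S) ⊔ purePowers K hb (fun _ => 2)) e +
      (sqMon b (Finset.range n) e).card =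
        Module.finrank K (homogeneousSubmodule (Fin n) K e) + N.card := by
  rw [purePowers_two_eq_span]
  set Q := Set.range fun i : Fin b => (Finsupp.single (Fin.castLE hb i) 2 : Fin n →₀ ℕ)
  have hsub : {m | expDeg m = e ∧ ∃ μ ∈ S ∪ Q, μ ≤ m} ⊆ {m : Fin n →₀ ℕ | expDeg m = e} :=
    fun m hm => hm.1
  have hcompl : {m : Fin n →₀ ℕ | expDeg m = e} \ {m | expDeg m = e ∧ ∃ μ ∈ S ∪ Q, μ ≤ m} =
      natExp ⁻¹' ((sqMon b (Finset.range n) e \ N : Finset _) : Set (ℕ →₀ ℕ)) := by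
    ext m
    have hQ : (∃ μ ∈ Q, μ ≤ m) ↔ ¬ ∀ i : Fin b, m (Fin.castLE hb i) ≤ 1 := by
      simp only [Q, Set.exists_range_iff, Finsupp.single_le_iff, not_forall, not_le]
      rfl
    have hm := h m
    rw [natExp_mem_sqMon hb] at hm
    simp only [Set.mem_sdiff, Set.mem_ofPred_eq, Set.mem_union, or_and_right, exists_or, hQ,
      Set.mem_preimage, Finset.mem_coe, Finset.mem_sdiff, natExp_mem_sqMon hb]
    generalize (∀ i : Fin b, m (Fin.castLE hb i) ≤ 1) = P at hm ⊢
    generalize (∃ μ ∈ S, μ ≤ m) = R at hm ⊢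
    tauto
  have hcard := Set.ncard_sdiff_add_ncard_of_subset hsub (finite_setOf_expDeg_eq n e)
  rw [hcompl, Set.ncard_preimage_of_injective_subset_range natExp_injective, Set.ncard_coe_finset,
    Finset.card_sdiff_of_subset hN] at hcard
  · rw [← Ideal.span_union, ← Set.image_union, hilb,
      component_span_monomial, finrank_restrictSupport, finrank_homogeneousSubmodule, ← hcard]
    have := Finset.card_le_card hN
    omega
  · intro v hv
    obtain ⟨m, rfl⟩ := exists_natExp_eq
      (mem_sqMon.1 (Finset.mem_sdiff.1 (Finset.mem_coe.1 hv)).1).2.1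
    exact ⟨m, rfl⟩

end MonomialIdeal

/-- **Güntürkün–Hochster.** A homogeneous ideal `I ⊆ K[x_1,…,x_n]` containing a homogeneous
regular sequence of five quadrics satisfies `EGH_{(2,2,2,2,2)}`. -/
theorem gunturkun_hochster {K : Type*} [Field K] {n : ℕ} (h5n : 5 ≤ n)
    (I : Ideal (MvPolynomial (Fin n) K)) (hI : IsHomog I)
    (hreg : ContainsRegSeq (fun _ : Fin 5 => 2) I) :
    EGH h5n (fun _ : Fin 5 => 2) I := by
  intro d
  obtain ⟨T, hT, hcT, hsT⟩ := exists_sqMon_subset h5n hI hreg d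
  obtain ⟨L, hL, hcL, hsL⟩ := lexShadowLe 5 (Finset.range n) d T hT
  have hsq : sqMon 5 (Finset.range n) d ⊆ sqMon 0 (Finset.range n) d := fun m hm =>
    mem_sqMon.2 ⟨(mem_sqMon.1 hm).1, (mem_sqMon.1 hm).2.1, fun i hi => absurd hi i.not_lt_zero⟩
  set U := (sqMon 0 (Finset.range n) d).filter fun m => ∃ l ∈ L, toLex l ≤ toLex m
  have hU : IsLexUpper 0 (Finset.range n) d U := by
    refine ⟨Finset.filter_subset _ _, fun m hm m' hm' hle => ?_⟩
    obtain ⟨-, l, hl, hlm⟩ := Finset.mem_filter.1 hm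
    exact Finset.mem_filter.2 ⟨hm', l, hl, hlm.trans hle⟩
  have hLU : ∀ m ∈ sqMon 5 (Finset.range n) d, m ∈ U ↔ m ∈ L := by
    intro m hm
    rw [Finset.mem_filter]
    constructor
    · rintro ⟨-, l, hl, hle⟩
      exact hL.mem_of_le l hl m hm hle
    · exact fun hmL => ⟨hsq hm, m, hmL, le_rfl⟩
  have hS : ∀ μ ∈ {μ : Fin n →₀ ℕ | natExp μ ∈ U}, expDeg μ = d :=
    fun μ hμ => natExp_mem_sqMon_zero.1 (hU.subset hμ)
  refine ⟨_, isLPP_span_monomial_sup h5n hU, ?_, ?_⟩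
  · have h := hilb_span_monomial_sup (K := K) h5n hL.subset
      (S := {μ : Fin n →₀ ℕ | natExp μ ∈ U}) fun m hm => by
        rw [exists_le_iff_mem hS (natExp_mem_sqMon_zero.1 (hsq hm))]
        exact hLU _ hm
    have := hilbCodim_add_hilb I d
    omega
  · have h := hilb_span_monomial_sup (K := K) h5n (upShadow_subset_sqMon hL.subset)
      (S := {μ : Fin n →₀ ℕ | natExp μ ∈ U}) fun m hm => by
        have hb := (mem_sqMon.1 hm).2.2
        rw [exists_le_iff_exists_add_single hS (k := 0) ((natExp_mem_sqMon h5n).1 hm).1,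
          natExp_mem_upShadow, and_iff_left hb]
        refine exists_congr fun t => exists_congr fun i => and_congr_left ?_
        rintro rfl
        have ht : natExp t ∈ sqMon 5 (Finset.range n) d := by
          obtain ⟨h1, h2⟩ := (natExp_mem_sqMon h5n).1 hm
          refine (natExp_mem_sqMon h5n).2 ⟨?_, fun j => (Nat.le_add_right _ _).trans (h2 j)⟩
          simp only [expDeg_eq_degree, map_add, Finsupp.degree_single] at h1 ⊢
          omega
        rw [exists_le_iff_mem hS (natExp_mem_sqMon_zero.1 (hsq ht))]
        exact hLU _ ht
    have := hilbCodim_add_hilb I (d + 1)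
    omega
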